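/- arXiv:math/0608768 — 5 statements merged into one kernel-verified Lean document; each statement's English description precedes it below -/
import Mathlib

section
/- Let Σ be a finite type with decidable equality and I an irreflexive symmetric relation on Σ such that (Σ,I) is not a transitive forest. Then there exists a rational subset S of the graph group G(Σ,I), i.e. S = π '' L for some regular language L ⊆ List (Σ ⊕ Σ), such that the predicate on words w ↦ (π w ∈ S) is not computable (¬ ComputablePred). -/
/-- The relators of the graph group: commutators of independent generators. -/
def GraphGroupRels {S : Type} (I : S → S → Prop) : Set (FreeGroup S) :=
  { r | ∃ a b : S, I a b ∧
      r = FreeGroup.of a * FreeGroup.of b * (FreeGroup.of a)⁻¹ * (FreeGroup.of b)⁻¹ }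

/-- The graph group of an independence alphabet. -/
abbrev GraphGroup {S : Type} (I : S → S → Prop) : Type :=
  PresentedGroup (GraphGroupRels I)

/-- Evaluation homomorphism from the free monoid on `S ⊕ S` to the graph group,
sending `inl a` to the generator `a` and `inr a` to its inverse. -/
noncomputable def graphEval {S : Type} (I : S → S → Prop) :
    FreeMonoid (S ⊕ S) →* GraphGroup I :=
  FreeMonoid.lift (Sum.elim
    (fun a => (PresentedGroup.of (rels := GraphGroupRels I) a))
    (fun a => (PresentedGroup.of (rels := GraphGroupRels I) a)⁻¹))

/-- `(S, I)` is a transitive forest: there is a strict partial order whose strict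
down-sets are linearly ordered, realizing `I` as the comparability relation. -/
def IsTransitiveForest {S : Type} (I : S → S → Prop) : Prop :=
  ∃ r : S → S → Prop, IsStrictOrder S r ∧
    (∀ a b c : S, r b a → r c a → (r b c ∨ b = c ∨ r c b)) ∧
    (∀ a b : S, I a b ↔ (a ≠ b ∧ (r a b ∨ r b a)))

/-- Any finite type with decidable equality is primcodable. -/
noncomputable instance (priority := 50) fintypePrimcodable {α : Type} [Fintype α] [DecidableEq α] :
    Primcodable α :=
  Primcodable.ofEquiv (Fin (Fintype.card α)) (Fintype.equivFin α)

section TransitiveForests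

/-- An independence alphabet that is not a transitive forest contains an induced path or cycle on
four vertices. -/
theorem exists_path_of_not_isTransitiveForest {S : Type} [Fintype S] {I : S → S → Prop}
    (hirr : ∀ a, ¬ I a a) (hsym : ∀ a b, I a b → I b a) (h : ¬ IsTransitiveForest I) :
    ∃ a b c d, I a b ∧ I b c ∧ I c d ∧ ¬ I a c ∧ ¬ I b d ∧ a ≠ c ∧ b ≠ d := by
  by_contra! hno
  apply h
  let N (a : S) : Set S := {x | x = a ∨ I a x}
  have hN : ∀ a b, I a b → N a ⊆ N b ∨ N b ⊆ N a := by
    intro x y hxy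
    by_contra! hc
    obtain ⟨h₁, h₂⟩ := hc
    obtain ⟨u, hu, hu'⟩ := Set.not_subset.1 h₁
    obtain ⟨v, hv, hv'⟩ := Set.not_subset.1 h₂
    simp only [N, Set.mem_ofPred_eq, not_or] at hu hu' hv hv'
    have hux : I u x := hu.elim (fun e => absurd (e ▸ hsym _ _ hxy) hu'.2) (hsym _ _)
    have hyv : I y v := hv.elim (fun e => absurd (e ▸ hxy) hv'.2) id
    exact hv'.1 (hno u x y v hux hxy hyv (fun h => hu'.2 (hsym _ _ h)) hv'.2 hu'.1).symm
  let i : S → ℕ := fun a => Fintype.equivFin S a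
  have hi : Function.Injective i := Fin.val_injective.comp (Fintype.equivFin S).injective
  have hself : ∀ a, a ∈ N a := fun a => .inl rfl
  let r (a b : S) : Prop := I a b ∧ N b ⊆ N a ∧ (N a ⊆ N b → i a < i b)
  have htri : ∀ a b, I a b → r a b ∨ r b a := by
    intro a b hab
    by_cases h₁ : N b ⊆ N a <;> by_cases h₂ : N a ⊆ N b
    · rcases lt_trichotomy (i a) (i b) with hl | hl | hl
      · exact .inl ⟨hab, h₁, fun _ => hl⟩
      · exact absurd (hi hl ▸ hab) (hirr _)
      · exact .inr ⟨hsym _ _ hab, h₂, fun _ => hl⟩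
    · exact .inl ⟨hab, h₁, fun h => absurd h h₂⟩
    · exact .inr ⟨hsym _ _ hab, h₂, fun h => absurd h h₁⟩
    · exact absurd (hN a b hab) (by tauto)
  refine ⟨r, { irrefl := fun a ha => hirr a ha.1, trans := ?_ }, ?_, ?_⟩
  · rintro a b c ⟨hab, hba, h₁⟩ ⟨hbc, hcb, h₂⟩
    have hlt : N a ⊆ N c → i a < i c := fun hac =>
      (h₁ (hac.trans hcb)).trans (h₂ (hba.trans hac))
    refine ⟨?_, hcb.trans hba, hlt⟩
    refine (hba (hcb (hself c))).resolve_left ?_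
    rintro rfl
    exact lt_irrefl _ (hlt subset_rfl)
  · rintro a b c ⟨hba, hab, -⟩ ⟨hca, hac, -⟩
    by_cases hbc : b = c
    · exact .inr (.inl hbc)
    · have : I c b := (hac (.inr (hsym _ _ hba))).resolve_left hbc
      exact (htri b c (hsym _ _ this)).imp_right .inr
  · intro a b
    refine ⟨fun hab => ⟨fun e => hirr _ (e ▸ hab), htri a b hab⟩, ?_⟩
    rintro ⟨-, h | h⟩
    exacts [h.1, hsym _ _ h.1]

end TransitiveForests

section LabelledPaths

/-- `LabelPath E v' v w` says that the graph with labelled edges `E` has a path from `v` to `v'`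
with label `w`. -/
inductive LabelPath {V α : Type} (E : Set (V × List α × V)) (v' : V) : V → List α → Prop
  | nil : LabelPath E v' v' []
  | cons {v w : V} {x y : List α} : (v, x, w) ∈ E → LabelPath E v' w y → LabelPath E v' v (x ++ y)

theorem LabelPath.exists_split {V α : Type} {E : Set (V × List α × V)} {v v' : V} {x y : List α}
    (h : LabelPath E v' v (x ++ y)) :
    ∃ s w, (([], v') = (s, w) ∨ ∃ e ∈ E, ∃ n ≤ e.2.1.length, (e.2.1.drop n, e.2.2) = (s, w)) ∧
      (∃ z, LabelPath E v' w z ∧ y = s ++ z) ∧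
      ∀ z, LabelPath E v' w z → LabelPath E v' v (x ++ (s ++ z)) := by
  generalize hu : x ++ y = u at h
  induction h generalizing x with
  | nil =>
    obtain ⟨rfl, rfl⟩ := List.append_eq_nil_iff.1 hu
    exact ⟨[], v', .inl rfl, ⟨[], .nil, rfl⟩, fun z hz => hz⟩
  | @cons v w u p he hp ih =>
    obtain ⟨s, rfl, rfl⟩ | ⟨x', rfl, hx'⟩ := List.append_eq_append_iff.1 hu
    · refine ⟨s, w, .inr ⟨_, he, x.length, by simp, by simp⟩, ⟨p, hp, rfl⟩, fun z hz => ?_⟩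
      rw [← List.append_assoc]
      exact .cons he hz
    · obtain ⟨s, w', hs, hy, hz⟩ := ih hx'.symm
      refine ⟨s, w', hs, hy, fun z h => ?_⟩
      rw [List.append_assoc]
      exact .cons he (hz z h)

/-- The labels of the paths between two vertices of a finite graph form a regular language. -/
theorem isRegular_labelPath {V α : Type} {E : Set (V × List α × V)} (hE : E.Finite) (v' v : V) :
    Language.IsRegular ({w | LabelPath E v' v w} : Language α) := by
  let Q : Set (List α × V) := {([], v')} ∪
    ⋃ e ∈ E, (fun n => (e.2.1.drop n, e.2.2)) '' Set.Iic e.2.1.length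
  have hQ : Q.Finite := (Set.finite_singleton _).union
    (hE.biUnion fun e _ => (Set.finite_Iic _).image _)
  apply Language.IsRegular.of_finite_range_leftQuotient
  refine (hQ.finite_subsets.image fun A : Set (List α × V) =>
    {y | ∃ q ∈ A, ∃ z, LabelPath E v' q.2 z ∧ y = q.1 ++ z}).subset ?_
  rintro _ ⟨x, rfl⟩
  refine ⟨{q ∈ Q | ∀ z, LabelPath E v' q.2 z → LabelPath E v' v (x ++ (q.1 ++ z))},
    fun _ h => h.1, ?_⟩
  ext y
  constructor
  · rintro ⟨q, ⟨-, hq⟩, z, hz, rfl⟩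
    exact hq z hz
  · intro h
    obtain ⟨s, w, hs, hy, hz⟩ := LabelPath.exists_split (show LabelPath E v' v (x ++ y) from h)
    refine ⟨(s, w), ⟨?_, hz⟩, hy⟩
    obtain hs | ⟨e, he, n, hn, hs⟩ := hs
    · exact .inl hs.symm
    · exact .inr (Set.mem_biUnion he ⟨n, hn, hs⟩)

end LabelledPaths

section AffineMachines

/-- A rule of an affine machine: in state `src` with counter value `p * t + r`, move to state `tgt`
with counter value `q * t + s`. -/
structure AffineRule (V : Type) where
  /-- source state -/
  src : V
  /-- target state -/
  tgt : V
  /-- slope on the input side -/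
  p : ℕ
  /-- slope on the output side -/
  q : ℕ
  /-- offset on the input side -/
  r : ℕ
  /-- offset on the output side -/
  s : ℕ

/-- One step of the affine machine with rule set `E`. -/
def AffineStep {V : Type} (E : Set (AffineRule V)) (x y : V × ℕ) : Prop :=
  ∃ e ∈ E, ∃ t, x = (e.src, e.p * t + e.r) ∧ y = (e.tgt, e.q * t + e.s)

/-- The affine machine with rule set `E` can move from `x` to the state `v`. -/
def AffineReaches {V : Type} (E : Set (AffineRule V)) (x : V × ℕ) (v : V) : Prop :=
  ∃ n, Relation.ReflTransGen (AffineStep E) x (v, n)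

theorem AffineReaches.head {V : Type} {E : Set (AffineRule V)} {x y : V × ℕ} {v : V}
    (h : AffineStep E x y) : AffineReaches E y v → AffineReaches E x v
  | ⟨n, hn⟩ => ⟨n, .head h hn⟩

/-- The rules replacing `α * u` by `β * u`, for `u` coprime to `m`. -/
def ratioRules {V : Type} (v : V) (α β m : ℕ) (w : V) : Set (AffineRule V) :=
  (fun ρ => ⟨v, w, α * m, β * m, α * ρ, β * ρ⟩) '' {ρ | ρ < m ∧ m.Coprime ρ}

theorem finite_ratioRules {V : Type} (v : V) (α β m : ℕ) (w : V) :
    (ratioRules v α β m w).Finite :=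
  ((Set.finite_lt_nat m).subset fun _ h => h.1).image _

theorem affineStep_ratioRules {V : Type} {v w : V} {α β m : ℕ} (hm : 0 < m) {x y : V × ℕ} :
    AffineStep (ratioRules v α β m w) x y ↔
      ∃ u, m.Coprime u ∧ x = (v, α * u) ∧ y = (w, β * u) := by
  constructor
  · rintro ⟨_, ⟨ρ, ⟨-, hρ⟩, rfl⟩, t, rfl, rfl⟩
    refine ⟨m * t + ρ, ?_, ?_, ?_⟩
    · simpa using hρ
    · simp only [Prod.mk.injEq, true_and]; ring
    · simp only [Prod.mk.injEq, true_and]; ring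
  · rintro ⟨u, hu, rfl, rfl⟩
    refine ⟨_, ⟨u % m, ⟨Nat.mod_lt _ hm, ?_⟩, rfl⟩, u / m, ?_, ?_⟩
    · rwa [Nat.Coprime, Nat.gcd_comm, ← Nat.gcd_rec]
    · simp only [mul_assoc, ← mul_add, Nat.div_add_mod]
    · simp only [mul_assoc, ← mul_add, Nat.div_add_mod]

end AffineMachines

section PositiveWords

theorem FreeGroup.prod_map_of_injective {α : Type} [DecidableEq α] :
    Function.Injective fun w : List α => (w.map FreeGroup.of).prod := by
  have h (w : List α) : (w.map FreeGroup.of).prod = FreeGroup.mk (w.map (·, true)) := by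
    induction w with
    | nil => rfl
    | cons a w ih => rw [List.map_cons, List.prod_cons, ih]; rfl
  intro w w' hw
  have hr (w : List α) : FreeGroup.reduce (w.map (·, true)) = w.map (·, true) := by
    refine FreeGroup.IsReduced.reduce_eq ?_
    rw [FreeGroup.IsReduced, List.isChain_map]
    exact (List.pairwise_of_forall fun _ _ _ => rfl).isChain
  simp only [h] at hw
  have := FreeGroup.reduce.sound hw
  rw [hr, hr] at this
  exact List.map_injective_iff.2 (fun a b hab => congrArg Prod.fst hab) this

/-- The product of the elements `x ^ n * y` over a list of natural numbers `n`. -/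
def blockProd {G : Type*} [Group G] (x y : G) (m : List ℕ) : G :=
  (m.map fun n => x ^ n * y).prod

@[simp]
theorem blockProd_nil {G : Type*} [Group G] (x y : G) : blockProd x y [] = 1 := rfl

@[simp]
theorem blockProd_cons {G : Type*} [Group G] (x y : G) (n : ℕ) (m : List ℕ) :
    blockProd x y (n :: m) = x ^ n * y * blockProd x y m := by
  simp [blockProd]

theorem blockProd_append {G : Type*} [Group G] (x y : G) (m m' : List ℕ) :
    blockProd x y (m ++ m') = blockProd x y m * blockProd x y m' := by
  simp [blockProd]

theorem flatMap_replicate_injective :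
    Function.Injective fun m : List ℕ => m.flatMap fun n => List.replicate n true ++ [false] := by
  intro m
  induction m with
  | nil => rintro (_ | ⟨n, m'⟩) h <;> simp_all
  | cons n m ih =>
    rintro (_ | ⟨n', m'⟩) h
    · simp at h
    · suffices n = n' ∧ m = m' by rw [this.1, this.2]
      simp only [List.flatMap_cons, List.append_assoc, List.singleton_append] at h
      induction n generalizing n' with
      | zero =>
        cases n' with
        | zero => exact ⟨rfl, ih (by simpa using h)⟩
        | succ n' => simp [List.replicate_succ] at h
      | succ n ihn =>
        cases n' with
        | zero => simp [List.replicate_succ] at h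
        | succ n' =>
          rw [List.replicate_succ, List.replicate_succ, List.cons_append, List.cons_append,
            List.cons.injEq] at h
          exact (ihn n' h.2).imp (congrArg _) id

theorem blockProd_of_injective :
    Function.Injective (blockProd (FreeGroup.of true) (FreeGroup.of false)) := by
  have h (m : List ℕ) : blockProd (FreeGroup.of true) (FreeGroup.of false) m =
      ((m.flatMap fun n => List.replicate n true ++ [false]).map FreeGroup.of).prod := by
    induction m with
    | nil => rfl
    | cons n m ih => rw [blockProd_cons, ih]; simp [mul_assoc]
  intro m m' hm
  rw [h, h] at hm
  exact flatMap_replicate_injective (FreeGroup.prod_map_of_injective hm)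

end PositiveWords

section GraphGroups

variable {S : Type} {I : S → S → Prop}

theorem commute_of_independent {a b : S} (h : I a b) :
    Commute (PresentedGroup.of (rels := GraphGroupRels I) a) (PresentedGroup.of b) := by
  have := PresentedGroup.one_of_mem (rels := GraphGroupRels I) ⟨a, b, h, rfl⟩
  simp only [map_mul, map_inv] at this
  rwa [mul_inv_eq_one, mul_inv_eq_iff_eq_mul] at this

/-- Non-adjacent generators freely generate: there is a projection to the free group on two
generators killing all other generators. -/
theorem exists_projection (hirr : ∀ a, ¬ I a a) (hsym : ∀ a b, I a b → I b a) {x y : S}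
    (hxy : x ≠ y) (h : ¬ I x y) :
    ∃ φ : GraphGroup I →* FreeGroup Bool,
      φ (PresentedGroup.of x) = FreeGroup.of true ∧ φ (PresentedGroup.of y) = FreeGroup.of false ∧
      ∀ z, z ≠ x → z ≠ y → φ (PresentedGroup.of z) = 1 := by
  classical
  let f (z : S) : FreeGroup Bool :=
    if z = x then FreeGroup.of true else if z = y then FreeGroup.of false else 1
  have hf : ∀ r ∈ GraphGroupRels I, FreeGroup.lift f r = 1 := by
    rintro _ ⟨a, b, hab, rfl⟩
    simp only [map_mul, map_inv, FreeGroup.lift_apply_of]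
    rw [mul_inv_eq_one, mul_inv_eq_iff_eq_mul]
    have h₁ : ¬ I y x := fun h' => h (hsym _ _ h')
    have := hirr a
    simp only [f]
    split_ifs <;> simp_all
  refine ⟨PresentedGroup.toGroup hf, ?_, ?_, fun z hx hy => ?_⟩
  · simp [f]
  · simp [f, hxy.symm]
  · simp [f, hx, hy]

end GraphGroups

section AffineGraphs

/-- Vertices of the graph of words attached to an affine machine. -/
inductive AffineVertex (V : Type) : Type
  /-- a state of the machine -/
  | state (v : V)
  /-- a rule is being executed -/
  | rule (e : AffineRule V)
  /-- the final state has been reached -/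
  | fin
  /-- the boundary of two blocks of the comparison word -/
  | pop
  /-- the interior of a block of the comparison word -/
  | dec

/-- The graph of words attached to the affine machine with rules `E` and final state `vf`. -/
def affineGraph {V S : Type} (E : Set (AffineRule V)) (vf : V) (a b c d : S) :
    Set (AffineVertex V × List (S ⊕ S) × AffineVertex V) :=
  (⋃ e ∈ E, {(.state e.src, List.replicate e.r (.inl b) ++ List.replicate e.s (.inl c), .rule e),
    (.rule e, List.replicate e.p (.inl b) ++ List.replicate e.q (.inl c), .rule e),
    (.rule e, [.inl d, .inl a], .state e.tgt)}) ∪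
  {(.state vf, [], .fin), (.fin, [.inl b], .fin), (.fin, [.inl d], .pop),
    (.pop, [.inr d, .inr a], .dec), (.dec, [.inr b, .inr c], .dec), (.dec, [], .pop)}

theorem finite_affineGraph {V S : Type} {E : Set (AffineRule V)} (hE : E.Finite) (vf : V)
    (a b c d : S) : (affineGraph E vf a b c d).Finite :=
  (hE.biUnion fun _ _ => Set.toFinite _).union (Set.toFinite _)

/-- Evaluation of words in the generators and their inverses. -/
def wordEval {S G : Type} [Group G] (f : S → G) (w : List (S ⊕ S)) : G :=
  (w.map (Sum.elim f fun x => (f x)⁻¹)).prod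

section WordEval

variable {S G : Type} [Group G] (f : S → G)

@[simp]
theorem wordEval_nil : wordEval f [] = 1 := rfl

@[simp]
theorem wordEval_cons_inl (x : S) (w : List (S ⊕ S)) :
    wordEval f (.inl x :: w) = f x * wordEval f w := by
  simp [wordEval]

@[simp]
theorem wordEval_cons_inr (x : S) (w : List (S ⊕ S)) :
    wordEval f (.inr x :: w) = (f x)⁻¹ * wordEval f w := by
  simp [wordEval]

@[simp]
theorem wordEval_append (w w' : List (S ⊕ S)) :
    wordEval f (w ++ w') = wordEval f w * wordEval f w' := by
  simp [wordEval]

@[simp]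
theorem wordEval_replicate_inl (x : S) (n : ℕ) :
    wordEval f (List.replicate n (.inl x)) = f x ^ n := by
  simp [wordEval]

@[simp]
theorem wordEval_replicate_inr (x : S) (n : ℕ) :
    wordEval f (List.replicate n (.inr x)) = (f x ^ n)⁻¹ := by
  simp [wordEval]

end WordEval

/-- The sequences of pairs (counter before, counter after) along runs of an affine machine, without
the requirement that consecutive steps match. -/
inductive LooseRun {V : Type} (E : Set (AffineRule V)) (vf : V) : V → List (ℕ × ℕ) → Prop
  | nil : LooseRun E vf vf []
  | cons {v w : V} {i j : ℕ} {l : List (ℕ × ℕ)} :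
    AffineStep E (v, i) (w, j) → LooseRun E vf w l → LooseRun E vf v ((i, j) :: l)

theorem LooseRun.affineReaches {V : Type} {E : Set (AffineRule V)} {vf v : V} {l : List (ℕ × ℕ)}
    (h : LooseRun E vf v l) {k n : ℕ} (hk : k :: l.map Prod.snd = l.map Prod.fst ++ [n]) :
    AffineReaches E (v, k) vf := by
  induction h generalizing k with
  | nil => exact ⟨k, .refl⟩
  | cons hs _ ih =>
    simp only [List.map_cons, List.cons_append, List.cons.injEq] at hk
    obtain ⟨rfl, hk⟩ := hk
    exact .head hs (ih hk)

variable {V S G : Type} [Group G] {E : Set (AffineRule V)} {vf : V} {a b c d : S}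

/-- The product of the elements `x ^ i * y ^ j * z` over a list of pairs `(i, j)`. -/
def pairProd (x y z : G) (l : List (ℕ × ℕ)) : G :=
  (l.map fun p => x ^ p.1 * y ^ p.2 * z).prod

@[simp]
theorem pairProd_nil (x y z : G) : pairProd x y z [] = 1 := rfl

@[simp]
theorem pairProd_cons (x y z : G) (i j : ℕ) (l : List (ℕ × ℕ)) :
    pairProd x y z ((i, j) :: l) = x ^ i * y ^ j * z * pairProd x y z l := by
  simp [pairProd]

/-- The group elements represented by labels of paths from a given vertex to `pop`. -/
def AffineValue (E : Set (AffineRule V)) (vf : V) (a b c d : G) : AffineVertex V → G → Prop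
  | .state v, g => ∃ l k m, LooseRun E vf v l ∧
      g = pairProd b c (d * a) l * (b ^ k * d * (blockProd (c * b) (a * d) m)⁻¹)
  | .rule e, g => ∃ t l k m, LooseRun E vf e.tgt l ∧
      g = (b ^ e.p * c ^ e.q) ^ t * (d * a) *
        (pairProd b c (d * a) l * (b ^ k * d * (blockProd (c * b) (a * d) m)⁻¹))
  | .fin, g => ∃ k m, g = b ^ k * d * (blockProd (c * b) (a * d) m)⁻¹
  | .pop, g => ∃ m, g = (blockProd (c * b) (a * d) m)⁻¹
  | .dec, g => ∃ k m, g = ((c * b) ^ k)⁻¹ * (blockProd (c * b) (a * d) m)⁻¹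

theorem Commute.pow_mul_pow_mul_pow {x y : G} (h : Commute x y) (p q r s t : ℕ) :
    x ^ r * y ^ s * (x ^ p * y ^ q) ^ t = x ^ (p * t + r) * y ^ (q * t + s) := by
  rw [(h.pow_pow _ _).mul_pow, ← pow_mul, ← pow_mul, add_comm (p * t), add_comm (q * t), pow_add,
    pow_add]
  simp only [mul_assoc]
  rw [← mul_assoc (y ^ s), ← (h.pow_pow (p * t) s).eq, mul_assoc]

theorem LabelPath.affineValue (f : S → G) (hbc : Commute (f b) (f c)) {v : AffineVertex V}
    {w : List (S ⊕ S)} (h : LabelPath (affineGraph E vf a b c d) .pop v w) :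
    AffineValue E vf (f a) (f b) (f c) (f d) v (wordEval f w) := by
  induction h with
  | nil => exact ⟨[], by simp⟩
  | cons he _ ih =>
    rw [wordEval_append]
    obtain he | he := he
    · simp only [Set.mem_iUnion, Set.mem_insert_iff, Set.mem_singleton_iff, Prod.mk.injEq] at he
      obtain ⟨e, heE, ⟨rfl, rfl, rfl⟩ | ⟨rfl, rfl, rfl⟩ | ⟨rfl, rfl, rfl⟩⟩ := he
      · obtain ⟨t, l, k, m, hl, hg⟩ := ih
        refine ⟨(e.p * t + e.r, e.q * t + e.s) :: l, k, m, .cons ⟨e, heE, t, rfl, rfl⟩ hl, ?_⟩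
        rw [hg, pairProd_cons, wordEval_append, wordEval_replicate_inl, wordEval_replicate_inl,
          ← hbc.pow_mul_pow_mul_pow]
        simp only [mul_assoc]
      · obtain ⟨t, l, k, m, hl, hg⟩ := ih
        refine ⟨t + 1, l, k, m, hl, ?_⟩
        rw [hg, pow_succ']
        simp [mul_assoc]
      · obtain ⟨l, k, m, hl, hg⟩ := ih
        exact ⟨0, l, k, m, hl, by rw [hg]; simp [mul_assoc]⟩
    · simp only [Set.mem_insert_iff, Set.mem_singleton_iff, Prod.mk.injEq] at he
      obtain ⟨rfl, rfl, rfl⟩ | ⟨rfl, rfl, rfl⟩ | ⟨rfl, rfl, rfl⟩ | ⟨rfl, rfl, rfl⟩ |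
        ⟨rfl, rfl, rfl⟩ | ⟨rfl, rfl, rfl⟩ := he
      · obtain ⟨k, m, hg⟩ := ih
        exact ⟨[], k, m, .nil, by rw [hg]; simp⟩
      · obtain ⟨k, m, hg⟩ := ih
        exact ⟨k + 1, m, by rw [hg, pow_succ']; simp [mul_assoc]⟩
      · obtain ⟨m, hg⟩ := ih
        exact ⟨0, m, by rw [hg]; simp⟩
      · obtain ⟨k, m, hg⟩ := ih
        exact ⟨m ++ [k], by rw [hg, blockProd_append]; simp [mul_assoc]⟩
      · obtain ⟨k, m, hg⟩ := ih
        exact ⟨k + 1, m, by rw [hg, pow_succ]; simp [mul_assoc]⟩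
      · obtain ⟨m, hg⟩ := ih
        exact ⟨0, m, by rw [hg]; simp⟩

theorem LabelPath.replicate_append {W α : Type} {F : Set (W × List α × W)} {v v' : W}
    {x y : List α} (hx : (v, x, v) ∈ F) (hy : LabelPath F v' v y) (n : ℕ) :
    LabelPath F v' v ((List.replicate n x).flatten ++ y) := by
  induction n with
  | zero => exact hy
  | succ n ih =>
    rw [List.replicate_succ, List.flatten_cons, List.append_assoc]
    exact .cons hx ih

theorem wordEval_flatten_replicate (f : S → G) (x : List (S ⊕ S)) (n : ℕ) :
    wordEval f (List.replicate n x).flatten = wordEval f x ^ n := by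
  induction n with
  | zero => simp
  | succ n ih => rw [List.replicate_succ, List.flatten_cons, wordEval_append, ih, pow_succ']

theorem exists_labelPath_pop (f : S → G) (m : List ℕ) :
    ∃ w, LabelPath (affineGraph E vf a b c d) .pop .pop w ∧
      wordEval f w = (blockProd (f c * f b) (f a * f d) m)⁻¹ := by
  induction m using List.reverseRecOn with
  | nil => exact ⟨[], .nil, by simp⟩
  | append_singleton m k ih =>
    obtain ⟨w, hw, hm⟩ := ih
    refine ⟨_, .cons (w := .dec) (x := [.inr d, .inr a]) (.inr (by simp))
      (.replicate_append (x := [.inr b, .inr c]) (.inr (by simp))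
        (.cons (x := []) (.inr (by simp)) hw) k), ?_⟩
    simp [wordEval_flatten_replicate, hm, blockProd_append, mul_assoc, ← inv_pow]

theorem exists_labelPath_state (f : S → G) (hab : Commute (f a) (f b))
    (hbc : Commute (f b) (f c)) (hcd : Commute (f c) (f d)) {v : V} {k : ℕ}
    (h : AffineReaches E (v, k) vf) :
    ∃ y m, (∀ z, LabelPath (affineGraph E vf a b c d) .pop .pop z →
        LabelPath (affineGraph E vf a b c d) .pop (.state v) (y ++ z)) ∧
      f c ^ k * f a * wordEval f y = blockProd (f c * f b) (f a * f d) m := by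
  obtain ⟨n, hn⟩ := h
  generalize hx : (v, k) = x at hn
  induction hn using Relation.ReflTransGen.head_induction_on generalizing v k with
  | refl =>
    obtain ⟨rfl, rfl⟩ := Prod.mk.inj hx
    refine ⟨(List.replicate k [.inl b]).flatten ++ [.inl d], [k], fun z hz => ?_, ?_⟩
    · rw [List.append_assoc]
      exact .cons (x := []) (w := .fin) (.inr (by simp))
        (.replicate_append (.inr (by simp)) (.cons (.inr (by simp)) hz) k)
    · simp only [wordEval_append, wordEval_flatten_replicate, wordEval_cons_inl, wordEval_nil,
        blockProd_cons, blockProd_nil, mul_one, hbc.symm.mul_pow, mul_assoc]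
      rw [← mul_assoc (f a), (hab.pow_right k).eq, mul_assoc]
  | head hs _ ih =>
    obtain ⟨e, he, t, rfl, rfl⟩ := hs
    obtain ⟨rfl, rfl⟩ := Prod.mk.inj hx
    obtain ⟨y, m, hy, hm⟩ := ih rfl
    have hE (p) (hp : p ∈ ({_, _, _} : Set _)) : p ∈ affineGraph E vf a b c d :=
      .inl (Set.mem_biUnion he hp)
    refine ⟨List.replicate e.r (.inl b) ++ List.replicate e.s (.inl c) ++
      ((List.replicate t (List.replicate e.p (.inl b) ++ List.replicate e.q (.inl c))).flatten ++
      ([.inl d, .inl a] ++ y)), (e.p * t + e.r) :: m, fun z hz => ?_, ?_⟩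
    · rw [List.append_assoc, List.append_assoc (List.flatten _), List.append_assoc [_, _]]
      exact .cons (w := .rule e) (hE _ (by simp))
        (.replicate_append (hE _ (by simp)) (.cons (hE _ (by simp)) (hy z hz)) t)
    · simp only [wordEval_append, wordEval_flatten_replicate, wordEval_cons_inl, wordEval_nil,
        wordEval_replicate_inl, blockProd_cons, mul_one]
      rw [← hm, hbc.symm.mul_pow, ← mul_assoc (_ * _) (_ ^ t),
        hbc.pow_mul_pow_mul_pow]
      generalize e.p * t + e.r = i
      generalize e.q * t + e.s = j
      have h₁ := (hab.pow_right i).eq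
      have h₂ := (hcd.pow_left j).eq
      simp only [mul_assoc]
      rw [← mul_assoc (f a) (f b ^ i), h₁, ← mul_assoc (f c ^ j) (f d), h₂]
      simp only [mul_assoc]

theorem blockProd_map {H : Type} [Group H] (φ : G →* H) (x y : G) (m : List ℕ) :
    φ (blockProd x y m) = blockProd (φ x) (φ y) m := by
  simp [blockProd, map_list_prod, Function.comp_def]

theorem pairProd_map {H : Type} [Group H] (φ : G →* H) (x y z : G) (l : List (ℕ × ℕ)) :
    φ (pairProd x y z l) = pairProd (φ x) (φ y) (φ z) l := by
  simp [pairProd, map_list_prod, Function.comp_def]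

theorem pairProd_one_left (y z : G) (l : List (ℕ × ℕ)) :
    pairProd 1 y z l = blockProd y z (l.map Prod.snd) := by
  simp [pairProd, blockProd, Function.comp_def]

theorem pairProd_one_right (x z : G) (l : List (ℕ × ℕ)) :
    pairProd x 1 z l = blockProd x z (l.map Prod.fst) := by
  simp [pairProd, blockProd, Function.comp_def]

/-- Membership in the rational subset attached to an affine machine encodes reachability of its
final state. -/
theorem mem_image_labelPath_iff {I : S → S → Prop} (hirr : ∀ a, ¬ I a a)
    (hsym : ∀ a b, I a b → I b a) (hab : I a b) (hbc : I b c) (hcd : I c d)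
    (hac : ¬ I a c) (hbd : ¬ I b d) (hac' : a ≠ c) (hbd' : b ≠ d) (v : V) (k : ℕ) :
    graphEval I (FreeMonoid.ofList (.inr a :: List.replicate k (.inr c))) ∈
      (fun w : List (S ⊕ S) => graphEval I (FreeMonoid.ofList w)) ''
        {w | LabelPath (affineGraph E vf a b c d) .pop (.state v) w} ↔
    AffineReaches E (v, k) vf := by
  have hev (w : List (S ⊕ S)) : graphEval I (FreeMonoid.ofList w) =
      wordEval (PresentedGroup.of (rels := GraphGroupRels I)) w :=
    FreeMonoid.lift_ofList _ _
  simp only [Set.mem_image, hev]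
  set f := PresentedGroup.of (rels := GraphGroupRels I)
  have hab_ne : a ≠ b := by rintro rfl; exact hirr _ hab
  have hbc_ne : b ≠ c := by rintro rfl; exact hirr _ hbc
  have hcd_ne : c ≠ d := by rintro rfl; exact hirr _ hcd
  have had_ne : a ≠ d := by rintro rfl; exact hac (hsym _ _ hcd)
  constructor
  · rintro ⟨w, hw, hwk⟩
    obtain ⟨l, n, m, hl, hg⟩ := LabelPath.affineValue f (commute_of_independent hbc) hw
    rw [hwk] at hg
    have key : f c ^ k * f a * (pairProd (f b) (f c) (f d * f a) l * (f b ^ n * f d)) =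
        blockProd (f c * f b) (f a * f d) m := by
      rw [wordEval_cons_inr, wordEval_replicate_inr, ← mul_inv_rev, ← mul_assoc,
        eq_mul_inv_iff_mul_eq, inv_mul_eq_iff_eq_mul] at hg
      exact hg.symm
    obtain ⟨φ, hc, ha, h₁⟩ := exists_projection hirr hsym hac'.symm fun h => hac (hsym _ _ h)
    obtain ⟨ψ, hb, hd, h₂⟩ := exists_projection hirr hsym hbd' hbd
    have e₁ := congrArg φ key
    have e₂ := congrArg ψ key
    have hφb : φ (f b) = 1 := h₁ b hbc_ne hab_ne.symm
    have hφd : φ (f d) = 1 := h₁ d hcd_ne.symm had_ne.symm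
    have hψa : ψ (f a) = 1 := h₂ a hab_ne had_ne
    have hψc : ψ (f c) = 1 := h₂ c hbc_ne.symm hcd_ne
    simp only [map_mul, map_pow, pairProd_map, blockProd_map, f, hc, ha, hb, hd] at e₁ e₂
    simp only [f] at hφb hφd hψa hψc
    simp only [hφb, hφd, one_pow, one_mul, mul_one, pairProd_one_left] at e₁
    simp only [hψa, hψc, one_pow, one_mul, mul_one, pairProd_one_right] at e₂
    have m₁ : k :: l.map Prod.snd = m := blockProd_of_injective (by rw [← e₁, blockProd_cons])
    have m₂ : l.map Prod.fst ++ [n] = m :=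
      blockProd_of_injective (by rw [← e₂, blockProd_append]; simp)
    exact hl.affineReaches (m₁.trans m₂.symm)
  · intro h
    obtain ⟨y, m, hy, hm⟩ := exists_labelPath_state f (commute_of_independent hab)
      (commute_of_independent hbc) (commute_of_independent hcd) h
    obtain ⟨z, hz, hzm⟩ := exists_labelPath_pop (E := E) (vf := vf) (a := a) (b := b) (c := c)
      (d := d) f m
    refine ⟨y ++ z, hy z hz, ?_⟩
    rw [wordEval_append, hzm, ← hm]
    simp [mul_assoc]

end AffineGraphs

section TuringMachines

open Turing

/-- A Post-Turing machine halts from a configuration if it reaches one without successor. -/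
def TM0Halts {Γ Λ : Type} [Inhabited Γ] [Inhabited Λ] (M : TM0.Machine Γ Λ)
    (x : TM0.Cfg Γ Λ) : Prop :=
  ∃ y, StateTransition.Reaches (TM0.step M) x y ∧ TM0.step M y = none

theorem tm0Halts_iff_eval_dom {Γ Λ : Type} [Inhabited Γ] [Inhabited Λ] (M : TM0.Machine Γ Λ)
    (l : List Γ) : TM0Halts M (TM0.init l) ↔ (TM0.eval M l).Dom := by
  rw [TM0.eval, Part.map_Dom, Part.dom_iff_mem]
  simp only [TM0Halts, StateTransition.mem_eval]

theorem trNat_two_pow (n : ℕ) :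
    PartrecToTM2.trNat (2 ^ n) =
      List.replicate n PartrecToTM2.Γ'.bit0 ++ [PartrecToTM2.Γ'.bit1] := by
  have h : ∀ n : ℕ, ∃ p : PosNum, ((2 ^ n : ℕ) : Num) = Num.pos p ∧
      PartrecToTM2.trPosNum p =
        List.replicate n PartrecToTM2.Γ'.bit0 ++ [PartrecToTM2.Γ'.bit1] := by
    intro n
    induction n with
    | zero => exact ⟨1, by simp; rfl, rfl⟩
    | succ n ih =>
      obtain ⟨p, hp, hp'⟩ := ih
      refine ⟨p.bit0, ?_, ?_⟩
      · rw [pow_succ, mul_two, Nat.cast_add, hp]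
        exact (Num.bit0_of_bit0 (Num.pos p))
      · rw [PartrecToTM2.trPosNum, hp', List.replicate_succ, List.cons_append]
  obtain ⟨p, hp, hp'⟩ := h n
  rw [PartrecToTM2.trNat, hp, PartrecToTM2.trNum, hp']

theorem primrec_const_pow (b : ℕ) : Primrec fun k : ℕ => b ^ k :=
  (Primrec.nat_iterate (g := fun _ => 1) (h := fun _ y => y * b) Primrec.id (Primrec.const 1)
    (Primrec.nat_mul.comp Primrec.snd (Primrec.const b))).of_eq fun k => by
      induction k with
      | zero => rfl
      | succ k ih => rw [pow_succ, ← ih]; exact Function.iterate_succ_apply' _ _ _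

theorem primrec_log_two : Primrec (Nat.log 2) := by
  have h : PrimrecRel fun m k : ℕ => 2 ^ k ≤ m :=
    Primrec.nat_le.comp ((primrec_const_pow 2).comp Primrec.snd) Primrec.fst
  refine (Primrec.nat_findGreatest Primrec.id h).of_eq fun m => ?_
  rcases Nat.eq_zero_or_pos m with rfl | hm
  · simp
  · refine Nat.findGreatest_eq_iff.2 ⟨Nat.log_le_self 2 m, fun _ => Nat.pow_log_le_self 2 hm.ne',
      fun k hk _ => (Nat.lt_pow_of_log_lt one_lt_two hk).not_ge⟩

theorem exists_partrec_dom_two_pow_not_computable :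
    ∃ f : ℕ →. ℕ, Partrec f ∧ ¬ ComputablePred fun n : ℕ => (f (2 ^ n)).Dom := by
  refine ⟨fun m => (Denumerable.ofNat Nat.Partrec.Code (Nat.log 2 m)).eval 0, ?_, ?_⟩
  · exact Nat.Partrec.Code.eval_part.comp ((Computable.ofNat Nat.Partrec.Code).comp
      primrec_log_two.to_comp) (Computable.const 0)
  · intro h
    refine ComputablePred.halting_problem 0 (ComputablePred.computable_of_manyOneReducible
      ⟨fun c : Nat.Partrec.Code => Encodable.encode c, Computable.encode, fun c => ?_⟩ h)
    simp [Nat.log_pow]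

theorem exists_code_not_computable :
    ∃ c : ToPartrec.Code, ¬ ComputablePred fun n : ℕ => (c.eval [2 ^ n]).Dom := by
  obtain ⟨f, hf, hn⟩ := exists_partrec_dom_two_pow_not_computable
  obtain ⟨c, hc⟩ := ToPartrec.Code.exists_code (Nat.Partrec'.part_iff₁.2 hf)
  refine ⟨c, fun h => hn (h.of_eq fun n => ?_)⟩
  have := hc (2 ^ n ::ᵥ List.Vector.nil)
  simp only [List.Vector.cons] at this
  rw [this]
  rfl

theorem tm2_eval_dom (c : ToPartrec.Code) (v : List ℕ) :
    letI : Inhabited PartrecToTM2.Λ' := ⟨PartrecToTM2.trNormal c PartrecToTM2.Cont'.halt⟩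
    (TM2.eval (K := PartrecToTM2.K') (Γ := fun _ => PartrecToTM2.Γ')
      PartrecToTM2.tr PartrecToTM2.K'.main (PartrecToTM2.trList v)).Dom ↔ (c.eval v).Dom := by
  let : Inhabited PartrecToTM2.Λ' := ⟨PartrecToTM2.trNormal c PartrecToTM2.Cont'.halt⟩
  have h := PartrecToTM2.tr_eval c v
  have hi : TM2.init PartrecToTM2.K'.main (PartrecToTM2.trList v) = PartrecToTM2.init c v := by
    rw [TM2.init, PartrecToTM2.init]
    congr 1
    funext k
    cases k <;> rfl
  change (Part.map _ (StateTransition.eval (TM2.step PartrecToTM2.tr) (TM2.init _ _))).Dom ↔ _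
  rw [Part.map_Dom, hi, h]
  rfl

theorem TM2.exists_tm0_halts_iff {K Λ σ : Type} [DecidableEq K] [Fintype K] {Γ : K → Type}
    [∀ k, Fintype (Γ k)] [Inhabited Λ] [Inhabited σ] [Fintype σ]
    (M : Λ → TM2.Stmt Γ Λ σ) (S : Finset Λ) (hs : TM2.Supports M S) (k : K) (x₀ x₁ x₂ : Γ k) :
    ∃ (Γ' Λ' : Type) (_ : Inhabited Γ') (_ : Finite Γ') (_ : Inhabited Λ')
      (M' : TM0.Machine Γ' Λ') (S' : Set Λ') (y₀ y₁ y₂ : Γ'), S'.Finite ∧ TM0.Supports M' S' ∧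
      ∀ n : ℕ, TM0Halts M' (TM0.init (y₀ :: y₁ :: List.replicate n y₂)) ↔
        (TM2.eval M k (List.replicate n x₂ ++ [x₁, x₀])).Dom := by
  let enc (b : Bool) (a : Γ k) : TM2to1.Γ' K Γ :=
    (b, Function.update (fun _ => none) k (some a))
  refine ⟨_, _, inferInstance, inferInstance, inferInstance, _, _, enc true x₀,
    enc false x₁, enc false x₂, Finset.finite_toSet _,
    TM1to0.tr_supports _ (TM2to1.tr_supports M hs), fun n => ?_⟩
  rw [tm0Halts_iff_eval_dom, TM1to0.tr_eval, ← TM2to1.tr_eval_dom]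
  have hl : TM2to1.trInit k (List.replicate n x₂ ++ [x₁, x₀]) =
      enc true x₀ :: enc false x₁ :: List.replicate n (enc false x₂) := by
    have hr : (List.replicate n x₂ ++ [x₁, x₀]).reverse = x₀ :: x₁ :: List.replicate n x₂ := by
      simp
    rw [TM2to1.trInit, hr]
    exact congrArg (enc true x₀ :: enc false x₁ :: ·) (List.map_replicate (f := enc false))
  rw [hl]

/-- There is a fixed Post-Turing machine with undecidable halting problem on the inputs
`x₀ x₁ x₂ⁿ`. -/
theorem exists_tm0_halting_not_computable :
    ∃ (Γ Λ : Type) (_ : Inhabited Γ) (_ : Finite Γ) (_ : Inhabited Λ) (M : TM0.Machine Γ Λ)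
      (S : Set Λ) (x₀ x₁ x₂ : Γ), S.Finite ∧ TM0.Supports M S ∧
      ¬ ComputablePred fun n : ℕ => TM0Halts M (TM0.init (x₀ :: x₁ :: List.replicate n x₂)) := by
  obtain ⟨c, hc⟩ := exists_code_not_computable
  let : Inhabited PartrecToTM2.Λ' := ⟨PartrecToTM2.trNormal c PartrecToTM2.Cont'.halt⟩
  let : Fintype PartrecToTM2.K' := ⟨{.main, .rev, .aux, .stack}, fun k => by cases k <;> simp⟩
  obtain ⟨Γ, Λ, iΓ, fΓ, iΛ, M, S, y₀, y₁, y₂, hS, hM, h⟩ := TM2.exists_tm0_halts_iff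
    (K := PartrecToTM2.K') (Γ := fun _ => PartrecToTM2.Γ') PartrecToTM2.tr _
    (PartrecToTM2.tr_supports c PartrecToTM2.Cont'.halt) PartrecToTM2.K'.main
    .cons .bit1 .bit0
  refine ⟨Γ, Λ, iΓ, fΓ, iΛ, M, S, y₀, y₁, y₂, hS, hM, fun hn => hc (hn.of_eq fun n => ?_)⟩
  rw [h, ← tm2_eval_dom]
  simp [PartrecToTM2.trList, trNat_two_pow]

end TuringMachines

section TapeEncoding

open Turing

/-- The value of a half-tape as a base `B` numeral with digits given by `e`. -/
def Turing.ListBlank.toNat {Γ : Type} [Inhabited Γ] (e : Γ → ℕ) (he : e default = 0) (B : ℕ)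
    (L : ListBlank Γ) : ℕ :=
  L.liftOn (List.foldr (fun a n => e a + B * n) 0) (by
    rintro a _ ⟨n, rfl⟩
    rw [List.foldr_append]
    congr 1
    induction n with
    | zero => rfl
    | succ n ih => rw [List.replicate_succ, List.foldr_cons, ← ih, he]; simp)

theorem Turing.ListBlank.toNat_mk {Γ : Type} [Inhabited Γ] (e : Γ → ℕ) (he : e default = 0)
    (B : ℕ) (l : List Γ) :
    (ListBlank.mk l).toNat e he B = l.foldr (fun a n => e a + B * n) 0 :=
  rfl

theorem Turing.ListBlank.toNat_cons {Γ : Type} [Inhabited Γ] (e : Γ → ℕ) (he : e default = 0)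
    (B : ℕ) (a : Γ) (L : ListBlank Γ) :
    (L.cons a).toNat e he B = e a + B * L.toNat e he B := by
  induction L using ListBlank.induction_on
  rfl

/-- The direction opposite to a given one. -/
def Turing.Dir.opp : Dir → Dir
  | .left => .right
  | .right => .left

/-- The half-tape lying in direction `d` of the head. -/
def Turing.Tape.side {Γ : Type} [Inhabited Γ] (T : Tape Γ) : Dir → ListBlank Γ
  | .left => T.left
  | .right => T.right

theorem Turing.Tape.head_move {Γ : Type} [Inhabited Γ] (T : Tape Γ) (d : Dir) :
    (T.move d).head = (T.side d).head := by
  cases d <;> rfl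

theorem Turing.Tape.side_move {Γ : Type} [Inhabited Γ] (T : Tape Γ) (d : Dir) :
    (T.move d).side d = (T.side d).tail := by
  cases d <;> rfl

theorem Turing.Tape.side_opp_move {Γ : Type} [Inhabited Γ] (T : Tape Γ) (d : Dir) :
    (T.move d).side d.opp = (T.side d.opp).cons T.head := by
  cases d <;> rfl

/-- Four distinct primes; two of them encode the two half-tapes, the others are used while the
head moves. -/
def tapePrime : Dir → Bool → ℕ
  | .left, false => 2
  | .right, false => 3
  | .left, true => 5
  | .right, true => 7

theorem prime_tapePrime (d : Dir) (ε : Bool) : (tapePrime d ε).Prime := by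
  cases d <;> cases ε <;> norm_num [tapePrime]

theorem coprime_tapePrime {d d' : Dir} {ε ε' : Bool} (h : d ≠ d' ∨ ε ≠ ε') :
    (tapePrime d ε).Coprime (tapePrime d' ε') := by
  cases d <;> cases ε <;> cases d' <;> cases ε' <;> simp_all [tapePrime] <;> decide

theorem coprime_pow_mul {P : ℕ} {a b c : ℕ} (ha : P.Coprime a) (hb : P.Coprime b)
    (hc : P.Coprime c) (x y z : ℕ) : P.Coprime (a ^ x * b ^ y * c ^ z) :=
  ((ha.pow_right x).mul_right (hb.pow_right y)).mul_right (hc.pow_right z)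

theorem eq_succ_of_prime_mul_eq {P c u x : ℕ} (hP : P.Prime) (hc : P.Coprime c)
    (h : P * u = P ^ x * c) : ∃ x', x = x' + 1 ∧ u = P ^ x' * c := by
  cases x with
  | zero =>
    rw [pow_zero, one_mul] at h
    exact absurd (Nat.Coprime.eq_one_of_dvd hc ⟨u, h.symm⟩) hP.one_lt.ne'
  | succ x =>
    refine ⟨x, rfl, Nat.eq_of_mul_eq_mul_left hP.pos ?_⟩
    rw [h]; ring

theorem eq_of_prime_pow_mul_eq {Q c u y k : ℕ} (hQ : Q.Prime) (hc : Q.Coprime c)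
    (hu : Q.Coprime u) (h : Q ^ k * u = Q ^ y * c) : y = k ∧ u = c := by
  induction k generalizing y with
  | zero =>
    cases y with
    | zero => simpa using h
    | succ y =>
      rw [pow_zero, one_mul] at h
      refine absurd (Nat.Coprime.eq_one_of_dvd hu ⟨Q ^ y * c, ?_⟩) hQ.one_lt.ne'
      rw [h]; ring
  | succ k ih =>
    rw [pow_succ', mul_assoc] at h
    obtain ⟨y', rfl, h'⟩ := eq_succ_of_prime_mul_eq hQ hc h
    obtain ⟨rfl, rfl⟩ := ih h'
    exact ⟨rfl, rfl⟩

theorem eq_add_of_prime_pow_mul_eq {Q c u y k : ℕ} (hQ : Q.Prime) (hc : Q.Coprime c)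
    (h : Q ^ k * u = Q ^ y * c) : ∃ y', y = y' + k ∧ u = Q ^ y' * c := by
  induction k generalizing y with
  | zero => exact ⟨y, rfl, by simpa using h⟩
  | succ k ih =>
    rw [pow_succ', mul_assoc] at h
    obtain ⟨y', rfl, h'⟩ := eq_succ_of_prime_mul_eq hQ hc h
    obtain ⟨y, rfl, rfl⟩ := ih h'
    exact ⟨y, rfl, rfl⟩

end TapeEncoding

section TapeMachine

open Turing

/-- States of the affine machine simulating a Post-Turing machine. -/
inductive TapeState (Γ Λ : Type) : Type
  /-- the tape is encoded by the primes `tapePrime _ ε`, the head reads `h`, the state is `q` -/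
  | main (q : Λ) (h : Γ) (ε : Bool)
  /-- the head, having left a cell containing `h`, moves in direction `d` -/
  | work (q : Λ) (h : Γ) (d : Dir) (ε : Bool)
  /-- the machine has halted -/
  | halt

variable {Γ Λ : Type} [Inhabited Λ]

/-- The affine rules simulating a step of a Post-Turing machine, except for head moves. -/
def mainRules (M : TM0.Machine Γ Λ) (q : Λ) (h : Γ) (ε : Bool) :
    Set (AffineRule (TapeState Γ Λ)) :=
  match M q h with
  | none => ratioRules (.main q h ε) 1 1 1 .halt
  | some (q', .move d) => ratioRules (.main q h ε) 1 1 1 (.work q' h d ε)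
  | some (q', .write a) => ratioRules (.main q h ε) 1 1 1 (.main q' a ε)

/-- The affine rules moving the head. -/
def workRules (e : Γ → ℕ) (B : ℕ) (q : Λ) (h : Γ) (d : Dir) (ε : Bool) :
    Set (AffineRule (TapeState Γ Λ)) :=
  ratioRules (.work q h d ε) (tapePrime d.opp ε) (tapePrime d.opp (!ε) ^ B) 1 (.work q h d ε) ∪
  ratioRules (.work q h d ε) (tapePrime d ε ^ B) (tapePrime d (!ε)) 1 (.work q h d ε) ∪
  ⋃ h', ratioRules (.work q h d ε) (tapePrime d ε ^ e h') (tapePrime d.opp (!ε) ^ e h)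
    (tapePrime d.opp ε * tapePrime d ε) (.main q h' (!ε))

/-- The affine rules simulating the Post-Turing machine `M` on the set of states `S`. -/
def tapeRules (M : TM0.Machine Γ Λ) (S : Set Λ) (e : Γ → ℕ) (B : ℕ) :
    Set (AffineRule (TapeState Γ Λ)) :=
  ⋃ q ∈ S, ⋃ h, ⋃ ε, mainRules M q h ε ∪ ⋃ d, workRules e B q h d ε

theorem finite_tapeRules [Finite Γ] (M : TM0.Machine Γ Λ) {S : Set Λ} (hS : S.Finite)
    (e : Γ → ℕ) (B : ℕ) : (tapeRules M S e B).Finite := by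
  refine hS.biUnion fun q _ => Set.finite_iUnion fun h => Set.finite_iUnion fun ε =>
    .union ?_ ?_
  · unfold mainRules
    split <;> exact finite_ratioRules ..
  · have : Finite Dir := Finite.of_injective (fun d => d = Dir.left) (by
      intro d d'; cases d <;> cases d' <;> simp)
    exact Set.finite_iUnion fun d => ((finite_ratioRules ..).union (finite_ratioRules ..)).union
      (Set.finite_iUnion fun h' => finite_ratioRules ..)

theorem AffineStep.mono {V : Type} {E F : Set (AffineRule V)} (h : E ⊆ F) {x y : V × ℕ} :
    AffineStep E x y → AffineStep F x y
  | ⟨e, he, t⟩ => ⟨e, h he, t⟩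

theorem mainRules_subset {M : TM0.Machine Γ Λ} {S : Set Λ} {e : Γ → ℕ} {B : ℕ}
    {q : Λ} (hq : q ∈ S) (h : Γ) (ε : Bool) :
    mainRules M q h ε ⊆ tapeRules M S e B := fun r hr => by
  simp only [tapeRules, Set.mem_iUnion]
  exact ⟨q, hq, h, ε, .inl hr⟩

theorem workRules_subset {M : TM0.Machine Γ Λ} {S : Set Λ} {e : Γ → ℕ} {B : ℕ}
    {q : Λ} (hq : q ∈ S) (h : Γ) (d : Dir) (ε : Bool) :
    workRules e B q h d ε ⊆ tapeRules M S e B := fun r hr => by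
  simp only [tapeRules, Set.mem_iUnion]
  exact ⟨q, hq, h, ε, .inr (Set.mem_iUnion.2 ⟨d, hr⟩)⟩

variable [Inhabited Γ] (M : TM0.Machine Γ Λ) (S : Set Λ) (e : Γ → ℕ) (he : e default = 0) (B : ℕ)

/-- The encoding of a tape as a natural number. -/
def tapeCode (T : Tape Γ) (ε : Bool) : ℕ :=
  tapePrime .left ε ^ T.left.toNat e he B * tapePrime .right ε ^ T.right.toNat e he B

theorem tapeCode_eq (T : Tape Γ) (ε : Bool) (d : Dir) :
    tapeCode e he B T ε = tapePrime d.opp ε ^ (T.side d.opp).toNat e he B *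
      tapePrime d ε ^ (T.side d).toNat e he B := by
  cases d
  · exact mul_comm _ _
  · rfl

theorem toNat_side_opp_move (T : Tape Γ) (d : Dir) :
    ((T.move d).side d.opp).toNat e he B = e T.head + B * (T.side d.opp).toNat e he B := by
  rw [Tape.side_opp_move, ListBlank.toNat_cons]

theorem toNat_side_eq (T : Tape Γ) (d : Dir) :
    (T.side d).toNat e he B =
      e (T.move d).head + B * ((T.move d).side d).toNat e he B := by
  rw [Tape.head_move, Tape.side_move, ← ListBlank.toNat_cons, ListBlank.cons_head_tail]

/-- The configurations of the affine machine all of whose decodings halt. -/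
def TapeGood : TapeState Γ Λ × ℕ → Prop
  | (.halt, _) => True
  | (.main q h ε, N) => ∀ T : Tape Γ, T.head = h → N = tapeCode e he B T ε → TM0Halts M ⟨q, T⟩
  | (.work q h d ε, N) => ∀ (T : Tape Γ) (x y z w : ℕ), T.head = h →
      N = tapePrime d.opp ε ^ x * tapePrime d ε ^ y * tapePrime d.opp (!ε) ^ z *
        tapePrime d (!ε) ^ w →
      z + B * x = B * (T.side d.opp).toNat e he B → y + B * w = (T.side d).toNat e he B →
      TM0Halts M ⟨q, T.move d⟩

variable {M S e he B}

theorem TM0Halts.of_step {x y : TM0.Cfg Γ Λ} (h : TM0.step M x = some y) :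
    TM0Halts M y → TM0Halts M x
  | ⟨z, hz, hn⟩ => ⟨z, .head h hz, hn⟩

theorem digit_unique {a b x y : ℕ} (ha : a < B) (hb : b < B) (h : a + B * x = b + B * y) :
    a = b ∧ x = y := by
  have h₁ := congrArg (· % B) h
  simp only [Nat.add_mul_mod_self_left, Nat.mod_eq_of_lt ha, Nat.mod_eq_of_lt hb] at h₁
  subst h₁
  exact ⟨rfl, Nat.eq_of_mul_eq_mul_left (Nat.zero_lt_of_lt ha) (Nat.add_left_cancel h)⟩

theorem opp_ne (d : Dir) : d.opp ≠ d := by cases d <;> simp [Dir.opp]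

theorem TapeGood.of_mainRules {q : Λ} {h : Γ} {ε : Bool} {x y : TapeState Γ Λ × ℕ}
    (hs : AffineStep (mainRules M q h ε) x y) (hy : TapeGood M e he B y) :
    TapeGood M e he B x := by
  unfold mainRules at hs
  split at hs
  · next hM =>
    obtain ⟨u, -, rfl, rfl⟩ := (affineStep_ratioRules one_pos).1 hs
    rintro T rfl -
    exact ⟨_, .refl, by simp [TM0.step, hM]⟩
  · next q' d hM =>
    obtain ⟨u, -, rfl, rfl⟩ := (affineStep_ratioRules one_pos).1 hs
    rintro T rfl hN
    refine TM0Halts.of_step (y := ⟨q', T.move d⟩) (by simp [TM0.step, hM])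
      (hy T _ _ 0 0 rfl (hN.trans ?_) (zero_add _) (add_zero _))
    rw [tapeCode_eq e he B T ε d]; simp
  · next q' a hM =>
    obtain ⟨u, -, rfl, rfl⟩ := (affineStep_ratioRules one_pos).1 hs
    rintro T rfl hN
    exact TM0Halts.of_step (y := ⟨q', T.write a⟩) (by simp [TM0.step, hM])
      (hy (T.write a) rfl hN)

theorem TapeGood.of_workRules (hB : ∀ a, e a < B) (hi : Function.Injective e)
    {q : Λ} {h : Γ} {d : Dir} {ε : Bool} {x y : TapeState Γ Λ × ℕ}
    (hs : AffineStep (workRules e B q h d ε) x y) (hy : TapeGood M e he B y) :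
    TapeGood M e he B x := by
  obtain ⟨r, hr, hs⟩ := hs
  have c₁ : (tapePrime d.opp ε).Coprime (tapePrime d ε) := coprime_tapePrime (.inl (opp_ne d))
  have c₂ : (tapePrime d.opp ε).Coprime (tapePrime d.opp (!ε)) :=
    coprime_tapePrime (.inr (by simp))
  have c₃ : (tapePrime d.opp ε).Coprime (tapePrime d (!ε)) :=
    coprime_tapePrime (.inr (by simp))
  have c₄ : (tapePrime d ε).Coprime (tapePrime d.opp (!ε)) :=
    coprime_tapePrime (.inr (by simp))
  have c₅ : (tapePrime d ε).Coprime (tapePrime d (!ε)) :=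
    coprime_tapePrime (.inr (by simp))
  obtain (hr | hr) | hr := hr
  · obtain ⟨u, -, rfl, rfl⟩ := (affineStep_ratioRules one_pos).1 ⟨r, hr, hs⟩
    rintro T x y z w hT hN h₁ h₂
    have hN' : tapePrime d.opp ε * u = tapePrime d.opp ε ^ x * (tapePrime d ε ^ y *
        tapePrime d.opp (!ε) ^ z * tapePrime d (!ε) ^ w) := by rw [hN]; ring
    obtain ⟨x, rfl, rfl⟩ := eq_succ_of_prime_mul_eq (prime_tapePrime ..)
      (coprime_pow_mul c₁ c₂ c₃ ..) hN'
    refine hy T x y (z + B) w hT (by ring) ?_ h₂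
    rw [← h₁]; ring
  · obtain ⟨u, -, rfl, rfl⟩ := (affineStep_ratioRules one_pos).1 ⟨r, hr, hs⟩
    rintro T x y z w hT hN h₁ h₂
    have hN' : tapePrime d ε ^ B * u = tapePrime d ε ^ y * (tapePrime d.opp ε ^ x *
        tapePrime d.opp (!ε) ^ z * tapePrime d (!ε) ^ w) := by rw [hN]; ring
    obtain ⟨y, rfl, rfl⟩ := eq_add_of_prime_pow_mul_eq (prime_tapePrime ..)
      (coprime_pow_mul c₁.symm c₄ c₅ ..) hN'
    refine hy T x y z (w + 1) hT (by ring) h₁ ?_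
    rw [← h₂]; ring
  · obtain ⟨h', hr⟩ := Set.mem_iUnion.1 hr
    obtain ⟨u, hu, rfl, rfl⟩ := (affineStep_ratioRules (Nat.mul_pos
      (prime_tapePrime ..).pos (prime_tapePrime ..).pos)).1 ⟨r, hr, hs⟩
    rintro T x y z w rfl hN h₁ h₂
    have hN' : tapePrime d ε ^ e h' * u = tapePrime d ε ^ y * (tapePrime d.opp ε ^ x *
        tapePrime d.opp (!ε) ^ z * tapePrime d (!ε) ^ w) := by rw [hN]; ring
    obtain ⟨rfl, hu'⟩ := eq_of_prime_pow_mul_eq (prime_tapePrime ..)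
      (coprime_pow_mul c₁.symm c₄ c₅ ..) hu.coprime_mul_left hN'
    have hx : tapePrime d.opp ε ^ 0 * u = tapePrime d.opp ε ^ x *
        (tapePrime d.opp (!ε) ^ z * tapePrime d (!ε) ^ w) := by rw [hu']; ring
    obtain ⟨rfl, rfl⟩ := eq_of_prime_pow_mul_eq (prime_tapePrime ..)
      ((c₂.pow_right z).mul_right (c₃.pow_right w)) hu.coprime_mul_right hx
    rw [toNat_side_eq] at h₂
    obtain ⟨hh, hw⟩ := digit_unique (hB _) (hB _) h₂
    refine hy (T.move d) (hi hh.symm) ?_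
    rw [tapeCode_eq e he B _ _ d, ← hw, toNat_side_opp_move, ← h₁]
    ring

theorem TapeGood.of_reaches (hB : ∀ a, e a < B) (hi : Function.Injective e)
    {x : TapeState Γ Λ × ℕ} (h : AffineReaches (tapeRules M S e B) x .halt) :
    TapeGood M e he B x := by
  obtain ⟨n, hn⟩ := h
  induction hn using Relation.ReflTransGen.head_induction_on with
  | refl => trivial
  | head hs _ ih =>
    obtain ⟨r, hr, hs⟩ := hs
    simp only [tapeRules, Set.mem_iUnion] at hr
    obtain ⟨q, -, h, ε, hr | hr⟩ := hr
    · exact .of_mainRules ⟨r, hr, hs⟩ ih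
    · obtain ⟨d, hr⟩ := Set.mem_iUnion.1 hr
      exact .of_workRules hB hi ⟨r, hr, hs⟩ ih

theorem affineReaches_work {q : Λ} (hq : q ∈ S) {d : Dir} {ε : Bool} (T : Tape Γ)
    (hr : AffineReaches (tapeRules M S e B)
      (.main q (T.move d).head (!ε), tapeCode e he B (T.move d) (!ε)) .halt)
    (x k z w : ℕ) (h₁ : z + B * x = B * (T.side d.opp).toNat e he B)
    (h₂ : k + w = ((T.move d).side d).toNat e he B) :
    AffineReaches (tapeRules M S e B) (.work q T.head d ε,
      tapePrime d.opp ε ^ x * tapePrime d ε ^ (e (T.move d).head + B * k) *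
        tapePrime d.opp (!ε) ^ z * tapePrime d (!ε) ^ w) .halt := by
  have hsub := workRules_subset (M := M) (e := e) (B := B) hq T.head d ε
  induction x generalizing z with
  | zero =>
    induction k generalizing w with
    | zero =>
      refine hr.head (.mono hsub (.mono (Set.subset_union_right.trans' (Set.subset_iUnion _
        (T.move d).head)) ((affineStep_ratioRules (Nat.mul_pos (prime_tapePrime ..).pos
        (prime_tapePrime ..).pos)).2
        ⟨tapePrime d.opp (!ε) ^ z * tapePrime d (!ε) ^ w, ?_, ?_, ?_⟩)))
      · refine .mul_left (.mul_right (.pow_right _ ?_) (.pow_right _ ?_))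
          (.mul_right (.pow_right _ ?_) (.pow_right _ ?_)) <;>
        exact coprime_tapePrime (.inr (by simp))
      · congr 1; ring
      · rw [tapeCode_eq e he B _ _ d, ← h₂, toNat_side_opp_move, ← h₁]
        congr 1; ring
    | succ k ih =>
      refine (ih (w + 1) (by rw [← h₂]; ring)).head (.mono hsub (.mono
        (Set.subset_union_left.trans' Set.subset_union_right)
        ((affineStep_ratioRules one_pos).2 ⟨tapePrime d ε ^ (e (T.move d).head + B * k) *
          tapePrime d.opp (!ε) ^ z * tapePrime d (!ε) ^ w, Nat.coprime_one_left _, ?_, ?_⟩)))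
      · congr 1; ring
      · congr 1; ring
  | succ x ih =>
    refine (ih (z + B) (by rw [← h₁]; ring)).head (.mono hsub (.mono
      (Set.subset_union_left.trans' Set.subset_union_left)
      ((affineStep_ratioRules one_pos).2 ⟨tapePrime d.opp ε ^ x *
        tapePrime d ε ^ (e (T.move d).head + B * k) *
        tapePrime d.opp (!ε) ^ z * tapePrime d (!ε) ^ w, Nat.coprime_one_left _, ?_, ?_⟩)))
    · congr 1; ring
    · congr 1; ring

theorem affineReaches_main_of_halts (hM : TM0.Supports M S) {x : TM0.Cfg Γ Λ}
    (hx : x.q ∈ S) (h : TM0Halts M x) (ε : Bool) :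
    AffineReaches (tapeRules M S e B) (.main x.q x.Tape.head ε, tapeCode e he B x.Tape ε)
      .halt := by
  obtain ⟨y, hxy, hy⟩ := h
  induction hxy using Relation.ReflTransGen.head_induction_on generalizing ε with
  | refl =>
    obtain ⟨q, T⟩ := y
    refine ⟨tapeCode e he B T ε, .single (.mono (mainRules_subset hx T.head ε) ?_)⟩
    have hn : M q T.head = none := by simpa [TM0.step] using hy
    simp only [mainRules, hn]
    exact (affineStep_ratioRules one_pos).2 ⟨tapeCode e he B T ε, by simp⟩
  | @head x z hxz _ ih =>
    have hz := TM0.step_supports M hM hxz hx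
    obtain ⟨q, T⟩ := x
    obtain ⟨⟨q', a⟩, ha, rfl⟩ := Option.map_eq_some_iff.1 hxz
    replace ih := ih hz
    cases a with
    | move d =>
      refine .head (y := (.work q' T.head d ε, tapeCode e he B T ε))
        (.mono (mainRules_subset hx T.head ε) ?_) ?_
      · simp only [mainRules, ha]
        exact (affineStep_ratioRules one_pos).2 ⟨tapeCode e he B T ε, by simp⟩
      · have := affineReaches_work hz T (ih (!ε)) _ _ 0 0 (zero_add _) (add_zero _)
        rwa [pow_zero, mul_one, pow_zero, mul_one, ← toNat_side_eq, ← tapeCode_eq] at this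
    | write a =>
      refine .head (.mono (mainRules_subset hx T.head ε) ?_) (ih ε)
      simp only [mainRules, ha]
      exact (affineStep_ratioRules one_pos).2 ⟨tapeCode e he B T ε, by simp; exact ⟨rfl, rfl⟩⟩

theorem affineReaches_tapeRules_iff (hB : ∀ a, e a < B) (hi : Function.Injective e)
    (hM : TM0.Supports M S) {q : Λ} (hq : q ∈ S) (T : Tape Γ) :
    AffineReaches (tapeRules M S e B) (.main q T.head false, tapeCode e he B T false) .halt ↔
      TM0Halts M ⟨q, T⟩ :=
  ⟨fun h => TapeGood.of_reaches (he := he) hB hi h T rfl rfl,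
    fun h => affineReaches_main_of_halts hM (x := ⟨q, T⟩) hq h false⟩

end TapeMachine

section Encoding

open Turing

theorem exists_digits (Γ : Type) [Inhabited Γ] [Finite Γ] :
    ∃ (e : Γ → ℕ) (B : ℕ), e default = 0 ∧ (∀ a, e a < B) ∧ Function.Injective e := by
  obtain ⟨n, ⟨E⟩⟩ := Finite.exists_equiv_fin Γ
  have : NeZero n := ⟨by rintro rfl; exact (E default).elim0⟩
  refine ⟨fun a => Equiv.swap (E default) 0 (E a), n, by simp, fun a => Fin.is_lt _, ?_⟩
  exact Fin.val_injective.comp ((Equiv.injective _).comp E.injective)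

theorem primrec_tapeCode {Γ : Type} [Inhabited Γ] (e : Γ → ℕ) (he : e default = 0) (B : ℕ)
    (x₀ x₁ x₂ : Γ) :
    Primrec fun n : ℕ =>
      tapeCode e he B (Tape.mk₁ (x₀ :: x₁ :: List.replicate n x₂)) false := by
  have h : Primrec fun n : ℕ =>
      3 ^ (e x₁ + B * Nat.rec (motive := fun _ => ℕ) 0 (fun _ t => e x₂ + B * t) n) :=
    (primrec_const_pow 3).comp (Primrec.nat_add.comp (.const _) (Primrec.nat_mul.comp (.const _)
      (.nat_rec₁ 0 (Primrec.nat_add.comp (.const _) (Primrec.nat_mul.comp (.const _) .snd)))))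
  refine h.of_eq fun n => ?_
  have hr : (ListBlank.mk (List.replicate n x₂)).toNat e he B =
      Nat.rec (motive := fun _ => ℕ) 0 (fun _ t => e x₂ + B * t) n := by
    rw [ListBlank.toNat_mk]
    induction n with
    | zero => rfl
    | succ n ih => rw [List.replicate_succ, List.foldr_cons, ih]
  rw [← hr, ← ListBlank.toNat_cons, ListBlank.cons_mk]
  have hl : (Tape.mk₁ (x₀ :: x₁ :: List.replicate n x₂)).left.toNat e he B = 0 := rfl
  rw [tapeCode, hl, pow_zero, one_mul]
  rfl

theorem primrec_cons_replicate {α : Type} [Primcodable α] (x y : α) {k : ℕ → ℕ} (hk : Primrec k) :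
    Primrec fun n => x :: List.replicate (k n) y := by
  have h : Primrec fun n => x :: (List.range (k n)).map fun _ => y :=
    Primrec.list_cons.comp (.const x)
      (.list_map (Primrec.list_range.comp hk) (Primrec₂.const y))
  exact h.of_eq fun n => by rw [List.map_const', List.length_range]

end Encoding

/-- If the independence alphabet is not a transitive forest, then there is a fixed
rational subset of the graph group with undecidable membership problem. -/
theorem exists_rationalSubset_membership_noncomputable
    {S : Type} [Fintype S] [DecidableEq S] (I : S → S → Prop)
    (hirr : ∀ a : S, ¬ I a a) (hsym : ∀ a b : S, I a b → I b a)
    (hnf : ¬ IsTransitiveForest I) :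
    ∃ L : Language (S ⊕ S), L.IsRegular ∧
      ¬ ComputablePred (fun w : List (S ⊕ S) =>
        graphEval I (FreeMonoid.ofList w) ∈
          (fun v : List (S ⊕ S) => graphEval I (FreeMonoid.ofList v)) '' L) := by
  obtain ⟨a, b, c, d, hab, hbc, hcd, hac, hbd, hac', hbd'⟩ :=
    exists_path_of_not_isTransitiveForest hirr hsym hnf
  obtain ⟨Γ, Λ, _, _, _, M, Q, x₀, x₁, x₂, hQ, hM, hn⟩ := exists_tm0_halting_not_computable
  obtain ⟨e, B, he, hB, hi⟩ := exists_digits Γ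
  refine ⟨{w | LabelPath (affineGraph (tapeRules M Q e B) .halt a b c d) .pop
      (.state (.main default x₀ false)) w},
    isRegular_labelPath (finite_affineGraph (finite_tapeRules M hQ e B) ..) _ _, fun h => hn ?_⟩
  refine ComputablePred.computable_of_manyOneReducible ⟨_, (primrec_cons_replicate (.inr a)
    (.inr c) (primrec_tapeCode e he B x₀ x₁ x₂)).to_comp, fun n => ?_⟩ h
  rw [mem_image_labelPath_iff hirr hsym hab hbc hcd hac hbd hac' hbd']
  exact (affineReaches_tapeRules_iff (he := he) hB hi hM hM.1
    (Turing.Tape.mk₁ (x₀ :: x₁ :: List.replicate n x₂))).symm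
end

section
/- Let Σ = {a,b,c,d} (e.g. Fin 4) and let I be the symmetric relation with exactly the pairs (a,b), (b,c), (c,d) and their transposes, so that (Σ,I) is the path P4. Then there exists a finitely generated submonoid M of the graph group G(Σ,I) (i.e. M = Submonoid.closure (π '' W) for some finite set W of words in List (Σ ⊕ Σ)) such that the predicate on words w ↦ (π w ∈ M) is not computable (¬ ComputablePred). -/
/-- The independence relation of the path `P4` on four vertices
`0 — 1 — 2 — 3`. -/
def P4rel : Fin 4 → Fin 4 → Prop := fun x y =>
  (x, y) ∈ ({(0, 1), (1, 0), (1, 2), (2, 1), (2, 3), (3, 2)} : Set (Fin 4 × Fin 4))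

/-- Instructions of a nondeterministic counter machine with registers indexed by `ℕ`. -/
inductive Instr
  | inc (i : ℕ)
  | dec (i : ℕ)
  | zero (i : ℕ)

namespace Instr

/-- The register an instruction refers to. -/
def reg : Instr → ℕ
  | inc i => i
  | dec i => i
  | zero i => i

/-- The effect of an instruction on the registers; `zero i` tests that register `i` is zero. -/
def Run : Instr → (ℕ → ℕ) → (ℕ → ℕ) → Prop
  | inc i, σ, τ => τ = Function.update σ i (σ i + 1)
  | dec i, σ, τ => σ i ≠ 0 ∧ τ = Function.update σ i (σ i - 1)
  | zero i, σ, τ => σ i = 0 ∧ τ = σ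

end Instr

/-- Structured nondeterministic counter programs. -/
inductive Prog
  | instr (a : Instr)
  | seq (p q : Prog)
  | star (p : Prog)

namespace Prog

/-- Input-output relation of a program. -/
def Run : Prog → (ℕ → ℕ) → (ℕ → ℕ) → Prop
  | instr a => a.Run
  | seq p q => fun σ τ => ∃ ρ, p.Run σ ρ ∧ q.Run ρ τ
  | star p => Relation.ReflTransGen p.Run

open Function

/-- Repeat `p` until register `c` is zero. -/
def loop (c : ℕ) (p : Prog) : Prog := seq (star p) (instr (.zero c))

theorem run_loop {c : ℕ} {p : Prog} {I : (ℕ → ℕ) → Prop} {F G : (ℕ → ℕ) → ℕ → ℕ}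
    (hp : ∀ σ, I σ → ∀ τ, p.Run σ τ ↔ σ c ≠ 0 ∧ τ = F σ)
    (hI : ∀ σ, I σ → σ c ≠ 0 → I (F σ))
    (hF : ∀ σ, I σ → σ c ≠ 0 → F σ c < σ c)
    (hG₀ : ∀ σ, I σ → σ c = 0 → G σ = σ)
    (hG : ∀ σ, I σ → σ c ≠ 0 → G (F σ) = G σ)
    (σ : ℕ → ℕ) (hσ : I σ) (τ : ℕ → ℕ) : (loop c p).Run σ τ ↔ τ = G σ := by
  constructor
  · rintro ⟨ρ, h, h0, rfl⟩
    induction h using Relation.ReflTransGen.head_induction_on with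
    | refl => exact (hG₀ _ hσ h0).symm
    | head h _ ih =>
      obtain ⟨hc, rfl⟩ := (hp _ hσ _).1 h
      rw [ih (hI _ hσ hc), hG _ hσ hc]
  · rintro rfl
    induction h : σ c using Nat.strong_induction_on generalizing σ with
    | _ n ih =>
      by_cases hc : σ c = 0
      · rw [hG₀ _ hσ hc]
        exact ⟨σ, .refl, hc, rfl⟩
      · obtain ⟨ρ, h1, h2⟩ := ih _ (h ▸ hF σ hσ hc) (F σ) (hI σ hσ hc) rfl
        rw [hG _ hσ hc] at h2
        exact ⟨ρ, h1.head ((hp _ hσ _).2 ⟨hc, rfl⟩), h2⟩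

/-- Set register `i` to zero. -/
def clear (i : ℕ) : Prog := loop i (instr (.dec i))

theorem run_clear (i : ℕ) (σ τ : ℕ → ℕ) : (clear i).Run σ τ ↔ τ = update σ i 0 := by
  refine run_loop (I := fun _ => True) (F := fun σ => update σ i (σ i - 1))
    (G := fun σ => update σ i 0) (fun σ _ τ => Iff.rfl) (fun _ _ _ => trivial) ?_ ?_ ?_ σ trivial τ
  · intro σ _ h
    simp only [update_self]; omega
  · intro σ _ h
    rw [← h, update_eq_self]
  · intro σ _ h
    simp

/-- Add register `i` to register `j`, emptying register `i`. -/
def move (i j : ℕ) : Prog := loop i (seq (instr (.dec i)) (instr (.inc j)))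

theorem run_move {i j : ℕ} (hij : i ≠ j) (σ τ : ℕ → ℕ) :
    (move i j).Run σ τ ↔ τ = update (update σ i 0) j (σ j + σ i) := by
  refine run_loop (I := fun _ => True)
    (F := fun σ => update (update σ i (σ i - 1)) j (σ j + 1))
    (G := fun σ => update (update σ i 0) j (σ j + σ i)) ?_ (fun _ _ _ => trivial) ?_ ?_ ?_ σ
    trivial τ
  · intro σ _ τ
    simp [Run, Instr.Run, hij.symm, and_assoc]
  · intro σ _ h
    simp [hij]; omega
  · intro σ _ h
    funext r
    simp only [update_apply]
    split_ifs <;> simp_all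
  · intro σ _ h
    funext r
    simp only [update_apply]
    split_ifs <;> omega

/-- Add register `i` to register `j`, using the empty register `k`. -/
def copy (i j k : ℕ) : Prog :=
  seq (loop i (seq (instr (.dec i)) (seq (instr (.inc j)) (instr (.inc k))))) (move k i)

theorem run_copy {i j k : ℕ} (hij : i ≠ j) (hik : i ≠ k) (hjk : j ≠ k) (σ τ : ℕ → ℕ)
    (hk : σ k = 0) : (copy i j k).Run σ τ ↔ τ = update σ j (σ j + σ i) := by
  have key : ∀ σ τ, (loop i (seq (instr (.dec i)) (seq (instr (.inc j)) (instr (.inc k))))).Run σ τ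
      ↔ τ = update (update (update σ i 0) j (σ j + σ i)) k (σ k + σ i) := by
    intro σ τ
    refine run_loop (I := fun _ => True)
      (F := fun σ => update (update (update σ i (σ i - 1)) j (σ j + 1)) k (σ k + 1))
      (G := fun σ => update (update (update σ i 0) j (σ j + σ i)) k (σ k + σ i)) ?_
      (fun _ _ _ => trivial) ?_ ?_ ?_ σ trivial τ
    · intro σ _ τ
      simp [Run, Instr.Run, hij.symm, hik.symm, hjk.symm, and_assoc]
    · intro σ _ h
      simp [hij, hik]; omega
    · intro σ _ h
      funext r
      simp only [update_apply]
      split_ifs <;> simp_all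
    · intro σ _ h
      funext r
      simp only [update_apply]
      split_ifs <;> omega
  simp only [copy, Run, key, run_move hik.symm, exists_eq_left]
  suffices h : ∀ r, _ = update σ j (σ j + σ i) r from ⟨fun e => e.trans (funext h),
    fun e => e.trans (funext h).symm⟩
  intro r
  simp only [update_apply]
  split_ifs <;> simp_all

/-- `P` computes `f` of the registers `ins` into register `b`, using only registers from `b` on
and restoring all registers except `b`. -/
def Computes {n : ℕ} (f : List.Vector ℕ n → ℕ) : Prop :=
  ∀ (ins : Fin n → ℕ) (b : ℕ), (∀ i, ins i < b) → ∃ P : Prog, ∀ σ : ℕ → ℕ, (∀ r, b ≤ r → σ r = 0) →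
    ∀ v : List.Vector ℕ n, (∀ i, v.get i = σ (ins i)) →
      ∀ τ, P.Run σ τ ↔ τ = update σ b (f v)

theorem Computes.tuple {n : ℕ} : ∀ {m : ℕ} {g : Fin m → List.Vector ℕ n → ℕ},
    (∀ i, Computes (g i)) → ∀ (ins : Fin n → ℕ) (b : ℕ), (∀ i, ins i < b) →
    ∃ P : Prog, ∀ σ : ℕ → ℕ, (∀ r, b ≤ r → σ r = 0) →
      ∀ v : List.Vector ℕ n, (∀ i, v.get i = σ (ins i)) →
        ∀ τ, P.Run σ τ ↔ τ = fun r => if h : b ≤ r ∧ r < b + m then g ⟨r - b, by omega⟩ v else σ r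
  | 0, g, _, ins, b, hb => by
    refine ⟨instr (.zero b), fun σ hσ v hv τ => ?_⟩
    have : ∀ r, ¬ (b ≤ r ∧ r < b) := by omega
    simp [Run, Instr.Run, hσ b le_rfl, this]
  | m + 1, g, hg, ins, b, hb => by
    obtain ⟨P, hP⟩ := Computes.tuple (fun i : Fin m => hg i.castSucc) ins b hb
    obtain ⟨P', hP'⟩ := hg (Fin.last m) ins (b + m) (fun i => by have := hb i; omega)
    refine ⟨seq P P', fun σ hσ v hv τ => ?_⟩
    simp only [Run, hP σ hσ v hv, exists_eq_left]
    rw [hP' _ (fun r hr => ?_) v (fun i => ?_)]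
    · suffices h : ∀ r, _ = dite _ _ _ from
        ⟨fun e => e.trans (funext h), fun e => e.trans (funext h).symm⟩
      intro r
      simp only [update_apply]
      split_ifs with h1 h2 h3 h4 <;> first | omega | rfl | skip
      congr 1; ext; simp [h1]
    · rw [dif_neg (by omega), hσ r (by omega)]
    · rw [dif_neg (by have := hb i; omega), hv]

/-- Set the registers `b, …, b + m` to zero. -/
def clearRange (b : ℕ) : ℕ → Prog
  | 0 => clear b
  | m + 1 => seq (clearRange b m) (clear (b + m + 1))

theorem run_clearRange (b m : ℕ) (σ τ : ℕ → ℕ) :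
    (clearRange b m).Run σ τ ↔ τ = fun r => if b ≤ r ∧ r ≤ b + m then 0 else σ r := by
  induction m generalizing τ with
  | zero =>
    simp only [clearRange, run_clear, add_zero, funext_iff, update_apply]
    refine forall_congr' fun r => ?_
    split_ifs <;> first | rfl | omega
  | succ m ih =>
    simp only [clearRange, Run, ih, exists_eq_left, run_clear]
    simp only [funext_iff, update_apply]
    refine forall_congr' fun r => ?_
    split_ifs <;> first | rfl | omega

theorem Computes.zero : Computes (n := 0) fun _ => 0 := fun _ b _ =>
  ⟨clear b, fun σ _ _ _ τ => run_clear b σ τ⟩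

theorem Computes.get {n : ℕ} (i : Fin n) : Computes fun v => v.get i := fun ins b hb => by
  refine ⟨copy (ins i) b (b + 1), fun σ hσ v hv τ => ?_⟩
  have := hb i
  rw [run_copy (by omega) (by omega) (by omega) σ τ (hσ _ (by omega)), hσ b le_rfl, zero_add, ← hv]

theorem Computes.succ : Computes (n := 1) fun v => v.head.succ := fun ins b hb => by
  obtain ⟨P, hP⟩ := Computes.get (0 : Fin 1) ins b hb
  refine ⟨seq P (instr (.inc b)), fun σ hσ v hv τ => ?_⟩
  simp [Run, hP σ hσ v hv, Instr.Run]

theorem Computes.comp {m n : ℕ} {f : List.Vector ℕ n → ℕ} {g : Fin n → List.Vector ℕ m → ℕ}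
    (hf : Computes f) (hg : ∀ i, Computes (g i)) :
    Computes fun a => f (List.Vector.ofFn fun i => g i a) := fun ins b hb => by
  obtain ⟨P, hP⟩ := Computes.tuple hg ins (b + 1) fun i => (hb i).trans b.lt_succ_self
  obtain ⟨Q, hQ⟩ := hf (fun i => b + 1 + i) (b + 1 + n) fun i => by omega
  refine ⟨seq P (seq Q (seq (move (b + 1 + n) b) (clearRange (b + 1) n))), fun σ hσ v hv τ => ?_⟩
  simp only [Run, hP σ (fun r hr => hσ r (by omega)) v hv, exists_eq_left]
  rw [exists_congr fun ρ => and_congr_left fun _ => hQ _ (fun r hr => ?_)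
    (List.Vector.ofFn fun i => g i v) (fun i => ?_) ρ]
  · simp only [exists_eq_left, run_move (show b + 1 + n ≠ b by omega), run_clearRange]
    simp only [funext_iff, update_apply]
    refine forall_congr' fun r => ?_
    have := hσ r
    have := hσ b le_rfl
    split_ifs <;> omega
  · rw [dif_neg (by omega), hσ r (by omega)]
  · simp

theorem Computes.prec {n : ℕ} {f : List.Vector ℕ n → ℕ} {g : List.Vector ℕ (n + 2) → ℕ}
    (hf : Computes f) (hg : Computes g) :
    Computes fun v : List.Vector ℕ (n + 1) =>
      v.head.rec (f v.tail) fun y IH => g (y ::ᵥ IH ::ᵥ v.tail) := fun ins b hb => by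
  obtain ⟨P, hP⟩ := hf (fun i => ins i.succ) b fun i => hb _
  obtain ⟨Q, hQ⟩ := hg (Fin.cons (b + 1) (Fin.cons b fun i => ins i.succ)) (b + 3) fun i => by
    refine Fin.cases ?_ (fun i => Fin.cases ?_ (fun i => ?_) i) i <;> simp
    have := hb i.succ; omega
  let body := seq (instr (.dec (b + 2))) (seq Q (seq (clear b)
    (seq (move (b + 3) b) (instr (.inc (b + 1))))))
  refine ⟨seq P (seq (copy (ins 0) (b + 2) (b + 3)) (seq (loop (b + 2) body) (clear (b + 1)))),
    fun σ hσ v hv τ => ?_⟩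
  have hb' := fun i => (hb i).ne
  have hv' : ∀ i, v.tail.get i = σ (ins i.succ) := fun i => by rw [← hv, List.Vector.get_tail_succ]
  let I : (ℕ → ℕ) → Prop := fun ρ => (∀ r, b + 3 ≤ r → ρ r = 0) ∧ ∀ r, r < b → ρ r = σ r
  let it : ℕ → ℕ → ℕ → ℕ := fun c => c.rec (fun _ IH => IH)
    fun _ next y IH => next (y + 1) (g (y ::ᵥ IH ::ᵥ v.tail))
  have hit : ∀ c y, it c y (y.rec (f v.tail) fun y IH => g (y ::ᵥ IH ::ᵥ v.tail)) =
      (y + c).rec (f v.tail) fun y IH => g (y ::ᵥ IH ::ᵥ v.tail) := by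
    intro c
    induction c with
    | zero => intro y; rfl
    | succ c ih => intro y; rw [← add_assoc, add_right_comm, ← ih (y + 1)]
  have hloop : ∀ ρ, I ρ → ∀ τ, (loop (b + 2) body).Run ρ τ ↔
      τ = update (update (update ρ b (it (ρ (b + 2)) (ρ (b + 1)) (ρ b)))
        (b + 1) (ρ (b + 1) + ρ (b + 2))) (b + 2) 0 := by
    refine run_loop (F := fun ρ => update (update (update ρ (b + 2) (ρ (b + 2) - 1))
      b (g (ρ (b + 1) ::ᵥ ρ b ::ᵥ v.tail))) (b + 1) (ρ (b + 1) + 1)) ?_ ?_ ?_ ?_ ?_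
    · intro ρ hρ τ
      simp only [body, Run, Instr.Run, and_assoc, exists_and_left, exists_eq_left]
      refine and_congr_right fun hc => ?_
      rw [exists_congr fun ρ' => and_congr_left fun _ => hQ _ (fun r hr => ?_)
        (ρ (b + 1) ::ᵥ ρ b ::ᵥ v.tail) (fun i => ?_) ρ']
      · simp only [exists_eq_left, run_clear, run_move (show b + 3 ≠ b by omega)]
        simp only [funext_iff, update_apply]
        refine forall_congr' fun r => ?_
        have := hρ.1 r
        split_ifs <;> omega
      · rw [update_apply, if_neg (by omega), hρ.1 r hr]
      · refine Fin.cases ?_ (fun i => Fin.cases ?_ (fun i => ?_) i) i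
        · simp
        · simp only [Fin.cons_succ, Fin.cons_zero, List.Vector.get_cons_succ, List.Vector.get_cons_zero]
          simp
        · have := hb i.succ
          simp [hv', update_apply, hρ.2 _ this]
          omega
    · intro ρ hρ _
      refine ⟨fun r hr => ?_, fun r hr => ?_⟩
      · have := hρ.1 r hr
        simp only [update_apply]
        split_ifs <;> omega
      · have := hρ.2 r hr
        simp only [update_apply]
        split_ifs <;> omega
    · intro ρ _ h
      simp; omega
    · intro ρ _ h
      funext r
      simp only [update_apply, h]
      split_ifs <;> simp_all [it]
    · intro ρ _ h
      obtain ⟨c, hc⟩ := Nat.exists_eq_succ_of_ne_zero h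
      funext r
      simp only [update_apply, hc]
      split_ifs <;> first | omega | simp_all [it]
  have h0 := hb 0
  simp only [Run, hP σ hσ _ hv', exists_eq_left]
  rw [exists_congr fun ρ => and_congr_left fun _ => run_copy (by omega) (by omega) (by omega) _ ρ
    (by rw [update_apply, if_neg (by omega), hσ _ (by omega)])]
  simp only [exists_eq_left]
  rw [exists_congr fun ρ => and_congr_left fun _ => hloop _ ⟨fun r hr => ?_, fun r hr => ?_⟩ ρ]
  · simp only [exists_eq_left, run_clear]
    have h1 := hσ (b + 1) (by omega)
    have h2 := hσ (b + 2) (by omega)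
    have key := hit v.head 0
    have h3 : v.head = σ (ins 0) := by rw [← hv, List.Vector.get_zero]
    simp only [funext_iff, update_apply]
    refine forall_congr' fun r => ?_
    simp only [zero_add] at key
    split_ifs <;> first | omega | simp_all
  · simp only [update_apply]
    rw [if_neg (by omega), if_neg (by omega), hσ r (by omega)]
  · simp only [update_apply]
    rw [if_neg (by omega), if_neg (by omega)]

theorem Computes.of_primrec {n : ℕ} {f : List.Vector ℕ n → ℕ} (hf : Nat.Primrec' f) :
    Computes f := by
  induction hf with
  | zero => exact .zero
  | succ => exact .succ
  | get i => exact .get i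
  | comp g _ _ hf hg => exact .comp hf hg
  | prec _ _ hf hg => exact .prec hf hg

/-- Every projection of a primitive recursive relation is the domain of a counter program. -/
theorem exists_run_iff {f : ℕ → ℕ → ℕ} (hf : Primrec₂ f) :
    ∃ P : Prog, ∀ n, (∃ τ, P.Run (Pi.single 0 n) τ) ↔ ∃ k, f n k ≠ 0 := by
  obtain ⟨P, hP⟩ := Computes.of_primrec (Nat.Primrec'.prim_iff₂.2 hf) (fun i => i) 2 fun i => i.2
  have hstar : ∀ n τ, (star (instr (.inc 1))).Run (Pi.single 0 n) τ ↔
      ∃ k, τ = update (Pi.single 0 n) 1 k := by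
    refine fun n τ => ⟨fun h => ?_, ?_⟩
    · induction h with
      | refl => exact ⟨0, by funext r; by_cases h : r = 1 <;> simp [h]⟩
      | tail _ h ih =>
        obtain ⟨k, rfl⟩ := ih
        exact ⟨k + 1, by simpa [Run, Instr.Run] using h⟩
    · rintro ⟨k, rfl⟩
      induction k with
      | zero => 
        rw [show update (Pi.single 0 n : ℕ → ℕ) 1 0 = Pi.single 0 n by
          funext r; by_cases h : r = 1 <;> simp [h]]
        exact .refl
      | succ k ih => exact ih.tail (by simp [Run, Instr.Run])
  refine ⟨seq (star (instr (.inc 1))) (seq P (instr (.dec 2))), fun n => ?_⟩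
  have hrun : ∀ k τ, P.Run (update (Pi.single 0 n) 1 k) τ ↔
      τ = update (update (Pi.single 0 n) 1 k) 2 (f n k) := fun k τ => by
    refine hP _ (fun r hr => ?_) (n ::ᵥ k ::ᵥ List.Vector.nil) (fun i => ?_) τ
    · rw [update_apply, if_neg (by omega), Pi.single_apply, if_neg (by omega)]
    · refine Fin.cases ?_ (fun i => Fin.cases ?_ (fun i => i.elim0) i) i
      · simp
      · rw [List.Vector.get_cons_succ, List.Vector.get_cons_zero]; simp
  constructor
  · rintro ⟨τ, ρ, h1, ρ', h2, h3, -⟩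
    obtain ⟨k, rfl⟩ := (hstar _ _).1 h1
    obtain rfl := (hrun _ _).1 h2
    exact ⟨k, by simpa using h3⟩
  · rintro ⟨k, hk⟩
    exact ⟨_, _, (hstar _ _).2 ⟨k, rfl⟩, _, (hrun _ _).2 rfl, by simpa using hk, rfl⟩

end Prog
namespace Prog

open Relation

/-- Elementary control steps on the stack of programs still to be executed, labelled with the
instruction that is performed, if any. -/
inductive Move : List Prog → Option Instr → List Prog → Prop
  | instr (a l) : Move (instr a :: l) (some a) l
  | seq (p q l) : Move (seq p q :: l) none (p :: q :: l)
  | exit (p l) : Move (star p :: l) none l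
  | enter (p l) : Move (star p :: l) none (p :: star p :: l)

/-- The effect of an optional instruction. -/
def RunOption : Option Instr → (ℕ → ℕ) → (ℕ → ℕ) → Prop
  | none, σ, τ => τ = σ
  | some a, σ, τ => a.Run σ τ

/-- A step of the stack machine. -/
def Step (x y : List Prog × (ℕ → ℕ)) : Prop := ∃ o, Move x.1 o y.1 ∧ RunOption o x.2 y.2

/-- Run the programs on a stack one after the other. -/
def RunList : List Prog → (ℕ → ℕ) → (ℕ → ℕ) → Prop
  | [], σ, τ => τ = σ
  | p :: l, σ, τ => ∃ ρ, p.Run σ ρ ∧ RunList l ρ τ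

theorem reflTransGen_step_of_run {p : Prog} (l : List Prog) {σ τ : ℕ → ℕ} (h : p.Run σ τ) :
    ReflTransGen Step (p :: l, σ) (l, τ) := by
  induction p generalizing l σ τ with
  | instr a => exact .single ⟨_, .instr a l, h⟩
  | seq p q hp hq =>
    obtain ⟨ρ, h1, h2⟩ := h
    have : Step (seq p q :: l, σ) (p :: q :: l, σ) := ⟨none, .seq p q l, rfl⟩
    exact ((hp (q :: l) h1).trans (hq l h2)).head this
  | star p hp =>
    induction h using ReflTransGen.head_induction_on with
    | refl => exact .single ⟨none, .exit p l, rfl⟩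
    | @head σ _ h _ ih =>
      have : Step (star p :: l, σ) (p :: star p :: l, σ) := ⟨none, .enter p l, rfl⟩
      exact ((hp (star p :: l) h).trans ih).head this

theorem runList_of_step {x y : List Prog × (ℕ → ℕ)} {τ : ℕ → ℕ} (h : Step x y)
    (hy : RunList y.1 y.2 τ) : RunList x.1 x.2 τ := by
  obtain ⟨l, σ⟩ := x
  obtain ⟨l', σ'⟩ := y
  obtain ⟨o, h, ho⟩ := h
  cases h with
  | instr a => exact ⟨_, ho, hy⟩
  | seq p q l =>
    obtain rfl := ho
    obtain ⟨ρ, h1, ρ', h2, h3⟩ := hy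
    exact ⟨_, ⟨ρ, h1, h2⟩, h3⟩
  | exit p =>
    obtain rfl := ho
    exact ⟨_, .refl, hy⟩
  | enter p l =>
    obtain rfl := ho
    obtain ⟨ρ, h1, ρ', h2, h3⟩ := hy
    exact ⟨_, h2.head h1, h3⟩

theorem run_iff_reflTransGen_step {p : Prog} {σ τ : ℕ → ℕ} :
    p.Run σ τ ↔ ReflTransGen Step ([p], σ) ([], τ) := by
  refine ⟨reflTransGen_step_of_run [], fun h => ?_⟩
  suffices h : RunList [p] σ τ by
    obtain ⟨ρ, h, rfl⟩ := h
    exact h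
  suffices ∀ x, ReflTransGen Step x ([], τ) → RunList x.1 x.2 τ from this _ h
  intro x hx
  induction hx using ReflTransGen.head_induction_on with
  | refl => rfl
  | head h _ ih => exact runList_of_step h ih

/-- The nonempty stacks reachable from `p :: l` before `p` is finished. -/
def reach : Prog → List Prog → Set (List Prog)
  | instr a, l => {instr a :: l}
  | seq p q, l => {seq p q :: l} ∪ (reach p (q :: l) ∪ reach q l)
  | star p, l => {star p :: l} ∪ reach p (star p :: l)

theorem finite_reach (p : Prog) (l : List Prog) : (reach p l).Finite := by
  induction p generalizing l with
  | instr a => exact Set.finite_singleton _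
  | seq p q hp hq => exact (Set.finite_singleton _).union ((hp _).union (hq _))
  | star p hp => exact (Set.finite_singleton _).union (hp _)

theorem cons_mem_reach (p : Prog) (l : List Prog) : p :: l ∈ reach p l := by
  cases p <;> simp [reach]

theorem mem_reach_of_move {p : Prog} {l x y : List Prog} {o : Option Instr} (hx : x ∈ reach p l)
    (h : Move x o y) : y ∈ reach p l ∨ y = l := by
  induction p generalizing l with
  | instr a =>
    obtain rfl := hx
    cases h
    exact .inr rfl
  | seq p q hp hq =>
    rcases hx with hx | hx | hx
    · obtain rfl := hx
      cases h
      exact .inl (.inr (.inl (cons_mem_reach _ _)))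
    · rcases hp hx with h | rfl
      · exact .inl (.inr (.inl h))
      · exact .inl (.inr (.inr (cons_mem_reach _ _)))
    · rcases hq hx with h | rfl
      · exact .inl (.inr (.inr h))
      · exact .inr rfl
  | star p hp =>
    rcases hx with hx | hx
    · obtain rfl := hx
      cases h
      · exact .inr rfl
      · exact .inl (.inr (cons_mem_reach _ _))
    · rcases hp hx with h | rfl
      · exact .inl (.inr h)
      · exact .inl (.inl rfl)

end Prog

/-- The numbers `m * k + r`, `k : ℕ`, are rewritten to `p * k + s`. -/
structure AffineRule_s3 where
  m : ℕ
  r : ℕ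
  p : ℕ
  s : ℕ

/-- One application of an affine rule. -/
def AffineRule_s3.Step (ρ : AffineRule_s3) (n n' : ℕ) : Prop := ∃ k, n = ρ.m * k + ρ.r ∧ n' = ρ.p * k + ρ.s

namespace Instr

/-- Affine rules acting on Gödel numbers as an instruction acts on registers. -/
noncomputable def rules : Option Instr → Set AffineRule_s3
  | none => {⟨1, 0, 1, 0⟩}
  | some (inc i) => {⟨1, 0, Nat.nth Nat.Prime i, 0⟩}
  | some (dec i) => {⟨Nat.nth Nat.Prime i, 0, 1, 0⟩}
  | some (zero i) => (fun t => ⟨Nat.nth Nat.Prime i, t, Nat.nth Nat.Prime i, t⟩) ''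
      Set.Ioo 0 (Nat.nth Nat.Prime i)

theorem finite_rules (o : Option Instr) : (rules o).Finite := by
  rcases o with _ | i | i | i
  · exact Set.finite_singleton _
  · exact Set.finite_singleton _
  · exact Set.finite_singleton _
  · exact (Set.finite_Ioo _ _).image _

theorem p_pos_of_mem_rules {o : Option Instr} {ρ : AffineRule_s3} (h : ρ ∈ rules o) : 0 < ρ.p := by
  have := fun i => (Nat.prime_nth_prime i).pos
  rcases o with _ | i | i | i
  · obtain rfl := h; exact one_pos
  · obtain rfl := h; exact this i
  · obtain rfl := h; exact one_pos
  · obtain ⟨t, -, rfl⟩ := h; exact this i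

/-- Gödel number of the first `K` registers. -/
noncomputable def godel (K : ℕ) (σ : ℕ → ℕ) : ℕ := ∏ i ∈ Finset.range K, Nat.nth Nat.Prime i ^ σ i

theorem godel_pos (K : ℕ) (σ : ℕ → ℕ) : 0 < godel K σ :=
  Finset.prod_pos fun i _ => pow_pos (Nat.prime_nth_prime i).pos _

theorem godel_update {K i : ℕ} (hi : i < K) (σ : ℕ → ℕ) (c : ℕ) :
    godel K (Function.update σ i (σ i + c)) = Nat.nth Nat.Prime i ^ c * godel K σ := by
  have := Finset.mem_range.2 hi
  rw [godel, godel, ← Finset.mul_prod_erase _ _ this, ← Finset.mul_prod_erase _ _ this,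
    Function.update_self, add_comm, pow_add, mul_assoc]
  congr 2
  refine Finset.prod_congr rfl fun j hj => ?_
  rw [Function.update_of_ne (Finset.ne_of_mem_erase hj)]

theorem dvd_godel_iff {K i : ℕ} (hi : i < K) (σ : ℕ → ℕ) :
    Nat.nth Nat.Prime i ∣ godel K σ ↔ σ i ≠ 0 := by
  have hp := Nat.prime_nth_prime
  refine ⟨fun h h0 => ?_, fun h => ?_⟩
  · obtain ⟨j, -, hj⟩ := (hp i).prime.exists_mem_finset_dvd h
    have hij : i = j := Nat.nth_injective Nat.infinite_setOfPred_prime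
      ((Nat.prime_dvd_prime_iff_eq (hp i) (hp j)).1 ((hp i).dvd_of_dvd_pow hj))
    rw [← hij, h0, pow_zero, Nat.dvd_one] at hj
    exact (hp i).one_lt.ne' hj
  · exact (dvd_pow_self _ h).trans (Finset.dvd_prod_of_mem _ (Finset.mem_range.2 hi))

theorem exists_rule_step_iff {K : ℕ} {o : Option Instr} (ho : ∀ a ∈ o, a.reg < K) (σ : ℕ → ℕ)
    (n : ℕ) : (∃ ρ ∈ rules o, ρ.Step (godel K σ) n) ↔
      ∃ τ, Prog.RunOption o σ τ ∧ n = godel K τ := by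
  rcases o with _ | i | i | i
  · simp [rules, AffineRule_s3.Step, Prog.RunOption]
  · have hi : i < K := ho (inc i) rfl
    simp [rules, AffineRule_s3.Step, Prog.RunOption, Run, godel_update hi]
  · have hi : i < K := ho (dec i) rfl
    have hp := (Nat.prime_nth_prime i).pos
    simp only [rules, AffineRule_s3.Step, Prog.RunOption, Run, Set.mem_singleton_iff, exists_eq_left,
      add_zero, one_mul, and_assoc, exists_and_left]
    rw [← dvd_godel_iff hi]
    have key : σ i ≠ 0 → godel K σ =
        Nat.nth Nat.Prime i * godel K (Function.update σ i (σ i - 1)) := fun h => by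
      have := godel_update hi (Function.update σ i (σ i - 1)) 1
      rw [Function.update_self, Nat.sub_add_cancel (Nat.pos_of_ne_zero h), Function.update_idem,
        Function.update_eq_self, pow_one] at this
      exact this
    constructor
    · rintro ⟨k, h, rfl⟩
      have hd : Nat.nth Nat.Prime i ∣ godel K σ := ⟨_, h⟩
      refine ⟨hd, Nat.eq_of_mul_eq_mul_left hp ?_⟩
      rw [← h, ← key ((dvd_godel_iff hi σ).1 hd)]
    · rintro ⟨hd, rfl⟩
      exact ⟨_, key ((dvd_godel_iff hi σ).1 hd), rfl⟩
  · have hi : i < K := ho (zero i) rfl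
    have hp := (Nat.prime_nth_prime i).pos
    have := dvd_godel_iff hi σ
    simp only [rules, AffineRule_s3.Step, Prog.RunOption, Run, Set.exists_mem_image, and_assoc,
      exists_and_left, exists_eq_left]
    constructor
    · rintro ⟨t, ⟨h0, h1⟩, k, h, rfl⟩
      refine ⟨not_not.1 fun h' => ?_, h.symm⟩
      rw [← ne_eq, ← this, h, ← Nat.dvd_add_iff_right (dvd_mul_right _ _)] at h'
      exact absurd (Nat.le_of_dvd h0 h') (by omega)
    · rintro ⟨h, rfl⟩
      refine ⟨godel K σ % Nat.nth Nat.Prime i, ⟨Nat.pos_of_ne_zero fun h' => ?_, Nat.mod_lt _ hp⟩,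
        _, (Nat.div_add_mod _ _).symm, (Nat.div_add_mod _ _).symm⟩
      exact this.1 (Nat.dvd_of_mod_eq_zero h') h

end Instr

/-- The rule acting as `ρ` on `N` while changing the state `a` to `b` in `Q * N + a`. -/
def AffineRule_s3.lift (Q a b : ℕ) (ρ : AffineRule_s3) : AffineRule_s3 :=
  ⟨Q * ρ.m, Q * ρ.r + a, Q * ρ.p, Q * ρ.s + b⟩

theorem Nat.mul_add_inj_of_lt {Q a b M N : ℕ} (ha : a < Q) (hb : b < Q) :
    Q * M + a = Q * N + b ↔ M = N ∧ a = b := by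
  refine ⟨fun h => ?_, fun ⟨h1, h2⟩ => h1 ▸ h2 ▸ rfl⟩
  have h1 := congrArg (· % Q) h
  simp only [Nat.mul_add_mod, Nat.mod_eq_of_lt ha, Nat.mod_eq_of_lt hb] at h1
  subst h1
  exact ⟨Nat.eq_of_mul_eq_mul_left (by omega) (Nat.add_right_cancel h), rfl⟩

theorem AffineRule_s3.lift_step_iff {Q a b c N n : ℕ} (ha : a < Q) (hc : c < Q) (ρ : AffineRule_s3) :
    (ρ.lift Q a b).Step (Q * N + c) n ↔ c = a ∧ ∃ N', ρ.Step N N' ∧ n = Q * N' + b := by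
  have key : ∀ k, Q * ρ.m * k + (Q * ρ.r + a) = Q * (ρ.m * k + ρ.r) + a := fun k => by ring
  have key' : ∀ k, Q * ρ.p * k + (Q * ρ.s + b) = Q * (ρ.p * k + ρ.s) + b := fun k => by ring
  simp only [AffineRule_s3.Step, lift, key, key', Nat.mul_add_inj_of_lt hc ha]
  constructor
  · rintro ⟨k, ⟨h, rfl⟩, rfl⟩
    exact ⟨rfl, _, ⟨k, h, rfl⟩, rfl⟩
  · rintro ⟨rfl, _, ⟨k, h, rfl⟩, rfl⟩
    exact ⟨k, ⟨h, rfl⟩, rfl⟩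

namespace Prog

open Relation

/-- The instruction at the top of a stack. -/
def label : List Prog → Option Instr
  | instr a :: _ => some a
  | _ => none

theorem Move.eq_label {l l' : List Prog} {o : Option Instr} (h : Move l o l') : o = label l := by
  cases h <;> rfl

/-- Halting of a counter program is reachability of `0` for finitely many affine rules. -/
theorem exists_affineRules (P : Prog) : ∃ R : Set AffineRule_s3, R.Finite ∧ (∀ ρ ∈ R, 0 < ρ.p) ∧
    ∃ Q q, ∀ n, (∃ τ, P.Run (Pi.single 0 n) τ) ↔
      ReflTransGen (fun x y => ∃ ρ ∈ R, ρ.Step x y) (Q * 2 ^ n + q) 0 := by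
  set X : Set (List Prog) := insert [] (reach P []) with hX
  have hXf : X.Finite := (finite_reach P []).insert _
  have hXm : ∀ {x o y}, x ∈ X → Move x o y → y ∈ X := by
    rintro x o y (rfl | hx) h
    · cases h
    · exact (mem_reach_of_move hx h).symm
  obtain ⟨e, he⟩ := Set.countable_iff_exists_injOn.1 hXf.countable
  obtain ⟨Q', hQ'⟩ := (hXf.image e).bddAbove
  obtain ⟨K', hK'⟩ := (hXf.image fun x => (label x).elim 0 Instr.reg).bddAbove
  obtain ⟨Q, hQ⟩ : ∃ Q, ∀ x ∈ X, e x < Q :=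
    ⟨Q' + 1, fun x hx => Nat.lt_succ_of_le (hQ' ⟨x, hx, rfl⟩)⟩
  obtain ⟨K, hK₀, hK⟩ : ∃ K, 0 < K ∧ ∀ x ∈ X, ∀ a ∈ label x, a.reg < K := by
    refine ⟨K' + 1, K'.succ_pos, fun x hx a ha => Nat.lt_succ_of_le ?_⟩
    have : (label x).elim 0 Instr.reg ≤ K' := hK' ⟨x, hx, rfl⟩
    rwa [Option.mem_def.1 ha] at this
  have h0X : [] ∈ X := .inl rfl
  have hQ₀ : 0 < Q := (Nat.zero_le _).trans_lt (hQ _ h0X)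
  set R₁ : Set AffineRule_s3 := ⋃ z ∈ {z ∈ X ×ˢ X | Move z.1 (label z.1) z.2},
    AffineRule_s3.lift Q (e z.1) (e z.2) '' Instr.rules (label z.1) with hR₁
  let E : List Prog × (ℕ → ℕ) → ℕ := fun x => Q * Instr.godel K x.2 + e x.1
  have hstep : ∀ x : List Prog × (ℕ → ℕ), x.1 ∈ X → ∀ n,
      (∃ ρ ∈ R₁, ρ.Step (E x) n) ↔ ∃ y, Step x y ∧ n = E y := by
    rintro ⟨x, σ⟩ hx n
    simp only [hR₁, Set.mem_iUnion, Set.mem_image, exists_prop]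
    constructor
    · rintro ⟨_, ⟨⟨x', y⟩, ⟨⟨hx', hy⟩, hm⟩, ρ, hρ, rfl⟩, h⟩
      obtain ⟨hxx, N, hN, rfl⟩ := (AffineRule_s3.lift_step_iff (hQ _ hx') (hQ _ hx) ρ).1 h
      obtain rfl := he hx hx' hxx
      obtain ⟨τ, hτ, rfl⟩ := (Instr.exists_rule_step_iff (hK _ hx) σ N).1 ⟨ρ, hρ, hN⟩
      exact ⟨(y, τ), ⟨_, hm, hτ⟩, rfl⟩
    · rintro ⟨⟨y, τ⟩, ⟨o, hm, hτ⟩, rfl⟩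
      obtain rfl := hm.eq_label
      obtain ⟨ρ, hρ, hN⟩ := (Instr.exists_rule_step_iff (hK _ hx) σ _).2 ⟨τ, hτ, rfl⟩
      exact ⟨_, ⟨(x, y), ⟨⟨hx, hXm hx hm⟩, hm⟩, ρ, hρ, rfl⟩,
        (AffineRule_s3.lift_step_iff (hQ _ hx) (hQ _ hx) ρ).2 ⟨rfl, _, hN, rfl⟩⟩
  set R₂ : Set AffineRule_s3 := {⟨Q, Q + e [], Q, e []⟩, ⟨0, e [], 1, 0⟩} with hR₂
  refine ⟨R₁ ∪ R₂, Set.Finite.union ?_ (by simp [hR₂]), ?_, Q, e [P], fun n => ?_⟩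
  · exact ((hXf.prod hXf).subset (Set.sep_subset _ _)).biUnion fun z _ =>
      (Instr.finite_rules _).image _
  · rintro ρ (h | rfl | rfl)
    · simp only [hR₁, Set.mem_iUnion, Set.mem_image] at h
      obtain ⟨z, -, ρ, hρ, rfl⟩ := h
      exact Nat.mul_pos hQ₀ (Instr.p_pos_of_mem_rules hρ)
    · exact hQ₀
    · exact one_pos
  have hE : Q * 2 ^ n + e [P] = E ([P], Pi.single 0 n) := by
    have : Instr.godel K (Pi.single 0 n) = 2 ^ n := by
      rw [Instr.godel, Finset.prod_eq_single_of_mem 0 (Finset.mem_range.2 hK₀)]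
      · rw [Nat.nth_prime_zero_eq_two, Pi.single_eq_same]
      · intro i _ hi
        rw [Pi.single_eq_of_ne hi, pow_zero]
    simp only [E, this]
  simp only [hE, run_iff_reflTransGen_step]
  constructor
  · rintro ⟨τ, h⟩
    suffices ∀ x, ReflTransGen Step x ([], τ) → x.1 ∈ X →
        ReflTransGen (fun x y => ∃ ρ ∈ R₁ ∪ R₂, ρ.Step x y) (E x) 0 from
      this _ h (.inr (cons_mem_reach P []))
    intro x hx
    induction hx using ReflTransGen.head_induction_on with
    | refl =>
      intro _
      simp only [E]
      generalize Instr.godel K τ = N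
      induction N with
      | zero => exact .single ⟨⟨0, e [], 1, 0⟩, .inr (.inr rfl), 0, by simp⟩
      | succ N ih =>
        exact ih.head ⟨⟨Q, Q + e [], Q, e []⟩, .inr (.inl rfl), N, by dsimp only; ring, rfl⟩
    | head h _ ih =>
      intro hx
      have hy := hXm hx h.choose_spec.1
      obtain ⟨ρ, hρ, hs⟩ := (hstep _ hx _).2 ⟨_, h, rfl⟩
      exact (ih hy).head ⟨ρ, .inl hρ, hs⟩
  · intro h
    suffices ∀ n, ReflTransGen (fun x y => ∃ ρ ∈ R₁ ∪ R₂, ρ.Step x y) n 0 →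
        ∀ x : List Prog × (ℕ → ℕ), x.1 ∈ X → n = E x → ∃ τ, ReflTransGen Step x ([], τ) from
      this _ h _ (.inr (cons_mem_reach P [])) rfl
    intro n hn
    induction hn using ReflTransGen.head_induction_on with
    | refl =>
      intro x _ h
      have := Nat.mul_pos hQ₀ (Instr.godel_pos K x.2)
      simp only [E] at h
      omega
    | head h _ ih =>
      rintro ⟨x, σ⟩ hx rfl
      obtain ⟨ρ, hρ | rfl | rfl, hs⟩ := h
      · obtain ⟨y, hy, rfl⟩ := (hstep _ hx _).1 ⟨ρ, hρ, hs⟩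
        obtain ⟨τ, hτ⟩ := ih y (hXm hx hy.choose_spec.1) rfl
        exact ⟨τ, hτ.head hy⟩
      all_goals
        obtain ⟨k, hk, -⟩ := hs
        suffices x = [] by subst this; exact ⟨σ, .refl⟩
        apply he hx h0X
      · rw [← add_assoc, ← mul_add_one] at hk
        exact ((Nat.mul_add_inj_of_lt (hQ _ hx) (hQ _ h0X)).1 hk).2
      · rw [zero_mul, ← mul_zero Q] at hk
        exact ((Nat.mul_add_inj_of_lt (hQ _ hx) (hQ _ h0X)).1 hk).2

end Prog
/-- The wreath product `ℤ ≀ ℤ`, with lamp configurations of arbitrary support. -/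
@[ext]
structure Lamplighter where
  /-- The states of the lamps. -/
  lamp : ℤ → ℤ
  /-- The position of the lamplighter. -/
  pos : ℤ

namespace Lamplighter

instance : Mul Lamplighter := ⟨fun x y => ⟨fun i => x.lamp i + y.lamp (i - x.pos), x.pos + y.pos⟩⟩
instance : One Lamplighter := ⟨⟨0, 0⟩⟩
instance : Inv Lamplighter := ⟨fun x => ⟨fun i => -x.lamp (i + x.pos), -x.pos⟩⟩

@[simp] theorem lamp_mul (x y : Lamplighter) (i : ℤ) :
    (x * y).lamp i = x.lamp i + y.lamp (i - x.pos) := rfl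
@[simp] theorem pos_mul (x y : Lamplighter) : (x * y).pos = x.pos + y.pos := rfl
@[simp] theorem lamp_one (i : ℤ) : (1 : Lamplighter).lamp i = 0 := rfl
@[simp] theorem pos_one : (1 : Lamplighter).pos = 0 := rfl
@[simp] theorem lamp_inv (x : Lamplighter) (i : ℤ) : x⁻¹.lamp i = -x.lamp (i + x.pos) := rfl
@[simp] theorem pos_inv (x : Lamplighter) : x⁻¹.pos = -x.pos := rfl

instance : Group Lamplighter :=
  Group.ofLeftAxioms
    (fun x y z => by ext <;> simp [add_assoc, sub_sub])
    (fun x => by ext <;> simp)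
    (fun x => by ext <;> simp)

/-- Change the current lamp by `w`, then move by `k`. -/
def act (w k : ℤ) : Lamplighter := ⟨Pi.single 0 w, k⟩

@[simp] theorem lamp_act (w k i : ℤ) : (act w k).lamp i = if i = 0 then w else 0 := by
  simp [act, Pi.single_apply]
@[simp] theorem pos_act (w k : ℤ) : (act w k).pos = k := rfl

theorem act_pow_left (w : ℤ) (n : ℕ) : act w 0 ^ n = act (n * w) 0 := by
  induction n with
  | zero => ext <;> simp
  | succ n ih => rw [pow_succ, ih]; ext <;> simp; split_ifs <;> ring

theorem act_pow_right (k : ℤ) (n : ℕ) : act 0 k ^ n = act 0 (n * k) := by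
  induction n with
  | zero => ext <;> simp
  | succ n ih => rw [pow_succ, ih]; ext <;> simp; ring

theorem act_commute {w k w' k' : ℤ} (h : w = 0 ∨ k' = 0) (h' : w' = 0 ∨ k = 0) :
    Commute (act w k) (act w' k') := by
  rcases h with rfl | rfl <;> rcases h' with rfl | rfl <;> ext <;> simp [add_comm]

/-- Lamplighters that have moved by `0` or at least `J` and whose lamps are off at all nonzero
positions smaller than `J`. -/
def gap (J : ℤ) (hJ : 0 < J) : Submonoid Lamplighter where
  carrier := {x | (x.pos = 0 ∨ J ≤ x.pos) ∧ ∀ i, i ≠ 0 → i < J → x.lamp i = 0}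
  one_mem' := by simp
  mul_mem' := by
    rintro x y ⟨hx, hx'⟩ ⟨hy, hy'⟩
    refine ⟨by simp only [pos_mul]; omega, fun i h0 hi => ?_⟩
    rw [lamp_mul, hx' i h0 hi, hy' _ (by omega) (by omega), add_zero]

theorem mem_gap {J : ℤ} {hJ : 0 < J} {x : Lamplighter} : x ∈ gap J hJ ↔
    (x.pos = 0 ∨ J ≤ x.pos) ∧ ∀ i, i ≠ 0 → i < J → x.lamp i = 0 := Iff.rfl

end Lamplighter

namespace PathGroup

/-- Homomorphisms out of the graph group of `P4`. -/
noncomputable def lift {H : Type*} [Group H] (f : Fin 4 → H) (h₀ : Commute (f 0) (f 1))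
    (h₁ : Commute (f 1) (f 2)) (h₂ : Commute (f 2) (f 3)) : GraphGroup P4rel →* H :=
  PresentedGroup.toGroup (f := f) <| by
    rintro _ ⟨x, y, hxy, rfl⟩
    suffices h : Commute (f x) (f y) by
      simp only [map_mul, map_inv, FreeGroup.lift_apply_of]
      rw [h.eq, mul_inv_cancel_right, mul_inv_cancel]
    simp only [P4rel, Set.mem_insert_iff, Set.mem_singleton_iff, Prod.mk.injEq] at hxy
    rcases hxy with ⟨rfl, rfl⟩ | ⟨rfl, rfl⟩ | ⟨rfl, rfl⟩ | ⟨rfl, rfl⟩ | ⟨rfl, rfl⟩ | ⟨rfl, rfl⟩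
    exacts [h₀, h₀.symm, h₁, h₁.symm, h₂, h₂.symm]

/-- The generators. -/
noncomputable def gen (x : Fin 4) : GraphGroup P4rel := PresentedGroup.of x

@[simp] theorem lift_gen {H : Type*} [Group H] (f : Fin 4 → H) (h₀ : Commute (f 0) (f 1))
    (h₁ : Commute (f 1) (f 2)) (h₂ : Commute (f 2) (f 3)) (x : Fin 4) :
    lift f h₀ h₁ h₂ (gen x) = f x := PresentedGroup.toGroup.of _

theorem commute_gen {x y : Fin 4} (h : P4rel x y) : Commute (gen x) (gen y) := by
  have : gen x * gen y * (gen x)⁻¹ * (gen y)⁻¹ = 1 :=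
    PresentedGroup.one_of_mem ⟨x, y, h, rfl⟩
  rwa [mul_inv_eq_one, mul_inv_eq_iff_eq_mul] at this

theorem commute_gen_zero_one : Commute (gen 0) (gen 1) := commute_gen (by simp [P4rel])
theorem commute_gen_one_two : Commute (gen 1) (gen 2) := commute_gen (by simp [P4rel])
theorem commute_gen_two_three : Commute (gen 2) (gen 3) := commute_gen (by simp [P4rel])

/-- `b * c`. -/
noncomputable def pair : GraphGroup P4rel := gen 1 * gen 2

/-- `a ^ l * d ^ 2`. -/
noncomputable def mark (l : ℕ) : GraphGroup P4rel := gen 0 ^ l * gen 3 ^ 2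

/-- `a ^ l * b ^ m * c ^ p * a ^ (-l)`. -/
noncomputable def loop (l : ℕ) (ρ : AffineRule_s3) : GraphGroup P4rel :=
  gen 0 ^ l * (gen 1 ^ ρ.m * gen 2 ^ ρ.p) * (gen 0 ^ l)⁻¹

/-- `a ^ l * b ^ r * c ^ s * d ^ 2`. -/
noncomputable def exit (l : ℕ) (ρ : AffineRule_s3) : GraphGroup P4rel :=
  gen 0 ^ l * (gen 1 ^ ρ.r * gen 2 ^ ρ.s) * gen 3 ^ 2

/-- `d⁻¹ * a * d`. -/
noncomputable def shift : GraphGroup P4rel := (gen 3)⁻¹ * gen 0 * gen 3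

theorem pow_mul_loop_pow_mul_exit (l k : ℕ) (ρ : AffineRule_s3) :
    gen 2 ^ (ρ.m * k + ρ.r) * loop l ρ ^ k * exit l ρ =
      pair ^ (ρ.m * k + ρ.r) * mark l * gen 2 ^ (ρ.p * k + ρ.s) := by
  have h01 := commute_gen_zero_one
  have h12 := commute_gen_one_two
  have h23 := commute_gen_two_three
  have hpow : loop l ρ ^ k =
      gen 0 ^ l * (gen 1 ^ (ρ.m * k) * gen 2 ^ (ρ.p * k)) * (gen 0 ^ l)⁻¹ := by
    rw [loop, conj_pow, (h12.pow_pow _ _).mul_pow, ← pow_mul, ← pow_mul]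
  rw [hpow, exit, mark, pair, h12.mul_pow]
  generalize ρ.m * k = x
  generalize ρ.p * k = y
  calc _ = gen 2 ^ (x + ρ.r) * gen 0 ^ l * (gen 1 ^ x * (gen 2 ^ y * gen 1 ^ ρ.r)) *
        (gen 2 ^ ρ.s * gen 3 ^ 2) := by group
    _ = gen 2 ^ (x + ρ.r) * (gen 0 ^ l * gen 1 ^ (x + ρ.r)) *
        (gen 2 ^ (y + ρ.s) * gen 3 ^ 2) := by
      rw [((h12.pow_pow ρ.r y).eq).symm]; simp only [pow_add, mul_assoc]
    _ = gen 2 ^ (x + ρ.r) * gen 1 ^ (x + ρ.r) * gen 0 ^ l * (gen 3 ^ 2 * gen 2 ^ (y + ρ.s)) := by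
      rw [(h01.pow_pow _ _).eq, (h23.pow_pow _ _).eq]; simp only [mul_assoc]
    _ = _ := by
      rw [(h12.pow_pow _ _).eq]; simp only [mul_assoc]

end PathGroup

namespace PathGroup

open Lamplighter

/-- The `c`-letters, located by the preceding powers of `a`. -/
noncomputable def contentC : GraphGroup P4rel →* Lamplighter :=
  lift ![act 0 1, act 0 0, act 1 0, act 0 0] (act_commute (by simp) (by simp))
    (act_commute (by simp) (by simp)) (act_commute (by simp) (by simp))

/-- The `b`-letters, located by the preceding powers of `d`. -/
noncomputable def contentB : GraphGroup P4rel →* Lamplighter :=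
  lift ![act 0 0, act 1 0, act 0 0, act 0 1] (act_commute (by simp) (by simp))
    (act_commute (by simp) (by simp)) (act_commute (by simp) (by simp))

/-- The `a`-letters, located by the preceding powers of `d`. -/
noncomputable def contentA : GraphGroup P4rel →* Lamplighter :=
  lift ![act 1 0, act 0 0, act 0 0, act 0 1] (act_commute (by simp) (by simp))
    (act_commute (by simp) (by simp)) (act_commute (by simp) (by simp))

theorem contentC_gen (x : Fin 4) :
    contentC (gen x) = ![act 0 1, act 0 0, act 1 0, act 0 0] x := lift_gen _ _ _ _ _

theorem contentB_gen (x : Fin 4) :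
    contentB (gen x) = ![act 0 0, act 1 0, act 0 0, act 0 1] x := lift_gen _ _ _ _ _

theorem contentA_gen (x : Fin 4) :
    contentA (gen x) = ![act 1 0, act 0 0, act 0 0, act 0 1] x := lift_gen _ _ _ _ _

@[simp] theorem contentC_pair_pow (n : ℕ) : contentC (pair ^ n) = act n 0 := by
  have : contentC pair = act 1 0 := by ext <;> simp [pair, contentC_gen]
  rw [map_pow, this, act_pow_left, mul_one]

@[simp] theorem contentB_pair_pow (n : ℕ) : contentB (pair ^ n) = act n 0 := by
  have : contentB pair = act 1 0 := by ext <;> simp [pair, contentB_gen]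
  rw [map_pow, this, act_pow_left, mul_one]

@[simp] theorem contentA_pair_pow (n : ℕ) : contentA (pair ^ n) = act 0 0 := by
  have : contentA pair = act 0 0 := by ext <;> simp [pair, contentA_gen]
  rw [map_pow, this, act_pow_left, mul_zero]

@[simp] theorem contentC_gen_two_pow (n : ℕ) : contentC (gen 2 ^ n) = act n 0 := by
  simp [contentC_gen, act_pow_left]

@[simp] theorem contentB_gen_two_pow (n : ℕ) : contentB (gen 2 ^ n) = act 0 0 := by
  simp [contentB_gen, act_pow_left]

@[simp] theorem contentA_gen_two_pow (n : ℕ) : contentA (gen 2 ^ n) = act 0 0 := by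
  simp [contentA_gen, act_pow_left]

@[simp] theorem contentC_mark (l : ℕ) : contentC (mark l) = act 0 l := by
  ext <;> simp [mark, contentC_gen, act_pow_left, act_pow_right]

@[simp] theorem contentB_mark (l : ℕ) : contentB (mark l) = act 0 2 := by
  ext <;> simp [mark, contentB_gen, act_pow_left, act_pow_right]

@[simp] theorem contentA_mark (l : ℕ) : contentA (mark l) = act l 2 := by
  ext <;> simp [mark, contentA_gen, act_pow_left, act_pow_right]

@[simp] theorem contentC_loop (l : ℕ) (ρ : AffineRule_s3) :
    contentC (loop l ρ) = ⟨Pi.single l ρ.p, 0⟩ := by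
  ext <;> simp [loop, contentC_gen, act_pow_left, act_pow_right, Pi.single_apply, sub_eq_zero]

@[simp] theorem contentB_loop (l : ℕ) (ρ : AffineRule_s3) : contentB (loop l ρ) = act ρ.m 0 := by
  ext <;> simp [loop, contentB_gen, act_pow_left]

@[simp] theorem contentA_loop (l : ℕ) (ρ : AffineRule_s3) : contentA (loop l ρ) = act 0 0 := by
  ext <;> simp [loop, contentA_gen, act_pow_left]

@[simp] theorem contentC_exit (l : ℕ) (ρ : AffineRule_s3) :
    contentC (exit l ρ) = ⟨Pi.single l ρ.s, l⟩ := by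
  ext <;> simp [exit, contentC_gen, act_pow_left, act_pow_right, Pi.single_apply, sub_eq_zero]

@[simp] theorem contentB_exit (l : ℕ) (ρ : AffineRule_s3) : contentB (exit l ρ) = act ρ.r 2 := by
  ext <;> simp [exit, contentB_gen, act_pow_left, act_pow_right]

@[simp] theorem contentA_exit (l : ℕ) (ρ : AffineRule_s3) : contentA (exit l ρ) = act l 2 := by
  ext <;> simp [exit, contentA_gen, act_pow_left, act_pow_right]

variable {ι : Type*} {R : ι → AffineRule_s3} {l : ι → ℕ}

/-- The submonoid generated by `pair` and all `mark (l i)`. -/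
noncomputable def leftMonoid (l : ι → ℕ) : Submonoid (GraphGroup P4rel) :=
  .closure (insert pair (Set.range fun i => mark (l i)))

/-- The submonoid generated by all `loop (l i) (R i)` and `exit (l i) (R i)`. -/
noncomputable def rightMonoid (R : ι → AffineRule_s3) (l : ι → ℕ) : Submonoid (GraphGroup P4rel) :=
  .closure (Set.range (fun i => loop (l i) (R i)) ∪ Set.range fun i => exit (l i) (R i))

theorem exists_of_mem_leftMonoid {x : GraphGroup P4rel} (hx : x ∈ leftMonoid l) :
    ∃ t : ℕ, x = pair ^ t ∨ ∃ i, ∃ x' ∈ leftMonoid l, x = pair ^ t * mark (l i) * x' := by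
  induction hx using Submonoid.closure_induction_left with
  | one => exact ⟨0, .inl (pow_zero _).symm⟩
  | mul_left g hg x hx ih =>
    rcases hg with rfl | ⟨i, rfl⟩
    · obtain ⟨t, rfl | ⟨i, x', hx', rfl⟩⟩ := ih
      · exact ⟨t + 1, .inl (pow_succ' _ _).symm⟩
      · exact ⟨t + 1, .inr ⟨i, x', hx', by simp only [pow_succ', mul_assoc]⟩⟩
    · exact ⟨0, .inr ⟨i, x, hx, by rw [pow_zero, one_mul]⟩⟩

theorem exists_of_mem_rightMonoid {x : GraphGroup P4rel} (hx : x ∈ rightMonoid R l) :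
    ∃ K : List ι, x = (K.map fun i => loop (l i) (R i)).prod ∨ ∃ i, ∃ x' ∈ rightMonoid R l,
      x = (K.map fun i => loop (l i) (R i)).prod * exit (l i) (R i) * x' := by
  induction hx using Submonoid.closure_induction_left with
  | one => exact ⟨[], .inl rfl⟩
  | mul_left g hg x hx ih =>
    rcases hg with ⟨j, rfl⟩ | ⟨i, rfl⟩
    · obtain ⟨K, rfl | ⟨i, x', hx', rfl⟩⟩ := ih
      · exact ⟨j :: K, .inl (by simp)⟩
      · exact ⟨j :: K, .inr ⟨i, x', hx', by simp [mul_assoc]⟩⟩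
    · exact ⟨[], .inr ⟨i, x, hx, by simp⟩⟩

theorem contentC_leftMonoid_mem_gap {J : ℤ} (hJ : 0 < J) (hl : ∀ i, J ≤ l i)
    {x : GraphGroup P4rel} (hx : x ∈ leftMonoid l) : contentC x ∈ gap J hJ := by
  suffices leftMonoid l ≤ (gap J hJ).comap contentC from this hx
  refine Submonoid.closure_le.2 (Set.insert_subset ?_ ?_)
  · have := contentC_pair_pow 1
    rw [pow_one] at this
    simp +contextual [mem_gap, this]
  · rintro _ ⟨i, rfl⟩
    simp [mem_gap, hl i]

theorem contentA_leftMonoid_mem_gap {x : GraphGroup P4rel} (hx : x ∈ leftMonoid l) :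
    contentA x ∈ gap 1 one_pos := by
  suffices leftMonoid l ≤ (gap 1 one_pos).comap contentA from this hx
  refine Submonoid.closure_le.2 (Set.insert_subset ?_ ?_)
  · have := contentA_pair_pow 1
    rw [pow_one] at this
    simp [mem_gap, this]
  · rintro _ ⟨i, rfl⟩
    simp +contextual [mem_gap]

theorem contentB_leftMonoid_mem_gap {x : GraphGroup P4rel} (hx : x ∈ leftMonoid l) :
    contentB x ∈ gap 1 one_pos := by
  suffices leftMonoid l ≤ (gap 1 one_pos).comap contentB from this hx
  refine Submonoid.closure_le.2 (Set.insert_subset ?_ ?_)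
  · have := contentB_pair_pow 1
    rw [pow_one] at this
    simp +contextual [mem_gap, this]
  · rintro _ ⟨i, rfl⟩
    simp [mem_gap]

theorem contentC_rightMonoid_mem_gap {J : ℤ} (hJ : 0 < J) (hl : ∀ i, J ≤ l i)
    {x : GraphGroup P4rel} (hx : x ∈ rightMonoid R l) : contentC x ∈ gap J hJ := by
  suffices rightMonoid R l ≤ (gap J hJ).comap contentC from this hx
  refine Submonoid.closure_le.2 (Set.union_subset ?_ ?_) <;> rintro _ ⟨i, rfl⟩
  · refine ⟨.inl (by simp), fun k _ hk => ?_⟩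
    simp only [contentC_loop]
    rw [Pi.single_eq_of_ne (hk.trans_le (hl i)).ne]
  · refine ⟨.inr (by simpa using hl i), fun k _ hk => ?_⟩
    simp only [contentC_exit]
    rw [Pi.single_eq_of_ne (hk.trans_le (hl i)).ne]

theorem contentA_rightMonoid_mem_gap {x : GraphGroup P4rel} (hx : x ∈ rightMonoid R l) :
    contentA x ∈ gap 1 one_pos := by
  suffices rightMonoid R l ≤ (gap 1 one_pos).comap contentA from this hx
  refine Submonoid.closure_le.2 (Set.union_subset ?_ ?_) <;> rintro _ ⟨i, rfl⟩ <;>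
    simp +contextual [mem_gap]

theorem contentB_rightMonoid_mem_gap {x : GraphGroup P4rel} (hx : x ∈ rightMonoid R l) :
    contentB x ∈ gap 1 one_pos := by
  suffices rightMonoid R l ≤ (gap 1 one_pos).comap contentB from this hx
  refine Submonoid.closure_le.2 (Set.union_subset ?_ ?_) <;> rintro _ ⟨i, rfl⟩ <;>
    simp +contextual [mem_gap]

theorem contentC_loops (K : List ι) :
    (contentC (K.map fun i => loop (l i) (R i)).prod).pos = 0 ∧
    ∀ k, (contentC (K.map fun i => loop (l i) (R i)).prod).lamp k =
      (K.map fun i => if k = l i then (R i).p else 0).sum := by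
  induction K with
  | nil => simp
  | cons j K ih => simp [ih.1, ih.2, Pi.single_apply, apply_ite Nat.cast]

theorem contentB_loops (K : List ι) :
    contentB (K.map fun i => loop (l i) (R i)).prod = act (K.map fun i => (R i).m).sum 0 := by
  induction K with
  | nil => ext <;> simp
  | cons j K ih =>
    ext <;> simp [ih]
    split_ifs <;> rfl

theorem contentA_loops (K : List ι) :
    contentA (K.map fun i => loop (l i) (R i)).prod = act 0 0 := by
  induction K with
  | nil => ext <;> simp
  | cons j K ih => ext <;> simp [ih]

theorem ne_of_contentC_loops_eq_zero (hp : ∀ i, 0 < (R i).p) {K : List ι} {k : ℤ}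
    (h : (contentC (K.map fun i => loop (l i) (R i)).prod).lamp k = 0) : ∀ i ∈ K, k ≠ l i := by
  rintro i hi rfl
  rw [(contentC_loops K).2, Nat.cast_eq_zero, List.sum_eq_zero_iff] at h
  have := h _ (List.mem_map.2 ⟨i, hi, rfl⟩)
  rw [if_pos rfl] at this
  exact (hp i).ne' this

theorem reflTransGen_of_mem_leftMonoid (hp : ∀ i, 0 < (R i).p) (hl : Function.Injective l)
    {J : ℕ} (hJ : 0 < J) (hJl : ∀ i, J ≤ l i ∧ l i < 2 * J) (N : ℕ) {x : GraphGroup P4rel}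
    (hx : x ∈ rightMonoid R l) (hN : (contentA x).pos = N) {n : ℕ}
    (h : gen 2 ^ n * x ∈ leftMonoid l) :
    Relation.ReflTransGen (fun n n' => ∃ i, (R i).Step n n') n 0 := by
  induction N using Nat.strong_induction_on generalizing x n with
  | _ N ih =>
  have hJ' : (0 : ℤ) < J := by exact_mod_cast hJ
  have hlJ : ∀ i, (J : ℤ) ≤ l i := fun i => by exact_mod_cast (hJl i).1
  have hlJ' : ∀ i, (l i : ℤ) < 2 * J := fun i => by exact_mod_cast (hJl i).2
  obtain ⟨t, ht⟩ := exists_of_mem_leftMonoid h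
  obtain ⟨K, rfl | ⟨i, x, hx', rfl⟩⟩ := exists_of_mem_rightMonoid hx
  · rcases ht with ht | ⟨j, y, hy, ht⟩
    · have hC := fun k => congrArg (fun g => (contentC g).lamp k) ht
      simp only [map_mul, contentC_gen_two_pow, lamp_mul, lamp_act, pos_act, sub_zero,
        contentC_pair_pow] at hC
      have hK : K = [] := List.eq_nil_iff_forall_not_mem.2 fun i hi => by
        have := hlJ i
        have hi' := hC (l i)
        rw [if_neg (by omega), if_neg (by omega), zero_add] at hi'
        exact ne_of_contentC_loops_eq_zero hp hi' i hi rfl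
      subst hK
      have hB := congrArg (fun g => (contentB g).lamp 0) ht
      have hC0 := hC 0
      simp at hB hC0
      rw [show n = 0 by omega]
    · have hA := congrArg (fun g => (contentA g).pos) ht
      have := (contentA_leftMonoid_mem_gap hy).1
      simp [contentA_loops] at hA
      omega
  · rcases ht with ht | ⟨j, y, hy, ht⟩
    · have hA := congrArg (fun g => (contentA g).pos) ht
      have := (contentA_rightMonoid_mem_gap hx').1
      simp [contentA_loops] at hA
      omega
    have hij : i = j := by
      have hA := congrArg (fun g => (contentA g).lamp 0) ht
      simp [contentA_loops, (contentA_rightMonoid_mem_gap hx').2 (-2),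
        (contentA_leftMonoid_mem_gap hy).2 (-2)] at hA
      exact hl hA
    subst hij
    have hC : ∀ k, _ := fun k => congrArg (fun g => (contentC g).lamp k) ht
    have hKp := (contentC_loops (R := R) (l := l) K).1
    simp only [map_mul, contentC_gen_two_pow, lamp_mul, pos_mul, lamp_act, pos_act, sub_zero,
      contentC_pair_pow, contentC_mark, contentC_exit, hKp, add_zero, zero_add, ite_self] at hC
    have hgx : ∀ k : ℤ, k ≠ l i → k - l i < J → (contentC x).lamp (k - l i) = 0 := fun k hk hk' =>
      (contentC_rightMonoid_mem_gap hJ' hlJ hx').2 _ (by omega) hk'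
    have hgy : ∀ k : ℤ, k ≠ l i → k - l i < J → (contentC y).lamp (k - l i) = 0 := fun k hk hk' =>
      (contentC_leftMonoid_mem_gap hJ' hlJ hy).2 _ (by omega) hk'
    have hK : ∀ j ∈ K, j = i := fun j hj => by
      by_contra hji
      have hlj : (l j : ℤ) ≠ l i := by exact_mod_cast fun e => hji (hl e)
      have h1 := hlJ i
      have h2 := hlJ' j
      have h3 := hlJ j
      have := hC (l j)
      rw [hgx _ hlj (by omega), hgy _ hlj (by omega), if_neg (by omega), if_neg (by omega),
        Pi.single_eq_of_ne hlj] at this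
      exact ne_of_contentC_loops_eq_zero hp (by simpa using this) j hj rfl
    have hB := congrArg (fun g => (contentB g).lamp 0) ht
    simp [contentB_loops, (contentB_rightMonoid_mem_gap hx').2 (-2),
      (contentB_leftMonoid_mem_gap hy).2 (-2)] at hB
    simp [contentA_loops] at hN
    obtain ⟨q, rfl⟩ : ∃ q, K = List.replicate q i := ⟨_, List.eq_replicate_of_mem hK⟩
    have hnt : n = t := by
      have h1 := hlJ i
      have := hC 0
      rw [hgx _ (by omega) (by omega), hgy _ (by omega) (by omega), if_pos rfl, if_pos rfl,
        Pi.single_eq_of_ne (by omega), (contentC_loops _).2, List.map_replicate,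
        if_neg (by omega)] at this
      simpa using this
    subst hnt
    have hn : n = (R i).m * q + (R i).r := by
      simp only [List.map_replicate, List.sum_replicate, Function.comp_apply, nsmul_eq_mul] at hB
      rw [mul_comm]
      exact_mod_cast hB.symm
    have key := pow_mul_loop_pow_mul_exit (l i) q (R i)
    rw [← hn] at key
    rw [List.map_replicate, List.prod_replicate, ← mul_assoc, ← mul_assoc, key, mul_assoc,
      mul_left_cancel_iff] at ht
    refine .head ⟨i, q, hn, rfl⟩ (ih ((contentA x).pos.toNat) ?_ hx' ?_ (ht ▸ hy))
    · have := (contentA_rightMonoid_mem_gap hx').1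
      omega
    · have := (contentA_rightMonoid_mem_gap hx').1
      omega

end PathGroup

namespace Delayed

/-- If `T` moves, elements of `A` increase and elements of `B` decrease the current counter, then
a product of elements of `A`, `T` and conjugates `T⁻¹ * v⁻¹ * T` with `v ∈ B` that has moved once
and has no effect on the counters `0` and `2` contains `T` as its only move, elements of `A` only to
its left and conjugates only to its right. -/
theorem exists_of_mem_closure {G : Type*} [Group G]
    (φ : G →* Equiv.Perm ((ℤ → ℤ) × ℤ × Bool)) {T : G} {A B : Set G}
    (hT : ∀ f k, φ T (f, k, false) = (f, k + 1, false))
    (hA : ∀ v ∈ A, ∃ q > 0, ∀ f k, φ v (f, k, false) = (f + Pi.single k q, k, false))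
    (hB : ∀ v ∈ B, ∃ q > 0, ∀ f k, φ v (f, k, false) = (f + Pi.single k q, k, false))
    {x : G} (hx : x ∈ Submonoid.closure (insert T (A ∪ (fun v => T⁻¹ * v⁻¹ * T) '' B))) :
    ∃ f k, φ x (0, 0, false) = (f, k, false) ∧ 0 ≤ k ∧
      (k = 0 → 0 ≤ f 0 ∧ f 2 = 0 ∧
        (f 0 = 0 → ∃ κ ∈ Submonoid.closure B, x = T⁻¹ * κ⁻¹ * T)) ∧
      (k = 1 → 0 ≤ f 0 ∧ f 2 ≤ 0 ∧ (f 0 = 0 → f 2 = 0 →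
        ∃ u ∈ Submonoid.closure A, ∃ κ ∈ Submonoid.closure B, x = u * κ⁻¹ * T)) := by
  induction hx using Submonoid.closure_induction_left with
  | one => exact ⟨0, 0, by simp, le_rfl, fun _ => ⟨le_rfl, rfl, fun _ => ⟨1, one_mem _, by simp⟩⟩,
      by simp⟩
  | mul_left g hg x _ ih =>
    obtain ⟨f, k, hφ, hk, h0, h1⟩ := ih
    simp only [map_mul, Equiv.Perm.mul_apply, hφ]
    rcases hg with rfl | hg | ⟨v, hv, rfl⟩
    · refine ⟨f, k + 1, hT f k, by omega, by omega, fun hk1 => ?_⟩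
      obtain ⟨h, h', h''⟩ := h0 (by omega)
      refine ⟨h, h'.le, fun hf _ => ?_⟩
      obtain ⟨κ, hκ, rfl⟩ := h'' hf
      exact ⟨1, one_mem _, κ, hκ, by group⟩
    · obtain ⟨q, hq, hg'⟩ := hA g hg
      refine ⟨_, _, hg' f k, hk, ?_, ?_⟩ <;> rintro rfl
      · obtain ⟨h, h', -⟩ := h0 rfl
        simp only [Pi.add_apply, Pi.single_apply]
        norm_num
        exact ⟨by omega, h', by omega⟩
      · obtain ⟨h, h', h''⟩ := h1 rfl
        simp only [Pi.add_apply, Pi.single_apply]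
        norm_num
        refine ⟨h, h', fun hf hf' => ?_⟩
        obtain ⟨u, hu, κ, hκ, rfl⟩ := h'' hf hf'
        exact ⟨g * u, mul_mem (Submonoid.subset_closure hg) hu, κ, hκ, by simp only [mul_assoc]⟩
    · obtain ⟨q, hq, hv'⟩ := hB v hv
      have : φ (T⁻¹ * v⁻¹ * T) (f, k, false) = (f - Pi.single (k + 1) q, k, false) := by
        simp only [map_mul, map_inv, Equiv.Perm.mul_apply, hT, Equiv.Perm.inv_eq_iff_eq, hv',
          sub_add_cancel]
      refine ⟨_, _, by simpa only [map_mul, Equiv.Perm.mul_apply] using this, hk, ?_, ?_⟩ <;> rintro rfl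
      · obtain ⟨h, h', h''⟩ := h0 rfl
        simp only [Pi.sub_apply, Pi.single_apply]
        norm_num
        refine ⟨h, h', fun hf => ?_⟩
        obtain ⟨κ, hκ, rfl⟩ := h'' hf
        exact ⟨κ * v, mul_mem hκ (Submonoid.subset_closure hv), by group⟩
      · obtain ⟨h, h', h''⟩ := h1 rfl
        simp only [Pi.sub_apply, Pi.single_apply]
        norm_num
        exact ⟨h, by omega, by omega⟩

end Delayed

namespace PathGroup

/-- Action of the generators of the graph group of `P4` on counters `ℤ → ℤ` with a current position
and a switch `d`: `c` increases the current counter, `a` moves if the switch is on, and `d ^ 2` has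
the effect of `c`. -/
def counterPerm : Fin 4 → Equiv.Perm ((ℤ → ℤ) × ℤ × Bool) :=
  ![{ toFun := fun z => (z.1, if z.2.2 then z.2.1 + 1 else z.2.1, z.2.2)
      invFun := fun z => (z.1, if z.2.2 then z.2.1 - 1 else z.2.1, z.2.2)
      left_inv := by rintro ⟨f, k, _ | _⟩ <;> simp
      right_inv := by rintro ⟨f, k, _ | _⟩ <;> simp },
    1,
    { toFun := fun z => (z.1 + Pi.single z.2.1 1, z.2)
      invFun := fun z => (z.1 - Pi.single z.2.1 1, z.2)
      left_inv := by rintro ⟨f, k, _ | _⟩ <;> simp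
      right_inv := by rintro ⟨f, k, _ | _⟩ <;> simp },
    { toFun := fun z => (if z.2.2 then z.1 + Pi.single z.2.1 1 else z.1, z.2.1, !z.2.2)
      invFun := fun z => (if z.2.2 then z.1 else z.1 - Pi.single z.2.1 1, z.2.1, !z.2.2)
      left_inv := by rintro ⟨f, k, _ | _⟩ <;> simp
      right_inv := by rintro ⟨f, k, _ | _⟩ <;> simp }]

/-- The action of the graph group of `P4` given by `counterPerm`. -/
noncomputable def counterAction : GraphGroup P4rel →* Equiv.Perm ((ℤ → ℤ) × ℤ × Bool) :=
  lift counterPerm (Commute.one_right _) (Commute.one_left _)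
    (Equiv.ext <| by rintro ⟨f, k, _ | _⟩ <;> simp [counterPerm])

theorem counterAction_gen (x : Fin 4) : counterAction (gen x) = counterPerm x :=
  lift_gen _ _ _ _ _

theorem counterAction_gen_zero_true (f : ℤ → ℤ) (k : ℤ) :
    counterAction (gen 0) (f, k, true) = (f, k + 1, true) := by simp [counterAction_gen, counterPerm]

theorem counterAction_gen_zero_pow (f : ℤ → ℤ) (k : ℤ) (n : ℕ) :
    counterAction (gen 0 ^ n) (f, k, false) = (f, k, false) := by
  induction n with
  | zero => simp
  | succ n ih => rw [pow_succ', map_mul, Equiv.Perm.mul_apply, ih]; simp [counterAction_gen, counterPerm]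

theorem counterAction_gen_one : counterAction (gen 1) = 1 := by simp [counterAction_gen, counterPerm]

theorem counterAction_gen_two_pow (f : ℤ → ℤ) (k : ℤ) (n : ℕ) :
    counterAction (gen 2 ^ n) (f, k, false) = (f + Pi.single k (n : ℤ), k, false) := by
  induction n with
  | zero => simp
  | succ n ih =>
    rw [pow_succ', map_mul, Equiv.Perm.mul_apply, ih]
    simp [counterAction_gen, counterPerm, add_assoc, Pi.single_add]

theorem counterAction_gen_three_false (f : ℤ → ℤ) (k : ℤ) :
    counterAction (gen 3) (f, k, false) = (f, k, true) := by simp [counterAction_gen, counterPerm]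

theorem counterAction_gen_three_sq (f : ℤ → ℤ) (k : ℤ) :
    counterAction (gen 3 ^ 2) (f, k, false) = (f + Pi.single k 1, k, false) := by
  simp [counterAction_gen, counterPerm, pow_two]

theorem counterAction_shift (f : ℤ → ℤ) (k : ℤ) :
    counterAction shift (f, k, false) = (f, k + 1, false) := by
  simp only [shift, map_mul, map_inv, Equiv.Perm.mul_apply, counterAction_gen_three_false,
    counterAction_gen_zero_true, Equiv.Perm.inv_eq_iff_eq]

theorem counterAction_pair (f : ℤ → ℤ) (k : ℤ) :
    counterAction pair (f, k, false) = (f + Pi.single k 1, k, false) := by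
  have := counterAction_gen_two_pow f k 1
  rw [pow_one] at this
  simp [pair, this, counterAction_gen_one]

theorem counterAction_mark (n : ℕ) (f : ℤ → ℤ) (k : ℤ) :
    counterAction (mark n) (f, k, false) = (f + Pi.single k 1, k, false) := by
  rw [mark, map_mul, Equiv.Perm.mul_apply, counterAction_gen_three_sq, counterAction_gen_zero_pow]

theorem counterAction_loop (n : ℕ) (ρ : AffineRule_s3) (f : ℤ → ℤ) (k : ℤ) :
    counterAction (loop n ρ) (f, k, false) = (f + Pi.single k (ρ.p : ℤ), k, false) := by
  have : (counterAction (gen 0 ^ n))⁻¹ (f, k, false) = (f, k, false) := by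
    rw [Equiv.Perm.inv_eq_iff_eq, counterAction_gen_zero_pow]
  rw [loop, map_mul, map_mul, map_mul, map_inv, Equiv.Perm.mul_apply, Equiv.Perm.mul_apply,
    Equiv.Perm.mul_apply, this, counterAction_gen_two_pow, map_pow _ (gen 1), counterAction_gen_one, one_pow,
    Equiv.Perm.one_apply, counterAction_gen_zero_pow]

theorem counterAction_exit (n : ℕ) (ρ : AffineRule_s3) (f : ℤ → ℤ) (k : ℤ) :
    counterAction (exit n ρ) (f, k, false) = (f + Pi.single k (ρ.s + 1 : ℤ), k, false) := by
  rw [exit, map_mul, map_mul, map_mul, Equiv.Perm.mul_apply, Equiv.Perm.mul_apply,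
    Equiv.Perm.mul_apply, counterAction_gen_three_sq, counterAction_gen_two_pow, map_pow _ (gen 1),
    counterAction_gen_one, one_pow, Equiv.Perm.one_apply, counterAction_gen_zero_pow, add_assoc,
    ← Pi.single_add, add_comm (1 : ℤ)]

variable {ι : Type*} {R : ι → AffineRule_s3} {l : ι → ℕ}

/-- Generators of a submonoid of the graph group of `P4` simulating the rules `R`. -/
def generators (R : ι → AffineRule_s3) (l : ι → ℕ) : Set (GraphGroup P4rel) :=
  insert shift (insert pair (Set.range fun i => mark (l i)) ∪ (fun v => shift⁻¹ * v⁻¹ * shift) ''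
    (Set.range (fun i => loop (l i) (R i)) ∪ Set.range fun i => exit (l i) (R i)))

theorem finite_generators [Finite ι] : (generators R l).Finite :=
  ((((Set.finite_range _).insert _).union
    (((Set.finite_range _).union (Set.finite_range _)).image _))).insert _

theorem exists_mul_mem_leftMonoid {n : ℕ}
    (h : Relation.ReflTransGen (fun n n' => ∃ i, (R i).Step n n') n 0) :
    ∃ κ ∈ rightMonoid R l, gen 2 ^ n * κ ∈ leftMonoid l := by
  induction h using Relation.ReflTransGen.head_induction_on with
  | refl => exact ⟨1, one_mem _, by simp⟩
  | head h _ ih =>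
    obtain ⟨i, k, rfl, rfl⟩ := h
    obtain ⟨κ, hκ, h⟩ := ih
    refine ⟨loop (l i) (R i) ^ k * exit (l i) (R i) * κ, mul_mem (mul_mem (pow_mem ?_ _) ?_) hκ, ?_⟩
    · exact Submonoid.subset_closure (.inl ⟨i, rfl⟩)
    · exact Submonoid.subset_closure (.inr ⟨i, rfl⟩)
    · rw [← mul_assoc, ← mul_assoc, pow_mul_loop_pow_mul_exit, mul_assoc]
      refine mul_mem (mul_mem (pow_mem ?_ _) ?_) h
      · exact Submonoid.subset_closure (.inl rfl)
      · exact Submonoid.subset_closure (.inr ⟨i, rfl⟩)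

theorem gen_pow_mul_shift_mem_iff (hp : ∀ i, 0 < (R i).p) (hl : Function.Injective l)
    {J : ℕ} (hJ : 0 < J) (hJl : ∀ i, J ≤ l i ∧ l i < 2 * J) (n : ℕ) :
    gen 2 ^ n * shift ∈ Submonoid.closure (generators R l) ↔
      Relation.ReflTransGen (fun n n' => ∃ i, (R i).Step n n') n 0 := by
  constructor
  · intro h
    obtain ⟨f, k, hφ, -, -, h1⟩ := Delayed.exists_of_mem_closure counterAction counterAction_shift
      (by
        rintro _ (rfl | ⟨i, rfl⟩)
        exacts [⟨1, one_pos, counterAction_pair⟩, ⟨1, one_pos, counterAction_mark _⟩])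
      (by
        rintro _ (⟨i, rfl⟩ | ⟨i, rfl⟩)
        exacts [⟨(R i).p, by exact_mod_cast hp i, counterAction_loop _ _⟩,
          ⟨(R i).s + 1, by positivity, counterAction_exit _ _⟩]) h
    rw [map_mul, Equiv.Perm.mul_apply, counterAction_shift, counterAction_gen_two_pow] at hφ
    simp only [zero_add, Prod.mk.injEq, and_true] at hφ
    obtain ⟨rfl, rfl⟩ := hφ
    obtain ⟨u, hu, κ, hκ, h⟩ := (h1 rfl).2.2 (by simp) (by simp)
    rw [mul_left_inj, eq_mul_inv_iff_mul_eq] at h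
    have hN := (contentA_rightMonoid_mem_gap hκ).1
    exact reflTransGen_of_mem_leftMonoid hp hl hJ hJl (contentA κ).pos.toNat hκ
      (by omega) (h ▸ hu)
  · intro h
    obtain ⟨κ, hκ, h⟩ := exists_mul_mem_leftMonoid (R := R) (l := l) h
    have hl' : leftMonoid l ≤ Submonoid.closure (generators R l) :=
      Submonoid.closure_mono ((Set.subset_union_left).trans (Set.subset_insert _ _))
    have hr : shift⁻¹ * κ⁻¹ * shift ∈ Submonoid.closure (generators R l) := by
      clear h
      induction hκ using Submonoid.closure_induction_right with
      | one => simp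
      | mul_right x _ v hv ih =>
        have : shift⁻¹ * (x * v)⁻¹ * shift = shift⁻¹ * v⁻¹ * shift * (shift⁻¹ * x⁻¹ * shift) := by
          group
        rw [this]
        exact mul_mem (Submonoid.subset_closure (.inr (.inr ⟨v, hv, rfl⟩))) ih
    have : gen 2 ^ n * shift = gen 2 ^ n * κ * shift * (shift⁻¹ * κ⁻¹ * shift) := by group
    rw [this]
    exact mul_mem (mul_mem (hl' h) (Submonoid.subset_closure (.inl rfl))) hr

end PathGroup

theorem graphEval_surjective {S : Type} (I : S → S → Prop) : Function.Surjective (graphEval I) := by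
  intro g
  obtain ⟨x, rfl⟩ := PresentedGroup.mk_surjective _ g
  induction x using FreeGroup.induction_on with
  | C1 => exact ⟨1, by simp⟩
  | of a => exact ⟨FreeMonoid.of (.inl a), by simp [graphEval, PresentedGroup.of]⟩
  | inv_of a _ => exact ⟨FreeMonoid.of (.inr a), by simp [graphEval, PresentedGroup.of]⟩
  | mul x y hx hy =>
    obtain ⟨u, hu⟩ := hx
    obtain ⟨v, hv⟩ := hy
    exact ⟨u * v, by rw [map_mul, map_mul, hu, hv]⟩

namespace PathGroup

/-- A word evaluating to `gen 2 ^ n * shift`. -/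
def counterWord (n : ℕ) : List (Fin 4 ⊕ Fin 4) :=
  (List.range n).map (fun _ => .inl 2) ++ [.inr 3, .inl 0, .inl 3]

theorem graphEval_counterWord (n : ℕ) :
    graphEval P4rel (FreeMonoid.ofList (counterWord n)) = gen 2 ^ n * shift := by
  simp [counterWord, graphEval, FreeMonoid.lift_apply, shift, gen, mul_assoc]

theorem primrec_counterWord : Primrec counterWord :=
  Primrec.list_append.comp
    (Primrec.list_map Primrec.list_range (Primrec.const (.inl 2 : Fin 4 ⊕ Fin 4)).to₂)
    (Primrec.const _)

end PathGroup

open Nat.Partrec in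
theorem exists_primrec_search_not_computable :
    ∃ f : ℕ → ℕ → ℕ, Primrec₂ f ∧ ¬ ComputablePred fun n => ∃ k, f n k ≠ 0 := by
  refine ⟨fun n k => bif (Code.evaln k (Denumerable.ofNat Code n) 0).isSome then 1 else 0, ?_, ?_⟩
  · exact Primrec.cond
      (Primrec.option_isSome.comp (Code.primrec_evaln.comp
        ((Primrec.snd.pair ((Primrec.ofNat Code).comp Primrec.fst)).pair (Primrec.const 0))))
      (Primrec.const 1) (Primrec.const 0)
  · intro h
    refine ComputablePred.halting_problem 0 (ComputablePred.computable_of_manyOneReducible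
      ⟨Encodable.encode, Computable.encode, fun c => ?_⟩ h)
    simp only [Denumerable.ofNat_encode, Part.dom_iff_mem, Code.evaln_complete]
    rw [exists_comm]
    refine exists_congr fun k => ?_
    cases h : Code.evaln k c 0 <;> simp

theorem primrec_two_pow : Primrec fun n : ℕ => 2 ^ n :=
  (Primrec.nat_rec₁ 1 (Primrec.nat_mul.comp Primrec.snd (Primrec.const 2)).to₂).of_eq fun n => by
    induction n with
    | zero => rfl
    | succ n ih => simp only [pow_succ, ← ih]

/-- There is a fixed finitely generated submonoid of the graph group of `P4`
whose membership problem is undecidable. -/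
theorem exists_submonoid_membership_noncomputable_P4 :
    ∃ W : Set (List (Fin 4 ⊕ Fin 4)), W.Finite ∧
      ¬ ComputablePred (fun w : List (Fin 4 ⊕ Fin 4) =>
        graphEval P4rel (FreeMonoid.ofList w) ∈
          Submonoid.closure
            ((fun v : List (Fin 4 ⊕ Fin 4) => graphEval P4rel (FreeMonoid.ofList v)) '' W)) := by
  obtain ⟨f, hf, hf'⟩ := exists_primrec_search_not_computable
  obtain ⟨P, hP⟩ := Prog.exists_run_iff hf
  obtain ⟨R, hR, hp, Q, q, hQ⟩ := P.exists_affineRules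
  have := hR.fintype
  let l : R → ℕ := fun ρ => Fintype.card R + 1 + Fintype.equivFin R ρ
  have hl : Function.Injective l := fun x y h =>
    (Fintype.equivFin R).injective (Fin.ext (Nat.add_left_cancel h))
  have hJl : ∀ ρ, Fintype.card R + 1 ≤ l ρ ∧ l ρ < 2 * (Fintype.card R + 1) := fun ρ => by
    have := (Fintype.equivFin R ρ).isLt
    simp only [l]
    omega
  have hev : Function.Surjective fun v : List (Fin 4 ⊕ Fin 4) =>
      graphEval P4rel (FreeMonoid.ofList v) :=
    (graphEval_surjective P4rel).comp FreeMonoid.ofList.surjective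
  refine ⟨Function.surjInv hev '' PathGroup.generators (fun ρ : R => ρ.1) l,
    PathGroup.finite_generators.image _, fun h => hf' ?_⟩
  rw [Set.image_image] at h
  simp only [Function.surjInv_eq hev, Set.image_id'] at h
  refine ComputablePred.computable_of_manyOneReducible
    ⟨fun n => PathGroup.counterWord (Q * 2 ^ n + q), ?_, fun n => ?_⟩ h
  · exact (PathGroup.primrec_counterWord.comp (Primrec.nat_add.comp
      (Primrec.nat_mul.comp (Primrec.const Q) primrec_two_pow) (Primrec.const q))).to_comp
  · beta_reduce
    rw [PathGroup.graphEval_counterWord,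
      PathGroup.gen_pow_mul_shift_mem_iff (R := fun ρ : R => ρ.1) (fun ρ => hp ρ.1 ρ.2) hl
        (Nat.succ_pos _) hJl, ← hP, hQ]
    simp only [Subtype.exists, exists_prop]
end

section
/- Let C be the smallest class of groups, closed under group isomorphism, such that: the trivial group belongs to C; if G₁ and G₂ belong to C then their free product Monoid.Coprod G₁ G₂ belongs to C; and if G belongs to C then G × ℤ belongs to C. Then a group belongs to C if and only if it is isomorphic to a graph group G(Σ,I) for some finite independence alphabet (Σ,I) that is a transitive forest. -/
/-- The smallest class of groups, closed under group isomorphism, containing the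
trivial group and closed under free products and direct products with `ℤ`. -/
inductive InClassC : (G : Type) → [inst : Group G] → Prop where
  | triv : InClassC PUnit
  | iso {G H : Type} [Group G] [Group H] (e : G ≃* H) : InClassC G → InClassC H
  | coprod {G₁ G₂ : Type} [Group G₁] [Group G₂] :
      InClassC G₁ → InClassC G₂ → InClassC (Monoid.Coprod G₁ G₂)
  | prodZ {G : Type} [Group G] : InClassC G → InClassC (G × Multiplicative ℤ)

namespace GraphGroup

variable {S T G : Type} {I : S → S → Prop} {J : T → T → Prop} [Group G]

/-- The generator of the graph group attached to a letter. -/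
def of (I : S → S → Prop) (a : S) : GraphGroup I :=
  PresentedGroup.of a

theorem commute_of {a b : S} (h : I a b) : Commute (of I a) (of I b) := by
  have h_rel : PresentedGroup.mk (GraphGroupRels I) (FreeGroup.of a * FreeGroup.of b *
      (FreeGroup.of a)⁻¹ * (FreeGroup.of b)⁻¹) = 1 :=
    PresentedGroup.one_of_mem ⟨a, b, h, rfl⟩
  simp only [map_mul, map_inv] at h_rel
  rwa [mul_inv_eq_one, mul_inv_eq_iff_eq_mul] at h_rel

/-- The universal property of the graph group. -/
def lift (f : S → G) (hf : ∀ a b, I a b → Commute (f a) (f b)) : GraphGroup I →* G :=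
  PresentedGroup.toGroup (f := f) <| by
    rintro _ ⟨a, b, h, rfl⟩
    simp [(hf a b h).eq]

@[simp]
theorem lift_of (f : S → G) (hf : ∀ a b, I a b → Commute (f a) (f b)) (a : S) :
    lift f hf (of I a) = f a :=
  PresentedGroup.toGroup.of _

theorem hom_ext {φ ψ : GraphGroup I →* G} (h : ∀ a, φ (of I a) = ψ (of I a)) : φ = ψ :=
  PresentedGroup.ext h

/-- An isomorphism of independence alphabets induces an isomorphism of graph groups. -/
def congr (e : I ≃r J) : GraphGroup I ≃* GraphGroup J :=
  MonoidHom.toMulEquiv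
    (lift (fun a => of J (e a)) fun _ _ h => commute_of (e.map_rel_iff.2 h))
    (lift (fun b => of I (e.symm b)) fun _ _ h => commute_of (e.symm.map_rel_iff.2 h))
    (hom_ext fun a => by simp) (hom_ext fun b => by simp)

/-- The graph group of a disjoint union is the free product of the graph groups. -/
def sumEquivCoprod (I : S → S → Prop) (J : T → T → Prop) :
    GraphGroup (Sum.LiftRel I J) ≃* Monoid.Coprod (GraphGroup I) (GraphGroup J) :=
  MonoidHom.toMulEquiv
    (lift (Sum.elim (fun a => Monoid.Coprod.inl (of I a)) (fun b => Monoid.Coprod.inr (of J b)))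
      (by
        rintro _ _ (h | h)
        · exact (commute_of h).map Monoid.Coprod.inl
        · exact (commute_of h).map Monoid.Coprod.inr))
    (Monoid.Coprod.lift
      (lift (fun a => of _ (Sum.inl a)) fun _ _ h => commute_of (.inl h))
      (lift (fun b => of _ (Sum.inr b)) fun _ _ h => commute_of (.inr h)))
    (hom_ext <| by rintro (a | b) <;> simp)
    (Monoid.Coprod.hom_ext (hom_ext fun a => by simp) (hom_ext fun b => by simp))

/-- The cone over a relation: the new letter `none` is related to all other letters. -/
def Cone (I : S → S → Prop) : Option S → Option S → Prop
  | none, none => False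
  | none, some _ => True
  | some _, none => True
  | some a, some b => I a b

theorem commute_of_none (x : GraphGroup (Cone I)) : Commute x (of (Cone I) none) := by
  refine Subgroup.mem_centralizer_singleton_iff.1 (PresentedGroup.generated_by _
    (Subgroup.centralizer {of (Cone I) none}) (fun a => ?_) x)
  rw [Subgroup.mem_centralizer_singleton_iff]
  cases a with
  | none => rfl
  | some a => exact commute_of (I := Cone I) (a := some a) (b := none) trivial

/-- The graph group of a cone is the direct product of the graph group of the base with `ℤ`. -/
def coneEquivProd (I : S → S → Prop) :
    GraphGroup (Cone I) ≃* GraphGroup I × Multiplicative ℤ :=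
  MonoidHom.toMulEquiv
    (lift (fun o => o.elim (1, Multiplicative.ofAdd 1) fun a => (of I a, 1))
      (by
        rintro (_ | a) (_ | b) h
        · exact .refl _
        · exact .prod (.one_left _) (.one_right _)
        · exact .prod (.one_right _) (.one_left _)
        · exact .prod (commute_of h) (.refl _)))
    (MonoidHom.noncommCoprod
      (lift (fun a => of (Cone I) (some a)) fun a b h =>
        commute_of (I := Cone I) (a := some a) (b := some b) h)
      (zpowersHom _ (of (Cone I) none))
      fun x n => by
        rw [zpowersHom_apply]
        exact (commute_of_none _).zpow_right _)
    (hom_ext <| by rintro (_ | a) <;> simp)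
    (by
      rw [MonoidHom.comp_noncommCoprod, ← MonoidHom.noncommCoprod_inl_inr]
      congr 1
      · exact hom_ext fun a => by simp
      · ext <;> simp)

/-- The graph group of an empty alphabet is trivial. -/
def equivPUnitOfIsEmpty [IsEmpty S] (I : S → S → Prop) : PUnit ≃* GraphGroup I :=
  MonoidHom.toMulEquiv 1 1 (MonoidHom.ext fun _ => rfl) (hom_ext isEmptyElim)

end GraphGroup

namespace IsTransitiveForest

open GraphGroup (Cone)

variable {S T : Type} {I : S → S → Prop} {J : T → T → Prop}

theorem irrefl (h : IsTransitiveForest I) (a : S) : ¬ I a a := by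
  obtain ⟨r, -, -, hI⟩ := h
  exact fun ha => ((hI a a).1 ha).1 rfl

theorem symm (h : IsTransitiveForest I) (a b : S) (hab : I a b) : I b a := by
  obtain ⟨r, -, -, hI⟩ := h
  rw [hI] at hab ⊢
  exact ⟨hab.1.symm, hab.2.symm⟩

theorem of_isEmpty [IsEmpty S] (I : S → S → Prop) : IsTransitiveForest I :=
  ⟨fun _ _ => False, { irrefl := isEmptyElim, trans := isEmptyElim }, isEmptyElim, isEmptyElim⟩

theorem comap (h : IsTransitiveForest J) (f : I ↪r J) : IsTransitiveForest I := by
  obtain ⟨r, hr, h_lin, hJ⟩ := h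
  refine ⟨Order.Preimage f r, (RelEmbedding.preimage f.toEmbedding r).isStrictOrder,
    fun a b c hb hc => ?_, fun a b => ?_⟩
  · simpa [Order.Preimage, f.injective.eq_iff] using h_lin _ _ _ hb hc
  · rw [← f.map_rel_iff, hJ, f.injective.ne_iff]
    rfl

theorem sum (hI : IsTransitiveForest I) (hJ : IsTransitiveForest J) :
    IsTransitiveForest (Sum.LiftRel I J) := by
  obtain ⟨r, hr, hr_lin, hrI⟩ := hI
  obtain ⟨s, hs, hs_lin, hsJ⟩ := hJ
  refine ⟨Sum.LiftRel r s, { irrefl := ?_, trans := ?_ }, ?_, ?_⟩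
  · rintro (a | a) <;> simp [irrefl_of]
  · rintro (a | a) (b | b) (c | c) <;> simp <;> exact trans_of _
  · rintro (a | a) (b | b) (c | c) <;> simp <;> first | exact hr_lin _ _ _ | exact hs_lin _ _ _
  · rintro (a | a) (b | b) <;> simp [hrI, hsJ]

theorem cone (hI : IsTransitiveForest I) : IsTransitiveForest (Cone I) := by
  obtain ⟨r, hr, h_lin, hI⟩ := hI
  refine ⟨fun x y => ∃ b, y = some b ∧ ∀ a, x = some a → r a b, { irrefl := ?_, trans := ?_ },
    ?_, ?_⟩
  · rintro (_ | a) <;> simp [irrefl_of]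
  · rintro (_ | a) (_ | b) (_ | c) <;> simp
    exact trans_of _
  · rintro (_ | a) (_ | b) (_ | c) <;> simp
    exact h_lin _ _ _
  · rintro (_ | a) (_ | b) <;> simp [Cone, hI]

/-- A nonempty finite transitive forest is the disjoint union of a tree, which is the cone over
the part above its root, and the remaining forest. -/
theorem exists_relIso_sum_cone [Finite S] [Nonempty S] (hI : IsTransitiveForest I) :
    ∃ (m : S) (A B : Set S), m ∉ A ∧ m ∉ B ∧
      Nonempty (Sum.LiftRel (Cone (Subrel I (· ∈ A))) (Subrel I (· ∈ B)) ≃r I) := by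
  obtain ⟨r, hr, h_lin, hI⟩ := hI
  obtain ⟨m, -, hm⟩ := (Finite.wellFounded_of_trans_of_irrefl r).has_min Set.univ Set.univ_nonempty
  have hm (x) : ¬ r x m := hm x trivial
  refine ⟨m, {x | r m x}, {x | x ≠ m ∧ ¬ r m x}, irrefl_of r m, fun h => h.1 rfl,
    ⟨Equiv.ofBijective (Sum.elim (fun o => o.elim m (↑)) (↑)) ⟨?_, ?_⟩, ?_⟩⟩
  · rintro ((_ | ⟨a, ha⟩) | ⟨a, ha⟩) ((_ | ⟨b, hb⟩) | ⟨b, hb⟩) <;> simp at * <;> grind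
  · intro x
    by_cases hx : x = m
    · exact ⟨.inl none, hx.symm⟩
    · by_cases hmx : r m x
      · exact ⟨.inl (some ⟨x, hmx⟩), rfl⟩
      · exact ⟨.inr ⟨x, hx, hmx⟩, rfl⟩
  · have h_trans {a b c} : r a b → r b c → r a c := trans_of r
    rintro ((_ | ⟨a, ha⟩) | ⟨a, ha⟩) ((_ | ⟨b, hb⟩) | ⟨b, hb⟩) <;>
      simp [Cone, hI] at * <;> grind

end IsTransitiveForest

theorem IsTransitiveForest.inClassC {S : Type} [Finite S] {I : S → S → Prop}
    (hI : IsTransitiveForest I) : InClassC (GraphGroup I) := by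
  induction hn : Nat.card S using Nat.strong_induction_on generalizing S with
  | _ n ih =>
    subst hn
    cases isEmpty_or_nonempty S with
    | inl _ => exact .iso (GraphGroup.equivPUnitOfIsEmpty I) .triv
    | inr _ =>
      obtain ⟨m, A, B, hA, hB, ⟨e⟩⟩ := hI.exists_relIso_sum_cone
      have h_sub (C : Set S) (hC : m ∉ C) : InClassC (GraphGroup (Subrel I (· ∈ C))) :=
        ih _ (Finite.card_subtype_lt hC) (hI.comap (Subrel.relEmbedding I _)) rfl
      exact .iso (GraphGroup.congr e) <| .iso (GraphGroup.sumEquivCoprod _ _).symm <|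
        .coprod (.iso (GraphGroup.coneEquivProd _).symm (.prodZ (h_sub A hA))) (h_sub B hB)

theorem InClassC.exists_graphGroup {G : Type} [Group G] (hG : InClassC G) :
    ∃ (S : Type) (_ : Finite S) (I : S → S → Prop),
      IsTransitiveForest I ∧ Nonempty (G ≃* GraphGroup I) := by
  induction hG with
  | triv =>
    exact ⟨Empty, inferInstance, fun _ _ => False, .of_isEmpty _,
      ⟨GraphGroup.equivPUnitOfIsEmpty _⟩⟩
  | iso e _ ih =>
    obtain ⟨S, _, I, hI, ⟨f⟩⟩ := ih
    exact ⟨S, ‹_›, I, hI, ⟨e.symm.trans f⟩⟩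
  | coprod _ _ ih₁ ih₂ =>
    obtain ⟨S, _, I, hI, ⟨f⟩⟩ := ih₁
    obtain ⟨T, _, J, hJ, ⟨g⟩⟩ := ih₂
    exact ⟨S ⊕ T, inferInstance, Sum.LiftRel I J, hI.sum hJ,
      ⟨(MulEquiv.coprodCongr f g).trans (GraphGroup.sumEquivCoprod I J).symm⟩⟩
  | prodZ _ ih =>
    obtain ⟨S, _, I, hI, ⟨f⟩⟩ := ih
    exact ⟨Option S, inferInstance, GraphGroup.Cone I, hI.cone,
      ⟨(f.prodCongr (.refl _)).trans (GraphGroup.coneEquivProd I).symm⟩⟩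

/-- A group belongs to the smallest class of groups containing the trivial group
and closed under isomorphism, free products and direct products with `ℤ` if and
only if it is isomorphic to the graph group of a finite independence alphabet that
is a transitive forest. -/
theorem inClassC_iff_graphGroup_of_transitiveForest (G : Type) [Group G] :
    InClassC G ↔
      ∃ (S : Type) (_ : Fintype S) (_ : DecidableEq S) (I : S → S → Prop),
        (∀ a : S, ¬ I a a) ∧ (∀ a b : S, I a b → I b a) ∧
        IsTransitiveForest I ∧ Nonempty (G ≃* GraphGroup I) := by
  constructor
  · intro hG
    obtain ⟨S, _, I, hI, hGI⟩ := hG.exists_graphGroup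
    exact ⟨S, Fintype.ofFinite S, Classical.decEq S, I, hI.irrefl, hI.symm, hI, hGI⟩
  · rintro ⟨S, _, _, I, -, -, hI, ⟨e⟩⟩
    exact .iso e.symm hI.inClassC
end

section
/- Let G₁ and G₂ be groups and let g : Fin m → G₁ ⊕ G₂ be an alternating sequence, i.e. for every i with i+1 < m, consecutive entries g i and g (i+1) lie in different summands. Let ι : G₁ ⊕ G₂ → Monoid.Coprod G₁ G₂ be Sum.elim of the canonical injections. If the product ι(g 0)·ι(g 1)⋯ι(g (m-1)) equals 1 in the free product G₁ ∗ G₂, then one of the following holds: (1) m ≤ 1; (2) there exists i with 1 ≤ i < m such that the product of the first i entries equals 1 in G₁ ∗ G₂ and the product of the remaining m−i entries equals 1 in G₁ ∗ G₂; or (3) there exist k ≥ 2 and indices 0 = j₁ < j₂ < ⋯ < j_k = m−1 such that all entries g j₁, g j₂, …, g j_k lie in the same summand G_i (i ∈ {1,2}), their product g j₁ · g j₂ ⋯ g j_k equals 1 in G_i, and for each ℓ < k the product ι(g (j_ℓ+1))⋯ι(g (j_{ℓ+1}−1)) of the intermediate entries equals 1 in G₁ ∗ G₂. -/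
/-- The canonical map `G₁ ⊕ G₂ → G₁ ∗ G₂` given by `Sum.elim` of the two injections
into the free product. -/
def coprodElim {G₁ G₂ : Type*} [Group G₁] [Group G₂] : G₁ ⊕ G₂ → Monoid.Coprod G₁ G₂ :=
  Sum.elim (fun x => (Monoid.Coprod.inl x : Monoid.Coprod G₁ G₂))
    (fun y => Monoid.Coprod.inr y)

section LetterProducts

variable {ι α : Type*} {M : ι → Type*} [∀ i, Monoid (M i)] (e : α → Σ i, M i)

open Monoid

/-- The product in the free product of a word over an alphabet `α` labelled by elements of the
factors. -/
def letterProd (w : List α) : CoprodI M :=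
  (w.map fun x => CoprodI.of (e x).2).prod

@[simp]
theorem letterProd_nil : letterProd e [] = 1 := rfl

@[simp]
theorem letterProd_cons (x : α) (w : List α) :
    letterProd e (x :: w) = CoprodI.of (e x).2 * letterProd e w := by
  simp [letterProd]

@[simp]
theorem letterProd_append (v w : List α) :
    letterProd e (v ++ w) = letterProd e v * letterProd e w := by
  simp [letterProd]

variable {e} in
theorem letterProd_cons_of_eq {i : ι} {x : α} {y : M i} (hx : e x = ⟨i, y⟩) (w : List α) :
    letterProd e (x :: w) = CoprodI.of y * letterProd e w := by
  rw [letterProd_cons, hx]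

/-- `FactorDecomp e i w c` says that `w` consists of letters of the factor `i` whose product is
`c`, separated by (possibly empty) blocks which multiply to `1` in the free product. -/
inductive FactorDecomp (i : ι) : List α → M i → Prop
  | trivial (w : List α) (hw : letterProd e w = 1) : FactorDecomp i w 1
  | cons (b : List α) (hb : letterProd e b = 1) (x : α) (y : M i) (hx : e x = ⟨i, y⟩)
      (w : List α) (c : M i) (hw : FactorDecomp i w c) : FactorDecomp i (b ++ x :: w) (y * c)

/-- `WordDecomp e w r` says that `w` is a concatenation of pieces decomposing the successive
letters of `r`, followed by a block which multiplies to `1`. -/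
inductive WordDecomp : List α → List (Σ i, M i) → Prop
  | nil (w : List α) (hw : letterProd e w = 1) : WordDecomp w []
  | cons (i : ι) (c : M i) (v w : List α) (r : List (Σ i, M i)) (hv : FactorDecomp e i v c)
      (hw : WordDecomp w r) : WordDecomp (v ++ w) (⟨i, c⟩ :: r)

variable {e}

theorem FactorDecomp.letterProd_eq {i : ι} {w : List α} {c : M i} (h : FactorDecomp e i w c) :
    letterProd e w = CoprodI.of c := by
  induction h with
  | trivial w hw => simpa using hw
  | cons b hb x y hx w c hw ih =>
    rw [letterProd_append, hb, one_mul, letterProd_cons_of_eq hx, ih, map_mul]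

theorem FactorDecomp.append_left {i : ι} {w : List α} {c : M i} (h : FactorDecomp e i w c)
    {v : List α} (hv : letterProd e v = 1) : FactorDecomp e i (v ++ w) c := by
  cases h with
  | trivial w hw => exact .trivial _ (by simp [hv, hw])
  | cons b hb x y hx w c hw =>
    rw [← List.append_assoc]
    exact .cons _ (by simp [hv, hb]) x y hx w c hw

theorem FactorDecomp.append_right {i : ι} {w : List α} {c : M i} (h : FactorDecomp e i w c)
    {v : List α} (hv : letterProd e v = 1) : FactorDecomp e i (w ++ v) c := by
  induction h with
  | trivial w hw => exact .trivial _ (by simp [hv, hw])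
  | cons b hb x y hx w c hw ih =>
    rw [List.append_assoc, List.cons_append]
    exact .cons b hb x y hx _ c ih

theorem WordDecomp.append_left {w : List α} {r : List (Σ i, M i)} (h : WordDecomp e w r)
    {v : List α} (hv : letterProd e v = 1) : WordDecomp e (v ++ w) r := by
  cases h with
  | nil w hw => exact .nil _ (by simp [hv, hw])
  | cons i c v' w r hv' hw =>
    rw [← List.append_assoc]
    exact .cons i c _ w r (hv'.append_left hv) hw

theorem WordDecomp.letterProd_eq {w : List α} {r : List (Σ i, M i)} (h : WordDecomp e w r) :
    letterProd e w = (r.map fun x => CoprodI.of x.2).prod := by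
  induction h with
  | nil w hw => simpa using hw
  | cons i c v w r hv hw ih => simp [hv.letterProd_eq, ih]

variable (e) in
/-- Every word decomposes along some reduced word. -/
theorem exists_wordDecomp (w : List α) : ∃ r : CoprodI.Word M, WordDecomp e w r.toList := by
  induction w with
  | nil => exact ⟨.empty, .nil [] rfl⟩
  | cons x w ih =>
    obtain ⟨r, hr⟩ := ih
    obtain ⟨i, y, hx⟩ : ∃ i y, e x = ⟨i, y⟩ := ⟨_, _, rfl⟩
    by_cases hi : r.fstIdx = some i
    · induction r using CoprodI.Word.consRecOn with
      | empty => simp [CoprodI.Word.fstIdx] at hi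
      | cons j c r h1 h2 _ =>
        obtain rfl : j = i := by simpa using hi
        rw [CoprodI.Word.cons_toList] at hr
        cases hr with
        | cons _ _ v w _ hv hw =>
          have hxv : FactorDecomp e j (x :: v) (y * c) := .cons [] rfl x y hx v c hv
          by_cases hyc : y * c = 1
          · refine ⟨r, hw.append_left (v := x :: v) ?_⟩
            rw [hxv.letterProd_eq, hyc, map_one]
          · exact ⟨.cons (y * c) r h1 hyc, .cons j _ (x :: v) w _ hxv hw⟩
    · by_cases hy : y = 1
      · exact ⟨r, hr.append_left (v := [x]) (by simp [letterProd_cons_of_eq hx, hy])⟩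
      · refine ⟨.cons y r hi hy, .cons i y [x] w _ ?_ hr⟩
        simpa using FactorDecomp.cons [] rfl x y hx [] 1 (.trivial [] rfl)

theorem factorDecomp_of_letterProd_eq {i : ι} {w : List α} {c : M i}
    (h : letterProd e w = CoprodI.of c) : FactorDecomp e i w c := by
  classical
  obtain ⟨r, hr⟩ := exists_wordDecomp e w
  have hrc : r.prod = CoprodI.of c := hr.letterProd_eq.symm.trans h
  by_cases hc : c = 1
  · subst hc
    exact .trivial w (by simpa using h)
  · obtain rfl : r = .cons c .empty (by simp [CoprodI.Word.fstIdx]) hc :=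
      CoprodI.Word.equiv.symm.injective (by simpa [CoprodI.Word.equiv] using hrc)
    rw [CoprodI.Word.cons_toList] at hr
    cases hr with
    | cons _ _ v w _ hv hw =>
      cases hw with
      | nil _ hw => exact hv.append_right hw

/-- The positions of the letters in a `FactorDecomp`, for a word starting with a letter of the
given factor. -/
theorem FactorDecomp.exists_positions {i : ι} {w : List α} {c : M i} (h : FactorDecomp e i w c)
    {x : α} {y : M i} (hx : e x = ⟨i, y⟩) :
    ∃ (k : ℕ) (j : Fin (k + 1) → ℕ) (a : Fin (k + 1) → α) (u : Fin (k + 1) → M i),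
      StrictMono j ∧ j 0 = 0 ∧ (∀ l, (x :: w)[j l]? = some (a l)) ∧ (∀ l, e (a l) = ⟨i, u l⟩) ∧
      (List.ofFn u).prod = y * c ∧
      (∀ l : Fin k, letterProd e
        (((x :: w).drop (j l.castSucc + 1)).take (j l.succ - j l.castSucc - 1)) = 1) ∧
      letterProd e ((x :: w).drop (j (Fin.last k) + 1)) = 1 := by
  induction h generalizing x y with
  | trivial w hw =>
    exact ⟨0, fun _ => 0, fun _ => x, fun _ => y, Subsingleton.strictMono (α := Fin 1) _, rfl, by simp,
      fun _ => hx, by simp, fun l => l.elim0, by simpa using hw⟩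
  | cons b hb z t hz w c hw ih =>
    obtain ⟨k, j, a, u, hj, hj0, ha, hu, hprod, hblock, hlast⟩ := ih hz
    have hdrop (n : ℕ) : (x :: (b ++ z :: w)).drop (n + (b.length + 1)) = (z :: w).drop n := by
      rw [show n + (b.length + 1) = (b.length + n) + 1 by omega, List.drop_succ_cons,
        List.drop_append]
      simp
    refine ⟨k + 1, Fin.cons 0 fun l => j l + (b.length + 1), Fin.cons x a, Fin.cons y u, ?_, rfl,
      ?_, ?_, ?_, ?_, ?_⟩
    · rw [Fin.strictMono_iff_lt_succ]
      intro l
      cases l using Fin.cases with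
      | zero => simp
      | succ l => simpa [← Fin.succ_castSucc] using hj l.castSucc_lt_succ
    · intro l
      cases l using Fin.cases with
      | zero => simp
      | succ l =>
        rw [← List.head?_drop, Fin.cons_succ, Fin.cons_succ, hdrop, List.head?_drop, ha]
    · intro l
      cases l using Fin.cases with
      | zero => simpa using hx
      | succ l => simpa using hu l
    · rw [List.ofFn_cons, List.prod_cons, hprod]
    · intro l
      cases l using Fin.cases with
      | zero => simp [hj0, hb]
      | succ l =>
        rw [← Fin.succ_castSucc, Fin.cons_succ, Fin.cons_succ,
          show j l.castSucc + (b.length + 1) + 1 = j l.castSucc + 1 + (b.length + 1) by omega,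
          hdrop, Nat.add_sub_add_right]
        exact hblock l
    · rw [← Fin.succ_last, Fin.cons_succ,
        show j (Fin.last k) + (b.length + 1) + 1 = j (Fin.last k) + 1 + (b.length + 1) by omega,
        hdrop]
      exact hlast

end LetterProducts

section SumFamily

universe u v

/-- Two groups as a family indexed by `Bool`, lifted to a common universe. -/
def BoolFamily (G₁ : Type u) (G₂ : Type v) : Bool → Type max u v
  | true => ULift.{v} G₁
  | false => ULift.{u} G₂

variable {G₁ : Type u} {G₂ : Type v} [Group G₁] [Group G₂]

instance : ∀ b, Group (BoolFamily G₁ G₂ b)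
  | true => inferInstanceAs (Group (ULift.{v} G₁))
  | false => inferInstanceAs (Group (ULift.{u} G₂))

/-- The member of the family at `true` is `G₁`. -/
def boolFamilyTrue : BoolFamily G₁ G₂ true ≃* G₁ := (MulEquiv.ulift : ULift.{v} G₁ ≃* G₁)

/-- The member of the family at `false` is `G₂`. -/
def boolFamilyFalse : BoolFamily G₁ G₂ false ≃* G₂ := (MulEquiv.ulift : ULift.{u} G₂ ≃* G₂)

/-- A letter of `G₁ ⊕ G₂` as an element of a member of the family. -/
def boolLetter : G₁ ⊕ G₂ → Σ b, BoolFamily G₁ G₂ b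
  | .inl x => ⟨true, boolFamilyTrue.symm x⟩
  | .inr x => ⟨false, boolFamilyFalse.symm x⟩

/-- The homomorphisms from the lifted factors to the binary free product. -/
def boolFamilyToCoprod : ∀ b, BoolFamily G₁ G₂ b →* Monoid.Coprod G₁ G₂
  | true => Monoid.Coprod.inl.comp boolFamilyTrue.toMonoidHom
  | false => Monoid.Coprod.inr.comp boolFamilyFalse.toMonoidHom

/-- The comparison map from the binary free product to the indexed one. -/
def coprodToCoprodI : Monoid.Coprod G₁ G₂ →* Monoid.CoprodI (BoolFamily G₁ G₂) :=
  Monoid.Coprod.lift (Monoid.CoprodI.of.comp boolFamilyTrue.symm.toMonoidHom)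
    (Monoid.CoprodI.of.comp boolFamilyFalse.symm.toMonoidHom)

theorem eq_inl_of_boolLetter_eq {x : G₁ ⊕ G₂} {y : BoolFamily G₁ G₂ true}
    (h : boolLetter x = ⟨true, y⟩) : x = .inl (boolFamilyTrue y) := by
  cases x with
  | inl z => cases h; rfl
  | inr z => exact nomatch congrArg Sigma.fst h

theorem eq_inr_of_boolLetter_eq {x : G₁ ⊕ G₂} {y : BoolFamily G₁ G₂ false}
    (h : boolLetter x = ⟨false, y⟩) : x = .inr (boolFamilyFalse y) := by
  cases x with
  | inl z => exact nomatch congrArg Sigma.fst h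
  | inr z => cases h; rfl

theorem letterProd_boolLetter_eq_one_iff (w : List (G₁ ⊕ G₂)) :
    letterProd boolLetter w = 1 ↔ (w.map coprodElim).prod = 1 := by
  constructor
  · intro h
    have h' := congrArg (Monoid.CoprodI.lift boolFamilyToCoprod) h
    rw [letterProd, map_list_prod, List.map_map, map_one] at h'
    rw [← h']
    congr 2
    funext x
    cases x with
    | inl x =>
      exact ((Monoid.CoprodI.lift_of boolFamilyToCoprod (boolFamilyTrue.symm x)).trans
        (congrArg Monoid.Coprod.inl (boolFamilyTrue.apply_symm_apply x))).symm
    | inr x =>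
      exact ((Monoid.CoprodI.lift_of boolFamilyToCoprod (boolFamilyFalse.symm x)).trans
        (congrArg Monoid.Coprod.inr (boolFamilyFalse.apply_symm_apply x))).symm
  · intro h
    have h' := congrArg coprodToCoprodI h
    rw [map_list_prod, List.map_map, map_one] at h'
    rw [← h', letterProd]
    congr 2
    funext x
    cases x <;> rfl

end SumFamily


/-- If an alternating word `g 0, …, g (m-1)` over `G₁ ⊔ G₂` multiplies to `1` in the
free product `G₁ ∗ G₂`, then (1) `m ≤ 1`, or (2) some nonempty proper prefix and the
corresponding suffix each multiply to `1` in `G₁ ∗ G₂`, or (3) there are indices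
`0 = j₁ < j₂ < ⋯ < j_k = m-1` (with `k ≥ 2`) whose entries all lie in the same
factor and multiply to `1` there, while each block of intermediate entries
multiplies to `1` in `G₁ ∗ G₂`. -/
theorem coprod_alternating_word_eq_one
    {G₁ G₂ : Type*} [Group G₁] [Group G₂] {m : ℕ} (g : Fin m → G₁ ⊕ G₂)
    (halt : ∀ (i : ℕ) (hi : i + 1 < m),
      (g ⟨i, Nat.lt_of_succ_lt hi⟩).isLeft ≠ (g ⟨i + 1, hi⟩).isLeft)
    (hprod : (List.ofFn (fun i => coprodElim (g i))).prod = 1) :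
    m ≤ 1 ∨
    (∃ i : ℕ, 1 ≤ i ∧ i < m ∧
      ((List.ofFn (fun i => coprodElim (g i))).take i).prod = 1 ∧
      ((List.ofFn (fun i => coprodElim (g i))).drop i).prod = 1) ∨
    (∃ (k : ℕ) (hk : 2 ≤ k) (j : Fin k → Fin m), StrictMono j ∧
      (j ⟨0, by omega⟩ : ℕ) = 0 ∧ (j ⟨k - 1, by omega⟩ : ℕ) = m - 1 ∧
      ((∃ u : Fin k → G₁, (∀ ℓ : Fin k, g (j ℓ) = Sum.inl (u ℓ)) ∧
          (List.ofFn u).prod = 1) ∨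
       (∃ u : Fin k → G₂, (∀ ℓ : Fin k, g (j ℓ) = Sum.inr (u ℓ)) ∧
          (List.ofFn u).prod = 1)) ∧
      ∀ (ℓ : ℕ) (hℓ : ℓ + 1 < k),
        (((List.ofFn (fun i => coprodElim (g i))).drop
            ((j ⟨ℓ, Nat.lt_of_succ_lt hℓ⟩ : ℕ) + 1)).take
          ((j ⟨ℓ + 1, hℓ⟩ : ℕ) - (j ⟨ℓ, Nat.lt_of_succ_lt hℓ⟩ : ℕ) - 1)).prod = 1) := by
  have hmap : List.ofFn (fun i => coprodElim (g i)) = (List.ofFn g).map coprodElim := by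
    simp [List.map_ofFn, Function.comp_def]
  rw [hmap] at hprod ⊢
  simp only [← List.map_drop, ← List.map_take, ← letterProd_boolLetter_eq_one_iff]
    at hprod ⊢
  by_cases hm : m ≤ 1
  · exact .inl hm
  refine .inr ?_
  obtain ⟨x, w, hw⟩ : ∃ x w, List.ofFn g = x :: w :=
    List.exists_cons_of_ne_nil (by simp; omega)
  have hlen : (x :: w).length = m := by rw [← hw, List.length_ofFn]
  obtain ⟨i, y, hx⟩ : ∃ i y, boolLetter x = ⟨i, y⟩ := ⟨_, _, rfl⟩
  have hprod' : letterProd boolLetter w = Monoid.CoprodI.of y⁻¹ := by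
    rw [hw, letterProd_cons_of_eq hx] at hprod
    rw [map_inv]
    exact (inv_eq_of_mul_eq_one_right hprod).symm
  obtain ⟨k, j, a, u, hj, hj0, ha, hu, hu1, hblock, hlast⟩ :=
    (factorDecomp_of_letterProd_eq hprod').exists_positions hx
  have hjm (l) : j l < m := by
    rw [← hlen]
    exact (List.getElem?_eq_some_iff.mp (ha l)).1
  rw [← hw] at ha hblock hlast
  have hga (l) : g ⟨j l, hjm l⟩ = a l := by
    simpa [List.getElem?_ofFn, hjm l] using ha l
  rw [mul_inv_cancel] at hu1
  by_cases hend : j (Fin.last k) + 1 < m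
  · refine .inl ⟨_, Nat.le_add_left 1 _, hend, ?_, hlast⟩
    rw [← List.take_append_drop (j (Fin.last k) + 1) (List.ofFn g), letterProd_append, hlast,
      mul_one] at hprod
    exact hprod
  have hend' : j (Fin.last k) = m - 1 := by have := hjm (Fin.last k); omega
  have hk : 2 ≤ k + 1 := by
    rcases k with _ | k
    · have : j (Fin.last 0) = 0 := hj0
      omega
    · omega
  refine .inr ⟨k + 1, hk, fun l => ⟨j l, hjm l⟩, fun _ _ h => hj h, hj0, hend', ?_,
    fun l hl => hblock ⟨l, by omega⟩⟩
  cases i with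
  | true =>
    refine .inl ⟨fun l => boolFamilyTrue (u l),
      fun l => (hga l).trans (eq_inl_of_boolLetter_eq (hu l)), ?_⟩
    have := congrArg boolFamilyTrue hu1
    rwa [map_list_prod, List.map_ofFn, map_one] at this
  | false =>
    refine .inr ⟨fun l => boolFamilyFalse (u l),
      fun l => (hga l).trans (eq_inr_of_boolLetter_eq (hu l)), ?_⟩
    have := congrArg boolFamilyFalse hu1
    rwa [map_list_prod, List.map_ofFn, map_one] at this
end

section
/- Let A, G, H be groups and ι₁ : A →* G, ι₂ : A →* H injective homomorphisms such that: ι₂ is not surjective (H ≠ A); the range of ι₁ has at least 5 left cosets in G (index at least 5, where infinite index is allowed); and there exists h ∈ H with h⁻¹·(range ι₂)·h ∩ (range ι₂) = {1}, i.e. for all a ∈ A, if h⁻¹ · ι₂(a) · h ∈ range ι₂ then a = 1. Then there is an injective group homomorphism from the free product Monoid.Coprod G (FreeGroup (Fin 2)) into the amalgamated free product G ∗_A H whose composition with the left injection G →* Monoid.Coprod G (FreeGroup (Fin 2)) equals the canonical homomorphism G →* G ∗_A H. In particular, G ∗_A H contains a copy of G ∗ F₂, the free product of G with a free group of rank two.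 -/
/-- The amalgamation relators `inl (ι₁ a) * (inr (ι₂ a))⁻¹` in the free product. -/
def AmalgRels {A G H : Type*} [Group A] [Group G] [Group H]
    (ι₁ : A →* G) (ι₂ : A →* H) : Set (Monoid.Coprod G H) :=
  { x | ∃ a : A, x = Monoid.Coprod.inl (ι₁ a) * (Monoid.Coprod.inr (ι₂ a))⁻¹ }

/-- The amalgamated free product `G ∗_A H` along `ι₁ : A →* G` and `ι₂ : A →* H`:
the quotient of the free product `G ∗ H` by the normal closure of the
amalgamation relators. -/
abbrev AmalgamatedProduct {A G H : Type*} [Group A] [Group G] [Group H]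
    (ι₁ : A →* G) (ι₂ : A →* H) : Type _ :=
  Monoid.Coprod G H ⧸ Subgroup.normalClosure (AmalgRels ι₁ ι₂)

/-- The canonical homomorphism `G →* G ∗_A H`. -/
def AmalgamatedProduct.inl {A G H : Type*} [Group A] [Group G] [Group H]
    (ι₁ : A →* G) (ι₂ : A →* H) : G →* AmalgamatedProduct ι₁ ι₂ :=
  (QuotientGroup.mk' (Subgroup.normalClosure (AmalgRels ι₁ ι₂))).comp Monoid.Coprod.inl

open scoped Pointwise

theorem zpow_smul_mem_union_of_ping_pong {K α : Type*} [Group K] [MulAction K α] {a : K}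
    {X Y : Set α} (hXY : Disjoint X Y) (hX : ∀ p ∉ Y, a • p ∈ X) (hY : ∀ p ∉ X, a⁻¹ • p ∈ Y)
    {n : ℤ} (hn : n ≠ 0) {p : α} (hp : p ∉ X ∪ Y) : a ^ n • p ∈ X ∪ Y := by
  have iterate_mem : ∀ {b : K} {S T : Set α}, Disjoint S T → (∀ q ∉ T, b • q ∈ S) → p ∉ T →
      ∀ m : ℕ, b ^ (m + 1) • p ∈ S := by
    intro b S T hST hb hpT m
    induction m with
    | zero => simpa using hb p hpT
    | succ m ih =>
      rw [pow_succ', mul_smul]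
      exact hb _ (hST.notMem_of_mem_left ih)
  rw [Set.mem_union, not_or] at hp
  obtain ⟨m, rfl | rfl⟩ := n.eq_nat_or_neg
  · obtain ⟨m, rfl⟩ := Nat.exists_eq_succ_of_ne_zero (n := m) (by simpa using hn)
    rw [zpow_natCast]
    exact Or.inl (iterate_mem hXY hX hp.2 m)
  · obtain ⟨m, rfl⟩ := Nat.exists_eq_succ_of_ne_zero (n := m) (by simpa using hn)
    rw [zpow_neg, zpow_natCast, ← inv_pow]
    exact Or.inr (iterate_mem hXY.symm hY hp.1 m)

/-- The factors of the free product `G ∗ FreeGroup ι`, with one infinite cyclic group for each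
generator of the free group. -/
def CoprodFreeGroupFactor.{u, v} (G : Type u) (ι : Type v) : Option ι → Type u
  | none => G
  | some _ => ULift (Multiplicative ℤ)

instance {G ι : Type*} [Group G] : ∀ o, Group (CoprodFreeGroupFactor G ι o)
  | none => inferInstanceAs (Group G)
  | some _ => inferInstanceAs (Group (ULift (Multiplicative ℤ)))

/-- The homomorphisms out of the factors of `G ∗ FreeGroup ι` given by a homomorphism out of `G`
and the images of the free generators. -/
def CoprodFreeGroupFactor.hom {G ι K : Type*} [Group G] [Group K] (f : G →* K) (a : ι → K) :
    ∀ o, CoprodFreeGroupFactor G ι o →* K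
  | none => f
  | some i => (zpowersHom K (a i)).comp MulEquiv.ulift.toMonoidHom

/-- The canonical homomorphism from `G ∗ FreeGroup ι` to the free product of its factors. -/
def CoprodFreeGroupFactor.ofCoprod {G ι : Type*} [Group G] :
    Monoid.Coprod G (FreeGroup ι) →* Monoid.CoprodI (CoprodFreeGroupFactor G ι) :=
  Monoid.Coprod.lift
    ((Monoid.CoprodI.of (M := CoprodFreeGroupFactor G ι) (i := none)).comp (MonoidHom.id G))
    (FreeGroup.lift fun i => Monoid.CoprodI.of (M := CoprodFreeGroupFactor G ι) (i := some i)
      (ULift.up (Multiplicative.ofAdd 1)))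

theorem CoprodFreeGroupFactor.lift_hom_comp_ofCoprod {G ι K : Type*} [Group G] [Group K]
    (f : G →* K) (a : ι → K) :
    (Monoid.CoprodI.lift (hom f a)).comp ofCoprod = Monoid.Coprod.lift f (FreeGroup.lift a) := by
  ext x
  · exact Monoid.CoprodI.lift_of (fi := hom f a) (i := none) x
  · simp only [ofCoprod, MonoidHom.comp_apply, Monoid.Coprod.lift_apply_inr,
      FreeGroup.lift_apply_of]
    exact zpow_one _

theorem CoprodFreeGroupFactor.ofCoprod_injective {G ι : Type*} [Group G] :
    Function.Injective (ofCoprod (G := G) (ι := ι)) := by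
  refine Function.LeftInverse.injective (g := Monoid.CoprodI.lift
    (hom Monoid.Coprod.inl fun i => Monoid.Coprod.inr (FreeGroup.of i))) fun x => ?_
  have h : FreeGroup.lift (fun i : ι => (Monoid.Coprod.inr (FreeGroup.of i) :
      Monoid.Coprod G (FreeGroup ι))) = Monoid.Coprod.inr := by
    ext
    simp
  rw [← MonoidHom.comp_apply, lift_hom_comp_ofCoprod, h, Monoid.Coprod.lift_inl_inr,
    MonoidHom.id_apply]

/-- The ping-pong lemma for the free product of a group and a free group. -/
theorem Monoid.Coprod.lift_freeGroup_injective_of_ping_pong {G ι K α : Type*} [Group G] [Group K]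
    [MulAction K α] [Nonempty ι] (f : G →* K) (a : ι → K) (Z : Set α) (X Y : ι → Set α)
    (hZ : Z.Nonempty) (hX : ∀ i, (X i).Nonempty)
    (hXZ : ∀ i, Disjoint (X i) Z) (hYZ : ∀ i, Disjoint (Y i) Z)
    (hXX : Pairwise fun i j => Disjoint (X i) (X j))
    (hYY : Pairwise fun i j => Disjoint (Y i) (Y j))
    (hXY : ∀ i j, Disjoint (X i) (Y j))
    (haX : ∀ i, ∀ p ∉ Y i, a i • p ∈ X i) (haY : ∀ i, ∀ p ∉ X i, (a i)⁻¹ • p ∈ Y i)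
    (hf : ∀ g ≠ 1, ∀ i, ∀ p ∈ X i ∪ Y i, f g • p ∈ Z) :
    Function.Injective (Monoid.Coprod.lift f (FreeGroup.lift a)) := by
  rw [← CoprodFreeGroupFactor.lift_hom_comp_ofCoprod, MonoidHom.coe_comp]
  refine Function.Injective.comp ?_ CoprodFreeGroupFactor.ofCoprod_injective
  let W : Option ι → Set α := fun o => o.elim Z fun i => X i ∪ Y i
  have hWZ : ∀ i, Disjoint (X i ∪ Y i) Z := fun i => (hXZ i).union_left (hYZ i)
  have hWW : Pairwise fun i j => Disjoint (X i ∪ Y i) (X j ∪ Y j) := fun i j hij =>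
    ((hXX hij).union_right (hXY i j)).union_left ((hXY j i).symm.union_right (hYY hij))
  have zpow_mem : ∀ i, ∀ n : CoprodFreeGroupFactor G ι (some i), n ≠ 1 → ∀ p ∉ X i ∪ Y i,
      CoprodFreeGroupFactor.hom f a (some i) n • p ∈ X i ∪ Y i := by
    intro i n hn p hp
    exact zpow_smul_mem_union_of_ping_pong (n := Multiplicative.toAdd (ULift.down n))
      (hXY i i) (haX i) (haY i) (fun h => hn (ULift.ext _ _ h)) hp
  refine Monoid.CoprodI.lift_injective_of_ping_pong _ (.inr ?_) W ?_ ?_ ?_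
  · refine ⟨some (Classical.arbitrary ι), ?_⟩
    have : Infinite (CoprodFreeGroupFactor G ι (some (Classical.arbitrary ι))) :=
      inferInstanceAs (Infinite (ULift (Multiplicative ℤ)))
    exact (Cardinal.natCast_le_aleph0 (n := 3)).trans (Cardinal.aleph0_le_mk _)
  · rintro (_ | i)
    · exact hZ
    · exact (hX i).inl
  · rintro (_ | i) (_ | j) hij
    · exact absurd rfl hij
    · exact (hWZ j).symm
    · exact hWZ i
    · exact hWW fun h => hij (congrArg some h)
  · rintro (_ | i) (_ | j) hij g hg _ ⟨p, hp, rfl⟩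
    · exact absurd rfl hij
    · exact hf g hg j p hp
    · exact zpow_mem i g hg p ((hWZ i).notMem_of_mem_right hp)
    · exact zpow_mem i g hg p ((hWW fun h => hij (congrArg some h)).notMem_of_mem_right hp)

namespace Monoid.PushoutI.NormalWord

variable {ι A : Type*} {G : ι → Type*} [∀ i, Group (G i)] [Group A] {φ : ∀ i, A →* G i}
  {d : Transversal φ}

theorem fstIdx_of_smul [DecidableEq ι] [∀ i, DecidableEq (G i)] {i : ι} {g : G i}
    (hg : g ∉ (φ i).range) {w : NormalWord d} (hw : w.fstIdx ≠ some i) :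
    (of (φ := φ) i g • w).fstIdx = some i := by
  let w' : NormalWord d := { w with head := 1 }
  have hw' : w = base φ w.head • w' := by simp [w', base_smul_def]
  have hg' : g * φ i w.head ∉ (φ i).range := by
    rwa [Subgroup.mul_mem_cancel_right _ (MonoidHom.mem_range.2 ⟨w.head, rfl⟩)]
  rw [hw', ← of_apply_eq_base φ i, smul_smul, ← map_mul, ← cons_eq_smul _ w' hw hg']
  simp [cons]

end Monoid.PushoutI.NormalWord

namespace AmalgamatedProduct

variable {A G H : Type*} [Group A] [Group G] [Group H] (ι₁ : A →* G) (ι₂ : A →* H)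

/-- The canonical homomorphism `H →* G ∗_A H`. -/
def inr : H →* AmalgamatedProduct ι₁ ι₂ :=
  (QuotientGroup.mk' (Subgroup.normalClosure (AmalgRels ι₁ ι₂))).comp Monoid.Coprod.inr

theorem inl_apply_eq_inr_apply (a : A) : inl ι₁ ι₂ (ι₁ a) = inr ι₁ ι₂ (ι₂ a) := by
  rw [← mul_inv_eq_one, ← map_inv]
  simp only [inl, inr, MonoidHom.comp_apply, ← map_mul]
  refine (QuotientGroup.eq_one_iff _).2 (Subgroup.subset_normalClosure ⟨a, ?_⟩)
  rw [map_inv]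

variable {ι₁ ι₂}

/-- The homomorphism out of `G ∗_A H` given by its universal property. -/
def lift {K : Type*} [Group K] (f₁ : G →* K) (f₂ : H →* K) (hf : ∀ a, f₁ (ι₁ a) = f₂ (ι₂ a)) :
    AmalgamatedProduct ι₁ ι₂ →* K :=
  QuotientGroup.lift _ (Monoid.Coprod.lift f₁ f₂) <| by
    refine Subgroup.normalClosure_le_normal ?_
    rintro _ ⟨a, rfl⟩
    simp [MonoidHom.mem_ker, hf]

/-- The two groups of an amalgam, lifted to a common universe. -/
def Factor.{u, v} (G : Type u) (H : Type v) : Bool → Type (max u v)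
  | false => ULift.{v} G
  | true => ULift.{u} H

instance : ∀ b, Group (Factor G H b)
  | false => inferInstanceAs (Group (ULift G))
  | true => inferInstanceAs (Group (ULift H))

/-- The inclusions of the amalgamated subgroup in the two groups of an amalgam. -/
def Factor.hom (ι₁ : A →* G) (ι₂ : A →* H) : ∀ b, A →* Factor G H b
  | false => MulEquiv.ulift.symm.toMonoidHom.comp ι₁
  | true => MulEquiv.ulift.symm.toMonoidHom.comp ι₂

/-- `G ∗_A H` acts on a set with a subset `P` which plays the role of the normal words whose first
letter is in `H`: it is moved off itself by the elements of `G` outside `A`, and contains the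
translates of its complement by the elements of `H` outside `A`. -/
theorem exists_mulAction.{u, v, w} {A : Type u} {G : Type v} {H : Type w} [Group A] [Group G]
    [Group H] {ι₁ : A →* G} {ι₂ : A →* H} (hinj₁ : Function.Injective ι₁) (hinj₂ : Function.Injective ι₂) :
    ∃ (α : Type (max u v w)) (_ : MulAction (AmalgamatedProduct ι₁ ι₂) α) (P : Set α), Pᶜ.Nonempty ∧
      (∀ g ∉ ι₁.range, ∀ p ∈ P, inl ι₁ ι₂ g • p ∉ P) ∧
      (∀ h ∉ ι₂.range, ∀ p ∉ P, inr ι₁ ι₂ h • p ∈ P) := by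
  classical
  let φ := Factor.hom ι₁ ι₂
  have hφ : ∀ b, Function.Injective (φ b) := by
    rintro (_ | _)
    · exact MulEquiv.ulift.symm.injective.comp hinj₁
    · exact MulEquiv.ulift.symm.injective.comp hinj₂
  obtain ⟨d⟩ := Monoid.PushoutI.NormalWord.transversal_nonempty φ hφ
  let j₁ : G →* Monoid.PushoutI φ :=
    (Monoid.PushoutI.of false).comp (MulEquiv.ulift (α := G)).symm.toMonoidHom
  let j₂ : H →* Monoid.PushoutI φ :=
    (Monoid.PushoutI.of true).comp (MulEquiv.ulift (α := H)).symm.toMonoidHom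
  let j : AmalgamatedProduct ι₁ ι₂ →* Monoid.PushoutI φ := lift j₁ j₂ fun a =>
    (Monoid.PushoutI.of_apply_eq_base φ false a).trans
      (Monoid.PushoutI.of_apply_eq_base φ true a).symm
  have range₁ : ∀ g : G, (ULift.up g : Factor G H false) ∈ (φ false).range → g ∈ ι₁.range :=
    fun g ⟨a, ha⟩ => ⟨a, congrArg ULift.down ha⟩
  have range₂ : ∀ h : H, (ULift.up h : Factor G H true) ∈ (φ true).range → h ∈ ι₂.range :=
    fun h ⟨a, ha⟩ => ⟨a, congrArg ULift.down ha⟩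
  refine ⟨Monoid.PushoutI.NormalWord d, MulAction.compHom _ j, {w | w.fstIdx = some true},
    ⟨.empty, by simp [Monoid.PushoutI.NormalWord.empty, Monoid.CoprodI.Word.fstIdx]⟩, ?_, ?_⟩
  · intro g hg w hw h
    have := Monoid.PushoutI.NormalWord.fstIdx_of_smul (w := w) (mt (range₁ g) hg)
      (by rw [show w.fstIdx = some true from hw]; simp)
    exact absurd (this.symm.trans h) (by simp)
  · intro h hh w hw
    exact Monoid.PushoutI.NormalWord.fstIdx_of_smul (mt (range₂ h) hh) hw

end AmalgamatedProduct

/-- A subgroup of infinite index or index at least `n + 1` has `n + 1` distinct left cosets, one of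
which is the subgroup itself. -/
theorem Subgroup.exists_pairwise_inv_mul_notMem {G : Type*} [Group G] (A : Subgroup G) (n : ℕ)
    (hA : A.index = 0 ∨ n + 1 ≤ A.index) :
    ∃ s : Fin (n + 1) → G, s 0 = 1 ∧ ∀ i j, i ≠ j → (s i)⁻¹ * s j ∉ A := by
  obtain ⟨e⟩ : Nonempty (Fin (n + 1) ↪ G ⧸ A) := by
    rcases finite_or_infinite (G ⧸ A) with hfin | hinf
    · have := Fintype.ofFinite (G ⧸ A)
      refine Function.Embedding.nonempty_of_card_le ?_
      rw [Fintype.card_fin, ← Nat.card_eq_fintype_card]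
      exact hA.resolve_left A.finiteIndex_of_finite_quotient.index_ne_zero
    · exact ⟨(Fin.valEmbedding).trans (Infinite.natEmbedding _)⟩
  refine ⟨fun i => (e 0).out⁻¹ * (e i).out, by simp, fun i j hij h => hij (e.injective ?_)⟩
  rw [← (e i).out_eq', ← (e j).out_eq']
  exact QuotientGroup.eq.2 (by simpa [mul_assoc] using h)

/-- If `A` is a finite subgroup of `G` of index at least 5 (infinite index allowed),
a proper subgroup of `H`, and some `h ∈ H` conjugates `A` off itself, then the
amalgamated free product `G ∗_A H` contains a copy of `G ∗ F₂` extending the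
canonical copy of `G`. -/
theorem amalgamatedProduct_contains_coprod_freeGroup
    {A G H : Type*} [Group A] [Group G] [Group H]
    (ι₁ : A →* G) (ι₂ : A →* H)
    (hinj₁ : Function.Injective ι₁) (hinj₂ : Function.Injective ι₂)
    (hns₂ : ¬ Function.Surjective ι₂)
    (hidx : ι₁.range.index = 0 ∨ 5 ≤ ι₁.range.index)
    (hmal : ∃ h : H, ∀ a : A, h⁻¹ * ι₂ a * h ∈ ι₂.range → a = 1) :
    ∃ ψ : Monoid.Coprod G (FreeGroup (Fin 2)) →* AmalgamatedProduct ι₁ ι₂,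
      Function.Injective ψ ∧
      ψ.comp Monoid.Coprod.inl = AmalgamatedProduct.inl ι₁ ι₂ := by
  obtain ⟨h, hh, hmal⟩ : ∃ h ∉ ι₂.range, ∀ a : A, h⁻¹ * ι₂ a * h ∈ ι₂.range → a = 1 := by
    obtain ⟨h, hmal⟩ := hmal
    by_cases hh : h ∈ ι₂.range
    · obtain ⟨k, hk⟩ := not_forall.1 hns₂
      exact ⟨k, hk, fun a _ => hmal a (mul_mem (mul_mem (inv_mem hh) (MonoidHom.mem_range.2 ⟨a, rfl⟩)) hh)⟩
    · exact ⟨h, hh, hmal⟩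
  obtain ⟨s, hs0, hs⟩ := ι₁.range.exists_pairwise_inv_mul_notMem 4 hidx
  obtain ⟨α, _, P, ⟨p₀, hp₀⟩, hG, hH⟩ := AmalgamatedProduct.exists_mulAction hinj₁ hinj₂
  set f := AmalgamatedProduct.inl ι₁ ι₂
  set k := AmalgamatedProduct.inr ι₁ ι₂ h
  have hk : ∀ p ∉ P, k • p ∈ P := hH h hh
  have hk' : ∀ p ∉ P, k⁻¹ • p ∈ P := by
    simpa only [k, map_inv] using hH h⁻¹ (by simpa using hh)
  let Q : Fin 5 → Set α := fun i => (k * f (s i)) • P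
  have hQ : ∀ i j, i ≠ j → Disjoint (Q i) (Q j) := by
    intro i j hij
    rw [Set.disjoint_left]
    intro p hi hj
    simp only [Q, Set.mem_smul_set_iff_inv_smul_mem] at hi hj
    refine hG _ (hs i j hij) _ hj ?_
    simpa [f, smul_smul, mul_assoc] using hi
  have hQne : ∀ i, (Q i).Nonempty := fun i => ⟨_, k • p₀, hk p₀ hp₀, rfl⟩
  have move : ∀ {c : AmalgamatedProduct ι₁ ι₂}, (∀ p ∉ P, c • p ∈ P) → ∀ i j, ∀ p ∉ Q j,
      (k * f (s i) * c * (k * f (s j))⁻¹) • p ∈ Q i := by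
    intro c hc i j p hp
    rw [mul_smul, mul_smul]
    exact Set.smul_mem_smul_set (hc _ (mt Set.mem_smul_set_iff_inv_smul_mem.2 hp))
  have hfQ : ∀ g ≠ 1, ∀ i ≠ 0, ∀ p ∈ Q i, f g • p ∈ Q 0 := by
    intro g hg i hi p hp
    replace hp : k⁻¹ • p ∉ P := by
      simpa [Q, hs0, Set.mem_smul_set_iff_inv_smul_mem] using (hQ i 0 hi).notMem_of_mem_left hp
    simp only [Q, hs0, map_one, mul_one, Set.mem_smul_set_iff_inv_smul_mem]
    by_cases hgA : g ∈ ι₁.range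
    · obtain ⟨a, rfl⟩ := hgA
      have := hH _ (fun h' => hg (by rw [hmal a h', map_one])) _ hp
      rw [map_mul, map_mul, map_inv, ← AmalgamatedProduct.inl_apply_eq_inr_apply] at this
      simpa [k, smul_smul, mul_assoc] using this
    · refine hk' _ (hG g hgA p ?_)
      simpa using hk _ hp
  refine ⟨Monoid.Coprod.lift f (FreeGroup.lift fun i : Fin 2 =>
    k * f (s (![1, 3] i)) * k * (k * f (s (![2, 4] i)))⁻¹), ?_, Monoid.Coprod.lift_comp_inl _ _⟩
  refine Monoid.Coprod.lift_freeGroup_injective_of_ping_pong f _ (Q 0)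
    (fun i => Q (![1, 3] i)) (fun i => Q (![2, 4] i)) (hQne 0) (fun i => hQne _)
    (fun i => hQ _ _ (by decide +revert)) (fun i => hQ _ _ (by decide +revert))
    (fun i j hij => hQ _ _ (by decide +revert)) (fun i j hij => hQ _ _ (by decide +revert))
    (fun i j => hQ _ _ (by decide +revert)) (fun i => move hk _ _) (fun i p hp => ?_) ?_
  · simpa [mul_assoc] using move hk' (![2, 4] i) (![1, 3] i) p hp
  · have index_ne_zero : ∀ i : Fin 2, ![1, 3] i ≠ (0 : Fin 5) ∧ ![2, 4] i ≠ (0 : Fin 5) := by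
      decide
    rintro g hg i p (hp | hp)
    · exact hfQ g hg _ (index_ne_zero i).1 p hp
    · exact hfQ g hg _ (index_ne_zero i).2 p hp
end
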